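/- Let n ≥ 1, let (Ψ_π)_{π∈NC_n} be a family of wheel polynomials of order n satisfying Ψ_π(σ) = 1 if σ = π and Ψ_π(σ) = 0 if σ ≠ π, for all σ ∈ NC_n, and let π_max ∈ NC_n be the matching consisting of n little arcs, i.e., π_max(2j−1) = 2j for 1 ≤ j ≤ n. Then Ψ_{π_max}(1,1,…,1) = ASM(n−1), with the convention ASM(0) = 1. -/

import Mathlib

open scoped BigOperators

open MvPolynomial

attribute [local instance 10] Classical.propDecidable

/-- A noncrossing matching of order `n`, on the points `0, …, 2n-1`
(representing the 1-indexed points `1, …, 2n`): a fixed-point-free involution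
with no crossing `a < b < c < d`, `f a = c`, `f b = d`. -/
structure NCM (n : ℕ) where
  f : Fin (2 * n) → Fin (2 * n)
  invol : ∀ k, f (f k) = k
  nofix : ∀ k, f k ≠ k
  noncross : ∀ a b c d : Fin (2 * n), a < b → b < c → c < d → f a = c → f b = d → False

theorem NCM.ext' {n : ℕ} {π σ : NCM n} (h : π.f = σ.f) : π = σ := by
  cases π; cases σ; simpa using h

noncomputable instance {n : ℕ} : Fintype (NCM n) :=
  Fintype.ofInjective NCM.f fun _ _ h => NCM.ext' h

/-- `q = e^{2πi/3}`. -/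
noncomputable def q : ℂ := Complex.exp (2 * Real.pi * Complex.I / 3)

/-- A wheel polynomial of order `n`: homogeneous of total degree `n(n-1)` and
vanishing under every substitution `z_j := q² z_i`, `z_k := q⁴ z_i` for `i < j < k`. -/
def IsWheel (n : ℕ) (p : MvPolynomial (Fin (2 * n)) ℂ) : Prop :=
  p.IsHomogeneous (n * (n - 1)) ∧
  ∀ i j k : Fin (2 * n), i < j → j < k →
    (aeval fun l : Fin (2 * n) =>
      if l = j then C (q ^ 2) * X i
      else if l = k then C (q ^ 4) * X i
      else (X l : MvPolynomial (Fin (2 * n)) ℂ)) p = 0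

/-- The `π`-evaluation `p(π) = p(q^{-π_1}, …, q^{-π_{2n}})`, where the `k`-th coordinate
is `q⁻¹` if `π` matches `k` to the right and `q` if it matches `k` to the left. -/
noncomputable def evalNC {n : ℕ} (p : MvPolynomial (Fin (2 * n)) ℂ) (π : NCM n) : ℂ :=
  eval (fun k => if k < π.f k then q⁻¹ else q) p

/-- Evaluation of a polynomial with all variables set to `1`. -/
noncomputable def evalOne {n : ℕ} (p : MvPolynomial (Fin (2 * n)) ℂ) : ℂ :=
  eval (fun _ => (1 : ℂ)) p

/-- The alternating sign matrix numbers `ASM(n) = ∏_{j=0}^{n-1} (3j+1)!/(n+j)!`. -/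
noncomputable def ASM (n : ℕ) : ℂ :=
  ∏ j ∈ Finset.range n, ((3 * j + 1).factorial : ℂ) / ((n + j).factorial : ℂ)

/-- Cyclic successor on `Fin m`. -/
def fsucc {m : ℕ} (k : Fin m) : Fin m := ⟨((k : ℕ) + 1) % m, Nat.mod_lt _ k.pos⟩

/-- The Temperley–Lieb operator `e_k` (underlying function on points): if `π` matches
`k` with `k+1` it is `π`; otherwise it matches `k ↔ k+1`, `π(k) ↔ π(k+1)` and agrees
with `π` elsewhere (indices cyclic modulo `2n`). -/
def eRaw {n : ℕ} (k : Fin (2 * n)) (π : NCM n) : Fin (2 * n) → Fin (2 * n) :=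
  if π.f k = fsucc k then π.f
  else fun m =>
    if m = k then fsucc k
    else if m = fsucc k then k
    else if m = π.f k then π.f (fsucc k)
    else if m = π.f (fsucc k) then π.f k
    else π.f m

/-- The stationarity linear system `2n·v_π = Σ_{k=1}^{2n} Σ_{π' : e_k(π') = π} v_{π'}`. -/
def Stationary {n : ℕ} (v : NCM n → ℂ) : Prop :=
  ∀ π : NCM n, ((2 * n : ℕ) : ℂ) * v π =
    ∑ k : Fin (2 * n), ∑ π' : NCM n, if eRaw k π' = π.f then v π' else 0

theorem q_cubed : q ^ 3 = 1 := by
  unfold q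
  rw [← Complex.exp_nat_mul]
  have : ((3:ℕ):ℂ) * (2 * Real.pi * Complex.I / 3) = 2 * Real.pi * Complex.I := by push_cast; ring
  rw [this, Complex.exp_two_pi_mul_I]

theorem q_ne_one : q ≠ 1 := by
  unfold q
  intro h
  rw [Complex.exp_eq_one_iff] at h
  obtain ⟨n, hn⟩ := h
  have h2 : (2 * Real.pi * Complex.I) ≠ 0 := Complex.two_pi_I_ne_zero
  have : (1:ℂ) = 3 * n := by
    have : (2 * Real.pi * Complex.I) * (1:ℂ) = (2 * Real.pi * Complex.I) * (3 * n) := by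
      linear_combination 3 * hn
    exact mul_left_cancel₀ h2 this
  have h3 : (1:ℤ) = 3 * n := by exact_mod_cast this
  omega

theorem q_ne_zero : q ≠ 0 := by
  intro h
  have := q_cubed
  rw [h] at this
  norm_num at this

theorem q_sum : 1 + q + q ^ 2 = 0 := by
  have h : (q - 1) * (1 + q + q ^ 2) = 0 := by linear_combination q_cubed
  exact (mul_eq_zero.mp h).resolve_left (sub_ne_zero.mpr q_ne_one)

theorem q_sq : q ^ 2 = -1 - q := by linear_combination q_sum

theorem q_inv : q⁻¹ = q ^ 2 := by
  rw [inv_eq_of_mul_eq_one_right]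
  linear_combination q_cubed

theorem q_sq_ne_one : q ^ 2 ≠ 1 := by
  intro h
  have h3 := q_cubed
  apply q_ne_one
  linear_combination h3 - q * h

theorem q_sq_ne_q : q ^ 2 ≠ q := by
  intro h
  apply q_ne_one
  apply mul_left_cancel₀ q_ne_zero
  linear_combination h

/-- A continuous function vanishing off a finite set vanishes. -/
theorem cont_zero {F : ℂ → ℂ} (hF : Continuous F) {B : Set ℂ} (hB : B.Finite)
    (h : ∀ t, t ∉ B → F t = 0) (t : ℂ) : F t = 0 := by
  have hd : Dense Bᶜ := hB.countable.dense_compl ℂ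
  have : F = fun _ => 0 := by
    apply Continuous.ext_on hd hF continuous_const
    intro t ht
    exact h t ht
  exact congrFun this t

theorem cont_line (p : MvPolynomial ℕ ℂ) (z v : ℕ → ℂ) :
    Continuous fun t : ℂ => eval (fun i => z i + t * v i) p := by
  have h1 : Continuous fun x : ℕ → ℂ => eval x p := MvPolynomial.continuous_eval p
  exact h1.comp (continuous_pi fun i => by fun_prop)

theorem finite_lin {a b : ℂ} (hb : b ≠ 0) : {t : ℂ | a + t * b = 0}.Finite := by
  apply (Set.finite_singleton (-a / b)).subset
  intro t ht
  simp only [Set.mem_ofPred_eq] at ht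
  simp only [Set.mem_singleton_iff]
  field_simp
  linear_combination ht

theorem quot_zero (I : Finset (ℕ × ℂ)) (g : MvPolynomial ℕ ℂ) (z v : ℕ → ℂ)
    (hv : ∀ x ∈ I, v x.1 ≠ 0)
    (h : ∀ t : ℂ, eval (fun i => z i + t * v i) ((∏ x ∈ I, (X x.1 - C x.2)) * g) = 0) :
    eval z g = 0 := by
  have := cont_zero (cont_line g z v) (B := ⋃ x ∈ I, {t : ℂ | (z x.1 - x.2) + t * v x.1 = 0})
    (Set.Finite.biUnion I.finite_toSet fun x hx => finite_lin (hv x hx)) ?_ 0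
  · simpa using this
  · intro t ht
    have := h t
    simp only [map_mul, map_prod, map_sub, eval_X, eval_C] at this
    refine (mul_eq_zero.mp this).resolve_left ?_
    refine Finset.prod_ne_zero_iff.mpr ?_
    intro x hx h0
    apply ht
    simp only [Set.mem_iUnion]
    refine ⟨x, hx, ?_⟩
    simp only [Set.mem_ofPred_eq]
    linear_combination h0

/-- Degree of a substitution by polynomials of degree at most one. -/
theorem totalDegree_bind₁_le (f : ℕ → MvPolynomial ℕ ℂ) (hf : ∀ i, (f i).totalDegree ≤ 1)
    (p : MvPolynomial ℕ ℂ) : (bind₁ f p).totalDegree ≤ p.totalDegree := by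
  conv_lhs => rw [p.as_sum, map_sum]
  apply totalDegree_finsetSum_le
  intro d hd
  rw [bind₁_monomial]
  refine (totalDegree_mul _ _).trans ?_
  rw [totalDegree_C, zero_add]
  refine (totalDegree_finsetProd _ _).trans ?_
  refine le_trans ?_ (le_totalDegree hd)
  rw [Finsupp.sum]
  apply Finset.sum_le_sum
  intro i _
  refine (totalDegree_pow _ _).trans ?_
  simpa using Nat.mul_le_mul_left (d i) (hf i)

noncomputable def slc (i : ℕ) (a : ℂ) (p : MvPolynomial ℕ ℂ) : MvPolynomial ℕ ℂ :=
  bind₁ (fun l => if l = i then C a else X l) p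

theorem slc_deg (i : ℕ) (a : ℂ) (p : MvPolynomial ℕ ℂ) :
    (slc i a p).totalDegree ≤ p.totalDegree := by
  apply totalDegree_bind₁_le
  intro l
  split_ifs
  · simp
  · simp

theorem eval_slc (i : ℕ) (a : ℂ) (p : MvPolynomial ℕ ℂ) (z : ℕ → ℂ) :
    eval z (slc i a p) = eval (Function.update z i a) p := by
  unfold slc
  rw [← coe_aeval_eq_eval, RingHom.coe_coe, aeval_bind₁, ← coe_aeval_eq_eval, RingHom.coe_coe]
  congr 2
  ext l
  by_cases h : l = i
  · subst h; simp
  · simp [h]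

theorem X_sub_C_dvd_of (i : ℕ) (a : ℂ) (p : MvPolynomial ℕ ℂ)
    (h : ∀ z, z i = a → eval z p = 0) : (X i - C a) ∣ p := by
  have h0 : slc i a p = 0 := by
    apply MvPolynomial.funext
    intro z
    rw [eval_slc, map_zero]
    apply h
    simp
  have : ∀ r : MvPolynomial ℕ ℂ, (X i - C a) ∣ r - slc i a r := by
    intro r
    induction r using MvPolynomial.induction_on with
    | C c => simp [slc]
    | add r s hr hs =>
      have : r + s - slc i a (r + s) = (r - slc i a r) + (s - slc i a s) := by
        simp only [slc, map_add]; ring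
      rw [this]
      exact dvd_add hr hs
    | mul_X r j hr =>
      by_cases hj : j = i
      · subst hj
        have : r * X j - slc j a (r * X j) = (r - slc j a r) * C a + r * (X j - C a) := by
          simp [slc]; ring
        rw [this]
        exact dvd_add (dvd_mul_of_dvd_left hr _) (dvd_mul_left _ _)
      · have : r * X j - slc i a (r * X j) = (r - slc i a r) * X j := by
          simp [slc, hj]; ring
        rw [this]
        exact dvd_mul_of_dvd_left hr _
  have := this p
  rwa [h0, sub_zero] at this

theorem prod_dvd_of (I : Finset (ℕ × ℂ)) (p : MvPolynomial ℕ ℂ)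
    (h : ∀ x ∈ I, ∀ z : ℕ → ℂ, z x.1 = x.2 → eval z p = 0) :
    ∃ g, p = (∏ x ∈ I, (X x.1 - C x.2)) * g := by
  induction I using Finset.induction_on generalizing p with
  | empty => exact ⟨p, by simp⟩
  | insert x I hx ih =>
    obtain ⟨g, hg⟩ := X_sub_C_dvd_of x.1 x.2 p (h x (Finset.mem_insert_self _ _))
    have key : ∀ y ∈ I, ∀ z : ℕ → ℂ, z y.1 = y.2 → eval z g = 0 := by
      intro y hy z hz
      by_cases hxy : y.1 = x.1
      · have h1 := h y (Finset.mem_insert_of_mem hy) z hz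
        rw [hg] at h1
        simp only [map_mul, map_sub, eval_X, eval_C] at h1
        refine (mul_eq_zero.mp h1).resolve_left ?_
        rw [← hxy, hz]
        intro h2
        apply hx
        have : x = y := Prod.ext hxy.symm (sub_eq_zero.mp h2).symm
        rwa [this]
      · apply quot_zero {x} g z (Function.update 0 x.1 1)
        · simp
        · intro t
          rw [Finset.prod_singleton, ← hg]
          apply h y (Finset.mem_insert_of_mem hy)
          simp [hxy, hz]
    obtain ⟨g', hg'⟩ := ih g key
    refine ⟨g', ?_⟩
    rw [Finset.prod_insert hx, hg, hg', mul_assoc]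

theorem totalDegree_prod_X_sub_C (I : Finset (ℕ × ℂ)) (g : MvPolynomial ℕ ℂ) (hg : g ≠ 0) :
    ((∏ x ∈ I, (X x.1 - C x.2)) * g).totalDegree = I.card + g.totalDegree := by
  induction I using Finset.induction_on with
  | empty => simp
  | insert x I hx ih =>
    have hne : ∀ x : ℕ × ℂ, (X x.1 - C x.2 : MvPolynomial ℕ ℂ) ≠ 0 := by
      intro x h
      have := congrArg (eval fun _ => x.2 + 1) h
      simp at this
    have h1 : (X x.1 - C x.2 : MvPolynomial ℕ ℂ).totalDegree = 1 := by
      apply le_antisymm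
      · refine (totalDegree_sub _ _).trans ?_
        simp
      · by_contra hlt
        have h0 : (X x.1 - C x.2 : MvPolynomial ℕ ℂ).totalDegree = 0 := by omega
        rw [totalDegree_eq_zero_iff_eq_C] at h0
        have e1 := congrArg (eval fun _ => (0:ℂ)) h0
        have e2 := congrArg (eval fun _ => (1:ℂ)) h0
        simp only [map_sub, eval_X, eval_C] at e1 e2
        have : (1:ℂ) = 0 := by linear_combination e2 - e1
        exact one_ne_zero this
    rw [Finset.prod_insert hx, mul_assoc, totalDegree_mul_of_isDomain (hne x)
      (mul_ne_zero (Finset.prod_ne_zero_iff.mpr fun y _ => hne y) hg), ih, h1,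
      Finset.card_insert_of_notMem hx]
    ring

def WheelOn (s : Finset ℕ) (p : MvPolynomial ℕ ℂ) : Prop :=
  ∀ i ∈ s, ∀ j ∈ s, ∀ k ∈ s, i < j → j < k → ∀ z : ℕ → ℂ,
    z j = q ^ 2 * z i → z k = q * z i → eval z p = 0

def Van (i j : ℕ) (p : MvPolynomial ℕ ℂ) : Prop :=
  ∀ z : ℕ → ℂ, z j = q ^ 2 * z i → eval z p = 0

inductive NCw : Finset ℕ → (ℕ → ℂ) → Prop
  | nil (z : ℕ → ℂ) : NCw ∅ z
  | cons (s : Finset ℕ) (z : ℕ → ℂ) (i j : ℕ) : i ∈ s → j ∈ s → i < j →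
      (∀ k ∈ s, ¬ (i < k ∧ k < j)) → z i = q ^ 2 → z j = q →
      NCw ((s.erase i).erase j) z → NCw s z

theorem NCw.val {s : Finset ℕ} {z : ℕ → ℂ} (h : NCw s z) : ∀ k ∈ s, z k = q ^ 2 ∨ z k = q := by
  induction h with
  | nil z => simp
  | cons s z i j hi hj hij hadj hzi hzj h ih =>
    intro k hk
    by_cases h1 : k = i
    · left; rw [h1, hzi]
    by_cases h2 : k = j
    · right; rw [h2, hzj]
    exact ih k (by simp [h1, h2, hk])

theorem NCw.congr {s : Finset ℕ} {z z' : ℕ → ℂ} (h : NCw s z) (h' : ∀ k ∈ s, z k = z' k) :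
    NCw s z' := by
  induction h with
  | nil z => exact NCw.nil _
  | cons s z i j hi hj hij hadj hzi hzj h ih =>
    refine NCw.cons s z' i j hi hj hij hadj ?_ ?_ (ih ?_)
    · rw [← h' i hi, hzi]
    · rw [← h' j hj, hzj]
    · intro k hk
      exact h' k (Finset.mem_of_mem_erase (Finset.mem_of_mem_erase hk))

theorem pair_slice (s : Finset ℕ) (p : MvPolynomial ℕ ℂ) (hp : WheelOn s p) (i j : ℕ)
    (hi : i ∈ s) (hj : j ∈ s) (hij : i < j)
    (hbet : ∀ k ∈ s, i < k → k < j → Van i k p ∧ Van k j p) (c : ℂ) (hc : c ≠ 0) :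
    ∃ g : MvPolynomial ℕ ℂ,
      (g ≠ 0 → g.totalDegree + ((s.erase i).erase j).card +
        (s.filter (fun k => i < k ∧ k < j)).card ≤ p.totalDegree) ∧
      WheelOn ((s.erase i).erase j) g ∧
      (g = 0 → slc i c (slc j (q ^ 2 * c) p) = 0) ∧
      ((∀ k ∈ s, ¬ (i < k ∧ k < j)) → ∀ z : ℕ → ℂ, (∀ k ∈ (s.erase i).erase j, z k ≠ q * c) →
        eval z (slc i c (slc j (q ^ 2 * c) p)) = 0 → eval z g = 0) := by
  set f := slc i c (slc j (q ^ 2 * c) p) with hf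
  have hev : ∀ z, eval z f = eval (Function.update (Function.update z i c) j (q ^ 2 * c)) p := by
    intro z; rw [hf, eval_slc, eval_slc]
  set s' := (s.erase i).erase j with hs'
  set B := s.filter (fun k => i < k ∧ k < j) with hB
  have hne : i ≠ j := hij.ne
  have hq3 := q_cubed
  set I1 : Finset (ℕ × ℂ) := s'.image (fun k => (k, if i < k ∧ k < j then q ^ 2 * c else q * c))
    with hI1
  set I2 : Finset (ℕ × ℂ) := B.image (fun k => (k, c)) with hI2
  have hdisj : Disjoint I1 I2 := by
    rw [Finset.disjoint_left]
    intro x hx1 hx2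
    simp only [hI1, hI2, Finset.mem_image] at hx1 hx2
    obtain ⟨k, hk, rfl⟩ := hx1
    obtain ⟨k', hk', he⟩ := hx2
    rw [Prod.mk.injEq] at he
    obtain ⟨-, he⟩ := he
    split_ifs at he
    · apply q_sq_ne_one
      apply mul_right_cancel₀ hc
      linear_combination -he
    · apply q_ne_one
      apply mul_right_cancel₀ hc
      linear_combination -he
  have hc1 : I1.card = s'.card :=
    Finset.card_image_of_injOn fun a _ b _ h => (Prod.mk.inj h).1
  have hc2 : I2.card = B.card :=
    Finset.card_image_of_injOn fun a _ b _ h => (Prod.mk.inj h).1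
  have hBs' : ∀ k ∈ B, k ∈ s' := by
    intro k hk
    simp only [hB, Finset.mem_filter] at hk
    simp only [hs', Finset.mem_erase]
    exact ⟨by omega, by omega, hk.1⟩
  have hmem : ∀ x ∈ I1 ∪ I2, x.1 ∈ s' := by
    intro x hx
    rw [Finset.mem_union] at hx
    rcases hx with hx | hx
    · simp only [hI1, Finset.mem_image] at hx
      obtain ⟨k, hk, rfl⟩ := hx
      exact hk
    · simp only [hI2, Finset.mem_image] at hx
      obtain ⟨k, hk, rfl⟩ := hx
      exact hBs' k hk
  obtain ⟨g, hg⟩ := prod_dvd_of (I1 ∪ I2) f (by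
    intro x hx z hz
    rw [hev]
    have hxs := hmem x hx
    simp only [hs', Finset.mem_erase] at hxs
    rw [Finset.mem_union] at hx
    rcases hx with hx | hx
    · simp only [hI1, Finset.mem_image] at hx
      obtain ⟨k, hk, rfl⟩ := hx
      simp only at hz hxs
      split_ifs at hz with hik
      · apply (hbet k hxs.2.2 hik.1 hik.2).1
        simp [hxs.1, hxs.2.1, hz, hne]
      · have : k < i ∨ j < k := by
          rcases lt_or_ge k i with h | h
          · exact Or.inl h
          · right
            by_contra h'
            apply hik
            have h1 := hxs.1
            have h2 := hxs.2.1
            omega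
        rcases this with h | h
        · apply hp k hxs.2.2 i hi j hj h hij
          · simp [hxs.1, hxs.2.1, hz, hne]; linear_combination -c * hq3
          · simp [hxs.1, hxs.2.1, hz]; ring
        · apply hp i hi j hj k hxs.2.2 hij h
          · simp [hne]
          · simp [hne, hxs.1, hxs.2.1, hz]
    · simp only [hI2, Finset.mem_image] at hx
      obtain ⟨k, hk, rfl⟩ := hx
      simp only [hB, Finset.mem_filter] at hk
      simp only at hz hxs
      apply (hbet k hk.1 hk.2.1 hk.2.2).2
      simp [hxs.1, hxs.2.1, hz])
  refine ⟨g, ?_, ?_, ?_, ?_⟩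
  · intro hg0
    have h1 := totalDegree_prod_X_sub_C (I1 ∪ I2) g hg0
    rw [← hg, Finset.card_union_of_disjoint hdisj, hc1, hc2] at h1
    have h2 : f.totalDegree ≤ p.totalDegree := (slc_deg _ _ _).trans (slc_deg _ _ _)
    omega
  · intro i' hi' j' hj' k' hk' hij' hjk' z hzj hzk
    apply quot_zero (I1 ∪ I2) g z (fun l => if l = j' then q ^ 2 else if l = k' then q else 1)
    · intro x _
      have := q_ne_zero
      split_ifs <;> simp [this]
    · intro t
      rw [← hg, hev]
      simp only [hs', Finset.mem_erase] at hi' hj' hk'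
      have e1 : i' ≠ k' := by omega
      have e2 : i' ≠ j' := by omega
      have e3 : k' ≠ j' := by omega
      apply hp i' hi'.2.2 j' hj'.2.2 k' hk'.2.2 hij' hjk'
      · simp [hi'.1, hi'.2.1, hj'.1, hj'.2.1, e1, e2, hzj]; ring
      · simp [hi'.1, hi'.2.1, hk'.1, hk'.2.1, e1, e2, e3, hzk]; ring
  · intro h0
    rw [hg, h0, mul_zero]
  · intro hadj z hz h0
    rw [hg, map_mul] at h0
    refine (mul_eq_zero.mp h0).resolve_left ?_
    rw [map_prod]
    refine Finset.prod_ne_zero_iff.mpr ?_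
    intro x hx
    have hxs := hmem x hx
    rw [Finset.mem_union] at hx
    rcases hx with hx | hx
    · simp only [hI1, Finset.mem_image] at hx
      obtain ⟨k, hk, rfl⟩ := hx
      have hks : k ∈ s := Finset.mem_of_mem_erase (Finset.mem_of_mem_erase hk)
      rw [if_neg (hadj k hks)]
      simp only [map_sub, eval_X, eval_C]
      exact sub_ne_zero.mpr (hz k hk)
    · simp only [hI2, Finset.mem_image] at hx
      obtain ⟨k, hk, rfl⟩ := hx
      simp only [hB, Finset.mem_filter] at hk
      exact absurd hk.2 (hadj k hk.1)

/-- Vanishing of slices for nonzero values gives `Van`. -/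
theorem van_of_slices (i j : ℕ) (hij : i ≠ j) (p : MvPolynomial ℕ ℂ)
    (h : ∀ c : ℂ, c ≠ 0 → slc i c (slc j (q ^ 2 * c) p) = 0) : Van i j p := by
  intro z hz
  have := cont_zero (cont_line p z (fun l => if l = j then q ^ 2 else 1))
    (B := {t : ℂ | z i + t * 1 = 0}) (finite_lin one_ne_zero) (by
      intro t ht
      simp only [Set.mem_ofPred_eq] at ht
      have h1 := congrArg (eval (fun l => z l + t * (if l = j then q ^ 2 else 1)))
        (h (z i + t * 1) ht)
      rw [eval_slc, eval_slc, map_zero] at h1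
      rw [← h1]
      congr 2
      ext l
      by_cases hl : l = j
      · subst hl; simp [hz]; ring
      · by_cases hl' : l = i
        · subst hl'; simp [hl]
        · simp [hl, hl']) 0
  simpa using this

theorem van_all_zero (N : ℕ) : ∀ (s : Finset ℕ), s.card = N → ∀ p : MvPolynomial ℕ ℂ,
    (∀ i ∈ s, ∀ j ∈ s, i < j → Van i j p) → 2 * p.totalDegree < N * (N - 1) → p = 0 := by
  induction N with
  | zero => intro s _ p _ h; simp at h
  | succ N ih =>
    intro s hs p hv hd
    have hne : s.Nonempty := by rw [← Finset.card_pos]; omega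
    set i := s.min' hne with hi
    have his : i ∈ s := s.min'_mem hne
    have hlt : ∀ k ∈ s.erase i, i < k := by
      intro k hk
      exact s.min'_lt_of_mem_erase_min' hne hk
    have hcard : (s.erase i).card = N := by rw [Finset.card_erase_of_mem his]; omega
    have key : ∀ c, slc i c p = 0 := by
      intro c
      set I : Finset (ℕ × ℂ) := (s.erase i).image (fun k => (k, q ^ 2 * c)) with hI
      have hIc : I.card = N := by
        rw [← hcard]; exact Finset.card_image_of_injOn fun a _ b _ h => (Prod.mk.inj h).1
      obtain ⟨g, hg⟩ := prod_dvd_of I (slc i c p) (by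
        intro x hx z hz
        simp only [hI, Finset.mem_image] at hx
        obtain ⟨k, hk, rfl⟩ := hx
        rw [eval_slc]
        apply hv i his k (Finset.mem_of_mem_erase hk) (hlt k hk)
        have := (hlt k hk).ne'
        simp only at hz
        simp [this, hz])
      by_contra hne0
      have hg0 : g ≠ 0 := by
        intro h; apply hne0; rw [hg, h, mul_zero]
      have h1 := totalDegree_prod_X_sub_C I g hg0
      rw [← hg, hIc] at h1
      have h2 := slc_deg i c p
      apply hg0
      apply ih (s.erase i) hcard g
      · intro a ha b hb hab z hz
        apply quot_zero I g z (fun l => if l = b then q ^ 2 else 1)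
        · intro x _
          have := q_ne_zero
          split_ifs <;> simp [this]
        · intro t
          rw [← hg, eval_slc]
          apply hv a (Finset.mem_of_mem_erase ha) b (Finset.mem_of_mem_erase hb) hab
          have e1 := (hlt a ha).ne'
          have e2 := (hlt b hb).ne'
          simp [e1, e2, hab.ne, hz]; ring
      · rcases N with _ | N
        · simp at hd
        · simp only [Nat.add_sub_cancel] at hd ⊢
          nlinarith
    apply MvPolynomial.funext
    intro z
    have := congrArg (eval z) (key (z i))
    rw [eval_slc] at this
    simpa using this

theorem card_erase2 {s : Finset ℕ} {i j m : ℕ} (hi : i ∈ s) (hj : j ∈ s) (hij : i < j)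
    (hs : s.card = 2 * (m + 1)) : ((s.erase i).erase j).card = 2 * m := by
  rw [Finset.card_erase_of_mem (Finset.mem_erase.mpr ⟨hij.ne', hj⟩), Finset.card_erase_of_mem hi]
  omega

theorem card_between_lt {s : Finset ℕ} {i j k : ℕ} (hk : k ∈ s) (h1 : i < k) (h2 : k < j) :
    (s.filter (fun l => i < l ∧ l < k)).card < (s.filter (fun l => i < l ∧ l < j)).card ∧
    (s.filter (fun l => k < l ∧ l < j)).card < (s.filter (fun l => i < l ∧ l < j)).card := by
  constructor
  · apply Finset.card_lt_card
    rw [Finset.ssubset_iff_of_subset]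
    · exact ⟨k, by simp [hk, h1, h2], by simp⟩
    · intro l; simp only [Finset.mem_filter]; intro h; exact ⟨h.1, h.2.1, by omega⟩
  · apply Finset.card_lt_card
    rw [Finset.ssubset_iff_of_subset]
    · exact ⟨k, by simp [hk, h1, h2], by simp⟩
    · intro l; simp only [Finset.mem_filter]; intro h; exact ⟨h.1, by omega, h.2.2⟩

theorem wheel_strict (m : ℕ) : ∀ (s : Finset ℕ), s.card = 2 * m → ∀ p : MvPolynomial ℕ ℂ,
    WheelOn s p → p.totalDegree < m * (m - 1) → p = 0 := by
  induction m with
  | zero => intro s _ p _ h; simp at h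
  | succ m ih =>
    intro s hs p hw hd
    have key : ∀ b i j, i ∈ s → j ∈ s → i < j →
        (s.filter (fun l => i < l ∧ l < j)).card = b → Van i j p := by
      intro b
      induction b using Nat.strong_induction_on with
      | _ b ihb =>
        intro i j hi hj hij hb
        apply van_of_slices i j hij.ne
        intro c hc
        obtain ⟨g, hg1, hg2, hg3, -⟩ := pair_slice s p hw i j hi hj hij (by
          intro k hk h1 h2
          have := card_between_lt hk h1 h2
          exact ⟨ihb _ (by omega) i k hi hk h1 rfl, ihb _ (by omega) k j hk hj h2 rfl⟩) c hc
        apply hg3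
        by_contra hg0
        have h1 := hg1 hg0
        have h2 := card_erase2 hi hj hij hs
        apply hg0
        apply ih _ h2 g hg2
        simp only [Nat.add_sub_cancel] at hd
        rcases m with _ | m
        · omega
        · simp only [Nat.add_sub_cancel]
          nlinarith
    apply van_all_zero _ s hs p (fun i hi j hj hij => key _ i j hi hj hij rfl)
    have : 2 * (m + 1) - 1 = 2 * m + 1 := by omega
    rw [this]
    simp only [Nat.add_sub_cancel] at hd
    nlinarith

theorem hom_scale {p : MvPolynomial ℕ ℂ} {d : ℕ} (hp : p.IsHomogeneous d) (t : ℂ) (z : ℕ → ℂ) :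
    eval (fun l => t * z l) p = t ^ d * eval z p := by
  rw [eval_eq, eval_eq, Finset.mul_sum]
  apply Finset.sum_congr rfl
  intro a ha
  have h1 : ∑ i ∈ a.support, a i = d := by
    have := hp (mem_support_iff.mp ha)
    rw [Finsupp.weight_apply, Finsupp.sum] at this
    simpa using this
  simp only [mul_pow, Finset.prod_mul_distrib]
  rw [Finset.prod_pow_eq_pow_sum, ← h1]
  ring

theorem wheel_comp {s : Finset ℕ} {p : MvPolynomial ℕ ℂ} (hw : WheelOn s p) (e : ℕ) :
    WheelOn s (homogeneousComponent e p) := by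
  intro i hi j hj k hk hij hjk z hzj hzk
  set P : Polynomial ℂ := ∑ d ∈ Finset.range (p.totalDegree + 1),
    Polynomial.C (eval z (homogeneousComponent d p)) * Polynomial.X ^ d with hP
  have hP0 : P = 0 := by
    apply Polynomial.funext
    intro t
    have h0 : eval (fun l => t * z l) p = 0 := by
      apply hw i hi j hj k hk hij hjk
      · rw [hzj]; ring
      · rw [hzk]; ring
    conv_lhs at h0 => rw [← sum_homogeneousComponent p, map_sum]
    rw [hP, Polynomial.eval_finsetSum, Polynomial.eval_zero, ← h0]
    apply Finset.sum_congr rfl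
    intro d _
    rw [Polynomial.eval_mul, Polynomial.eval_C, Polynomial.eval_pow, Polynomial.eval_X]
    rw [hom_scale (homogeneousComponent_isHomogeneous d p), mul_comm]
  have hco : P.coeff e = 0 := by rw [hP0]; simp
  rw [hP, Polynomial.finsetSum_coeff] at hco
  simp only [Polynomial.coeff_C_mul, Polynomial.coeff_X_pow, mul_ite, mul_one, mul_zero,
    Finset.sum_ite_eq, Finset.mem_range] at hco
  split_ifs at hco with h
  · exact hco
  · rw [homogeneousComponent_eq_zero _ _ (by omega), map_zero]

theorem wheel_unique (m : ℕ) : ∀ (s : Finset ℕ), s.card = 2 * m → ∀ p : MvPolynomial ℕ ℂ,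
    WheelOn s p → p.totalDegree ≤ m * (m - 1) → (∀ z, NCw s z → eval z p = 0) → p = 0 := by
  induction m with
  | zero =>
    intro s hs p _ _ h
    have : s = ∅ := Finset.card_eq_zero.mp (by omega)
    subst this
    apply MvPolynomial.funext
    intro z
    rw [h z (NCw.nil z), map_zero]
  | succ m ih =>
    intro s hs p hw hd hnc
    simp only [Nat.add_sub_cancel] at hd
    have hhom : p.IsHomogeneous ((m + 1) * m) := by
      have : p = homogeneousComponent ((m + 1) * m) p := by
        conv_lhs => rw [← sum_homogeneousComponent p]
        rw [Finset.sum_eq_single ((m + 1) * m)]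
        · intro e he hne
          rw [Finset.mem_range] at he
          apply wheel_strict (m + 1) s hs _ (wheel_comp hw e)
          have := (homogeneousComponent_isHomogeneous e p).totalDegree_le
          simp only [Nat.add_sub_cancel]
          omega
        · intro h
          rw [Finset.mem_range] at h
          apply homogeneousComponent_eq_zero
          omega
      rw [this]
      exact homogeneousComponent_isHomogeneous _ _
    have hq3 := q_cubed
    have key : ∀ b i j, i ∈ s → j ∈ s → i < j →
        (s.filter (fun l => i < l ∧ l < j)).card = b → Van i j p := by
      intro b
      induction b using Nat.strong_induction_on with
      | _ b ihb =>
        intro i j hi hj hij hb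
        apply van_of_slices i j hij.ne
        have hcard := card_erase2 hi hj hij hs
        have hps := pair_slice s p hw i j hi hj hij (by
          intro k hk h1 h2
          have := card_between_lt hk h1 h2
          exact ⟨ihb _ (by omega) i k hi hk h1 rfl, ihb _ (by omega) k j hk hj h2 rfl⟩)
        rcases Nat.eq_zero_or_pos b with hb0 | hb0
        · have hadj : ∀ k ∈ s, ¬ (i < k ∧ k < j) := by
            intro k hk h
            rw [hb0, Finset.card_eq_zero] at hb
            have : k ∈ s.filter (fun l => i < l ∧ l < j) := by simp [hk, h]
            rw [hb] at this
            simp at this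
          have hone : slc i (q ^ 2) (slc j (q ^ 2 * q ^ 2) p) = 0 := by
            obtain ⟨g, hg1, hg2, hg3, hg4⟩ := hps (q ^ 2) (pow_ne_zero 2 q_ne_zero)
            apply hg3
            by_contra hg0
            apply hg0
            have h1 := hg1 hg0
            refine ih _ hcard g hg2 ?_ ?_
            · rcases m with _ | m
              · simp at hd ⊢; omega
              · simp only [Nat.add_sub_cancel]
                nlinarith
            · intro z hz
              apply hg4 hadj
              · intro k hk
                have e : q * q ^ 2 = 1 := by linear_combination hq3
                rw [e]
                rcases hz.val k hk with h | h
                · rw [h]; exact q_sq_ne_one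
                · rw [h]; exact q_ne_one
              · rw [eval_slc, eval_slc]
                apply hnc
                refine NCw.cons s _ i j hi hj hij hadj ?_ ?_ (hz.congr ?_)
                · simp [hij.ne]
                · simp; linear_combination q * hq3
                · intro k hk
                  simp only [Finset.mem_erase] at hk
                  simp [hk.1, hk.2.1]
          intro c hc
          apply MvPolynomial.funext
          intro z
          have h1 := congrArg (eval (fun l => (c * q)⁻¹ * z l)) hone
          rw [map_zero, eval_slc, eval_slc] at h1
          rw [map_zero, eval_slc, eval_slc]
          have hcq : c * q ≠ 0 := mul_ne_zero hc q_ne_zero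
          have h2 := hom_scale hhom (c * q) (Function.update
            (Function.update (fun l => (c * q)⁻¹ * z l) i (q ^ 2)) j (q ^ 2 * q ^ 2))
          rw [h1, mul_zero] at h2
          rw [← h2]
          congr 2
          ext l
          by_cases hl : l = j
          · subst hl; simp; linear_combination - c * q ^ 2 * hq3
          · by_cases hl' : l = i
            · subst hl'; simp [hl]; linear_combination - c * hq3
            · simp only [Function.update, hl, hl', dite_false]
              rw [← mul_assoc, mul_inv_cancel₀ hcq, one_mul]
        · intro c hc
          obtain ⟨g, hg1, hg2, hg3, -⟩ := hps c hc
          apply hg3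
          by_contra hg0
          have h1 := hg1 hg0
          apply hg0
          apply wheel_strict m _ hcard g hg2
          rcases m with _ | m
          · simp at hd; omega
          · simp only [Nat.add_sub_cancel]
            nlinarith
    apply van_all_zero _ s hs p (fun i hi j hj hij => key _ i j hi hj hij rfl)
    have : 2 * (m + 1) - 1 = 2 * m + 1 := by omega
    rw [this]
    nlinarith

theorem prod_cancel {α β R : Type*} [CommMonoid R] [DecidableEq β] (I : Finset β) (A : Finset α)
    (κ : α → β) (hI : ∀ l ∈ A, κ l ∈ I) (hinj : Set.InjOn κ A) (g : β → R) (c : β → Prop)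
    [DecidablePred c] (hc : ∀ i ∈ I, c i ↔ ∃ l ∈ A, κ l = i) :
    (∏ i ∈ I, if c i then 1 else g i) * ∏ l ∈ A, g (κ l) = ∏ i ∈ I, g i := by
  have h1 : ∏ l ∈ A, g (κ l) = ∏ i ∈ I, if c i then g i else 1 := by
    rw [← Finset.prod_filter]
    have : I.filter c = A.image κ := by
      ext i
      simp only [Finset.mem_filter, Finset.mem_image]
      constructor
      · rintro ⟨h1, h2⟩; exact (hc i h1).mp h2
      · rintro ⟨l, hl, rfl⟩; exact ⟨hI l hl, (hc _ (hI l hl)).mpr ⟨l, hl, rfl⟩⟩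
    rw [this, Finset.prod_image (fun a ha b hb h => hinj ha hb h)]
  rw [h1, ← Finset.prod_mul_distrib]
  apply Finset.prod_congr rfl
  intro i _
  split_ifs <;> simp

/-- One variable divided differences are polynomial. -/
theorem dd_one {τ : Type*} [DecidableEq τ] (A : Finset τ) (r : ℕ) :
    ∃ h : MvPolynomial τ ℂ, ∀ z : τ → ℂ, Set.InjOn z A →
      eval z h = ∑ k ∈ A, z k ^ r / ∏ i ∈ A.erase k, (z k - z i) := by
  set g : Polynomial (MvPolynomial τ ℂ) := ∏ i ∈ A, (Polynomial.X - Polynomial.C (X i)) with hg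
  have hgm : g.Monic := Polynomial.monic_prod_X_sub_C _ _
  refine ⟨((Polynomial.X ^ r) %ₘ g).coeff (A.card - 1), ?_⟩
  intro z hz
  have hmap : Polynomial.map (eval z) g = ∏ i ∈ A, (Polynomial.X - Polynomial.C (z i)) := by
    simp [hg, Polynomial.map_prod]
  have hgm' : (∏ i ∈ A, (Polynomial.X - Polynomial.C (z i))).Monic :=
    Polynomial.monic_prod_X_sub_C _ _
  rw [← Polynomial.coeff_map, Polynomial.map_modByMonic _ hgm, hmap, Polynomial.map_pow,
    Polynomial.map_X]
  set G := ∏ i ∈ A, (Polynomial.X - Polynomial.C (z i)) with hG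
  rw [Lagrange.coeff_eq_sum hz]
  · apply Finset.sum_congr rfl
    intro k hk
    congr 1
    have h1 := congrArg (Polynomial.eval (z k)) (Polynomial.modByMonic_add_div (Polynomial.X ^ r) G)
    rw [Polynomial.eval_add, Polynomial.eval_mul, Polynomial.eval_pow, Polynomial.eval_X] at h1
    have h2 : G.eval (z k) = 0 := by
      rw [hG, Polynomial.eval_prod]
      exact Finset.prod_eq_zero hk (by simp)
    rw [h2, zero_mul, add_zero] at h1
    exact h1
  · refine (Polynomial.degree_modByMonic_lt _ hgm').trans_le ?_
    rw [hG, Polynomial.degree_prod]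
    simp

/-- Substitution homomorphism. -/
noncomputable def phi {Λ τ : Type*} (z : τ → ℂ) (κ : Λ → τ) :
    MvPolynomial Λ (MvPolynomial τ ℂ) →+* ℂ :=
  eval₂Hom (eval z) (fun l => z (κ l))

theorem dd_all {Λ τ : Type*} [Fintype Λ] [DecidableEq Λ] [DecidableEq τ] (A : Λ → Finset τ)
    (T : MvPolynomial Λ (MvPolynomial τ ℂ)) :
    ∃ Q : MvPolynomial τ ℂ, ∀ z : τ → ℂ, (∀ l, Set.InjOn z (A l)) →
      eval z Q = ∑ κ ∈ Fintype.piFinset A,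
        phi z κ T / ∏ l, ∏ i ∈ (A l).erase (κ l), (z (κ l) - z i) := by
  induction T using MvPolynomial.induction_on' with
  | monomial u a =>
    choose h hh using fun l => dd_one (A l) (u l)
    refine ⟨a * ∏ l, h l, ?_⟩
    intro z hz
    rw [map_mul, map_prod]
    have h1 : ∏ l, eval z (h l) =
        ∏ l, ∑ k ∈ A l, z k ^ (u l) / ∏ i ∈ (A l).erase k, (z k - z i) :=
      Finset.prod_congr rfl fun l _ => hh l z (hz l)
    rw [h1, Finset.prod_univ_sum, Finset.mul_sum]
    apply Finset.sum_congr rfl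
    intro κ _
    rw [Finset.prod_div_distrib, phi, coe_eval₂Hom, eval₂_monomial,
      Finsupp.prod_fintype _ _ (fun l => pow_zero _), mul_div_assoc]
  | add p r hp hr =>
    obtain ⟨Q1, h1⟩ := hp
    obtain ⟨Q2, h2⟩ := hr
    refine ⟨Q1 + Q2, ?_⟩
    intro z hz
    rw [map_add, h1 z hz, h2 z hz, ← Finset.sum_add_distrib]
    apply Finset.sum_congr rfl
    intro κ _
    rw [map_add, add_div]

theorem Gpoly {Λ τ : Type*} [DecidableEq τ] (I : Finset τ) (A : Finset Λ)
    (x : MvPolynomial Λ (MvPolynomial τ ℂ)) :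
    ∃ G : MvPolynomial Λ (MvPolynomial τ ℂ), ∀ (z : τ → ℂ) (κ : Λ → τ),
      (∀ l ∈ A, κ l ∈ I) → Set.InjOn κ A → ∀ (c : τ → Prop) [DecidablePred c],
      (∀ i ∈ I, c i ↔ ∃ l ∈ A, κ l = i) →
      phi z κ G = ∏ i ∈ I, if c i then 1 else z i - phi z κ x := by
  set f : Polynomial (MvPolynomial Λ (MvPolynomial τ ℂ)) :=
    ∏ i ∈ I, (Polynomial.X - Polynomial.C (C (X i))) with hf
  set g : Polynomial (MvPolynomial Λ (MvPolynomial τ ℂ)) :=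
    ∏ l ∈ A, (Polynomial.X - Polynomial.C (X l)) with hg
  have hgm : g.Monic := Polynomial.monic_prod_X_sub_C _ _
  refine ⟨(-1) ^ (I.card + A.card) * (f /ₘ g).eval x, ?_⟩
  intro z κ hκ hinj c _ hc
  have h1 := prod_cancel I A κ hκ hinj (fun i => Polynomial.X - Polynomial.C (z i)) c hc
  have h2 := prod_cancel I A κ hκ hinj (fun _ => (-1 : ℂ)) c hc
  have hmf : Polynomial.map (phi z κ) f = ∏ i ∈ I, (Polynomial.X - Polynomial.C (z i)) := by
    simp [hf, Polynomial.map_prod, phi]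
  have hmg : Polynomial.map (phi z κ) g = ∏ l ∈ A, (Polynomial.X - Polynomial.C (z (κ l))) := by
    simp [hg, Polynomial.map_prod, phi]
  have h3 : Polynomial.map (phi z κ) (f /ₘ g) =
      ∏ i ∈ I, if c i then 1 else (Polynomial.X - Polynomial.C (z i)) := by
    rw [Polynomial.map_divByMonic _ hgm, hmf, hmg, ← h1, mul_comm]
    exact Polynomial.mul_divByMonic_cancel_left _ (Polynomial.monic_prod_X_sub_C _ _)
  have h4 : phi z κ ((f /ₘ g).eval x) = ∏ i ∈ I, if c i then 1 else (phi z κ x - z i) := by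
    rw [← Polynomial.eval_map_apply, h3, Polynomial.eval_prod]
    apply Finset.prod_congr rfl
    intro i _
    split_ifs <;> simp
  simp only [Finset.prod_const] at h2
  have h5 : (-1 : ℂ) ^ (I.card + A.card) = ∏ i ∈ I, if c i then 1 else (-1 : ℂ) := by
    rw [pow_add, ← h2, mul_assoc, ← mul_pow]
    simp
  rw [map_mul, map_pow, map_neg, map_one, h4, h5, ← Finset.prod_mul_distrib]
  apply Finset.prod_congr rfl
  intro i _
  split_ifs <;> simp


section Kernel
variable {M : ℕ}

/-- Allowed positions of the integration labels. -/
def Ak (s : Finset ℕ) (L : Finset (Fin M)) (b : Fin M → ℕ) (l : Fin M) : Finset ℕ :=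
  if l ∈ L then s.filter (· < b l) else {0}

noncomputable def prs (L : Finset (Fin M)) (z : ℕ → ℂ) (κ : Fin M → ℕ) : ℂ :=
  ∏ l ∈ L, ∏ l' ∈ L.filter (l < ·), ((z (κ l') - z (κ l)) * (z (κ l) - q * z (κ l')))

noncomputable def Ek (s : Finset ℕ) (L : Finset (Fin M)) (b : Fin M → ℕ) (z : ℕ → ℂ)
    (κ : Fin M → ℕ) : ℂ :=
  ∏ j ∈ s, ∏ i ∈ s.filter (· < j), if ∃ l ∈ L, κ l = i ∧ b l ≤ j then 1 else z i - q * z j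

noncomputable def den (s : Finset ℕ) (L : Finset (Fin M)) (b : Fin M → ℕ) (z : ℕ → ℂ)
    (κ : Fin M → ℕ) : ℂ :=
  ∏ l ∈ L, ∏ i ∈ (s.filter (· < b l)).erase (κ l), (z (κ l) - z i)

noncomputable def Fk (s : Finset ℕ) (L : Finset (Fin M)) (b : Fin M → ℕ) (z : ℕ → ℂ)
    (κ : Fin M → ℕ) : ℂ := prs L z κ * Ek s L b z κ / den s L b z κ

noncomputable def Psum (s : Finset ℕ) (L : Finset (Fin M)) (b : Fin M → ℕ) (z : ℕ → ℂ) : ℂ :=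
  ∑ κ ∈ Fintype.piFinset (Ak s L b), Fk s L b z κ

theorem mem_Ak {s : Finset ℕ} {L : Finset (Fin M)} {b : Fin M → ℕ} {κ : Fin M → ℕ}
    (h : κ ∈ Fintype.piFinset (Ak s L b)) {l : Fin M} (hl : l ∈ L) : κ l ∈ s ∧ κ l < b l := by
  rw [Fintype.mem_piFinset] at h
  have := h l
  simpa [Ak, hl] using this

theorem mem_Ak' {s : Finset ℕ} {L : Finset (Fin M)} {b : Fin M → ℕ} {κ : Fin M → ℕ}
    (h : κ ∈ Fintype.piFinset (Ak s L b)) {l : Fin M} (hl : l ∉ L) : κ l = 0 := by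
  rw [Fintype.mem_piFinset] at h
  have := h l
  simpa [Ak, hl] using this

theorem prs_zero_of {L : Finset (Fin M)} {z : ℕ → ℂ} {κ : Fin M → ℕ} {l l' : Fin M} (hl : l ∈ L)
    (hl' : l' ∈ L) (hlt : l < l') (h : z (κ l') = z (κ l) ∨ z (κ l) = q * z (κ l')) :
    prs L z κ = 0 := by
  unfold prs
  apply Finset.prod_eq_zero hl
  apply Finset.prod_eq_zero (Finset.mem_filter.mpr ⟨hl', hlt⟩)
  rcases h with h | h
  · rw [h]; ring
  · rw [h]; ring

theorem prs_zero_of_not_inj {L : Finset (Fin M)} {z : ℕ → ℂ} {κ : Fin M → ℕ}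
    (h : ¬ Set.InjOn κ L) : prs L z κ = 0 := by
  rw [Set.InjOn] at h
  push Not at h
  obtain ⟨l, hl, l', hl', he, hne⟩ := h
  rcases lt_or_gt_of_ne hne with h1 | h1
  · exact prs_zero_of hl hl' h1 (Or.inl (by rw [he]))
  · exact prs_zero_of hl' hl h1 (Or.inl (by rw [he]))

theorem num_poly (s : Finset ℕ) (L : Finset (Fin M)) (b : Fin M → ℕ) :
    ∃ T : MvPolynomial (Fin M) (MvPolynomial ℕ ℂ), ∀ z κ, κ ∈ Fintype.piFinset (Ak s L b) →
      phi z κ T = prs L z κ * Ek s L b z κ := by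
  choose G hG using fun j : ℕ => Gpoly (s.filter (· < j)) (L.filter (fun l => b l ≤ j))
    (C (C q * X j) : MvPolynomial (Fin M) (MvPolynomial ℕ ℂ))
  refine ⟨(∏ l ∈ L, ∏ l' ∈ L.filter (l < ·), ((X l' - X l) * (X l - C (C q) * X l'))) *
    ∏ j ∈ s, G j, ?_⟩
  intro z κ hκ
  have h1 : phi z κ (∏ l ∈ L, ∏ l' ∈ L.filter (l < ·), ((X l' - X l) * (X l - C (C q) * X l'))) =
      prs L z κ := by
    simp [phi, prs, map_prod]
  rw [map_mul, h1]
  by_cases hinj : Set.InjOn κ L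
  · congr 1
    rw [map_prod, Ek]
    apply Finset.prod_congr rfl
    intro j _
    rw [hG j z κ ?_ ?_ (fun i => ∃ l ∈ L, κ l = i ∧ b l ≤ j)]
    · simp [phi]
    · intro i _
      simp only [Finset.mem_filter]
      constructor
      · rintro ⟨l, h1, h2, h3⟩; exact ⟨l, ⟨h1, h3⟩, h2⟩
      · rintro ⟨l, ⟨h1, h3⟩, h2⟩; exact ⟨l, h1, h2, h3⟩
    · intro l hl
      rw [Finset.mem_filter] at hl ⊢
      have := mem_Ak hκ hl.1
      exact ⟨this.1, by omega⟩
    · exact hinj.mono (by intro l hl; simp at hl ⊢; exact hl.1)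
  · rw [prs_zero_of_not_inj hinj, zero_mul, zero_mul]

theorem den_eq {s : Finset ℕ} {L : Finset (Fin M)} {b : Fin M → ℕ} {κ : Fin M → ℕ}
    (h : κ ∈ Fintype.piFinset (Ak s L b)) (z : ℕ → ℂ) :
    ∏ l, ∏ i ∈ (Ak s L b l).erase (κ l), (z (κ l) - z i) = den s L b z κ := by
  unfold den
  rw [← Finset.prod_subset (Finset.subset_univ L)]
  · apply Finset.prod_congr rfl
    intro l hl
    simp [Ak, hl]
  · intro l _ hl
    rw [mem_Ak' h hl]
    simp [Ak, hl]

/-- Polynomiality for a numerator multiplied by an extra polynomial factor. -/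
theorem poly_exists_gen (s : Finset ℕ) (L : Finset (Fin M)) (b : Fin M → ℕ)
    (T : MvPolynomial (Fin M) (MvPolynomial ℕ ℂ)) :
    ∃ p : MvPolynomial ℕ ℂ, ∀ z : ℕ → ℂ, Set.InjOn z s →
      eval z p = ∑ κ ∈ Fintype.piFinset (Ak s L b), Fk s L b z κ * phi z κ T := by
  obtain ⟨T1, hT1⟩ := num_poly s L b
  obtain ⟨Q, hQ⟩ := dd_all (Ak s L b) (T1 * T)
  refine ⟨Q, ?_⟩
  intro z hz
  rw [hQ z ?_]
  · apply Finset.sum_congr rfl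
    intro κ hκ
    rw [map_mul, hT1 z κ hκ, den_eq hκ, Fk]
    ring
  · intro l
    unfold Ak
    split_ifs
    · exact hz.mono (by intro i hi; simp at hi ⊢; exact hi.1)
    · simp

theorem poly_exists (s : Finset ℕ) (L : Finset (Fin M)) (b : Fin M → ℕ) :
    ∃ p : MvPolynomial ℕ ℂ, ∀ z : ℕ → ℂ, Set.InjOn z s → eval z p = Psum s L b z := by
  obtain ⟨p, hp⟩ := poly_exists_gen s L b 1
  refine ⟨p, ?_⟩
  intro z hz
  rw [hp z hz, Psum]
  simp

noncomputable def Ppol (s : Finset ℕ) (L : Finset (Fin M)) (b : Fin M → ℕ) : MvPolynomial ℕ ℂ :=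
  (poly_exists s L b).choose

theorem Ppol_eval {s : Finset ℕ} (L : Finset (Fin M)) (b : Fin M → ℕ) {z : ℕ → ℂ}
    (hz : Set.InjOn z s) : eval z (Ppol s L b) = Psum s L b z :=
  (poly_exists s L b).choose_spec z hz

end Kernel

theorem path_zero {s : Finset ℕ} {z v : ℕ → ℂ} (hv : Set.InjOn v s) {F : ℂ → ℂ}
    (hF : Continuous F) (h : ∀ t : ℂ, Set.InjOn (fun i => z i + t * v i) s → F t = 0) :
    F 0 = 0 := by
  apply cont_zero hF (B := ⋃ x ∈ s.offDiag, {t : ℂ | (z x.1 - z x.2) + t * (v x.1 - v x.2) = 0})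
  · refine Set.Finite.biUnion s.offDiag.finite_toSet fun x hx => finite_lin ?_
    rw [Finset.mem_coe, Finset.mem_offDiag] at hx
    intro h0
    exact hx.2.2 (hv hx.1 hx.2.1 (sub_eq_zero.mp h0))
  · intro t ht
    apply h
    intro a ha b hb hab
    by_contra hne
    apply ht
    simp only [Set.mem_iUnion]
    refine ⟨(a, b), Finset.mem_offDiag.mpr ⟨ha, hb, hne⟩, ?_⟩
    simp only [Set.mem_ofPred_eq]
    simp only at hab
    linear_combination hab

theorem norm_q : ‖q‖ = 1 := Complex.norm_eq_one_of_pow_eq_one q_cubed (by norm_num)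

theorem norm_nat_succ (l : ℕ) : ‖((l : ℂ) + 1)‖ = l + 1 := by
  have : ((l : ℂ) + 1) = ((l + 1 : ℕ) : ℂ) := by push_cast; ring
  rw [this, Complex.norm_natCast]; push_cast; ring

/-- Generic direction in the subspace `z k' = q² z k`. -/
theorem dir2_inj (k k' : ℕ) :
    Function.Injective (fun l : ℕ => if l = k' then q ^ 2 * ((k : ℂ) + 1) else (l : ℂ) + 1) := by
  have hk : ((k : ℂ) + 1) ≠ 0 := by exact_mod_cast Nat.succ_ne_zero k
  have key : ∀ b : ℕ, b ≠ k' → q ^ 2 * ((k : ℂ) + 1) ≠ (b : ℂ) + 1 := by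
    intro b hb he
    have h1 := congrArg norm he
    rw [norm_mul, norm_pow, norm_q, norm_nat_succ, norm_nat_succ] at h1
    have h2 : k = b := by
      have : (k : ℝ) = b := by linarith
      exact_mod_cast this
    rw [← h2] at he
    apply q_sq_ne_one
    apply mul_right_cancel₀ hk
    rw [he, one_mul]
  intro a b hab
  simp only at hab
  split_ifs at hab with h1 h2 h2
  · rw [h1, h2]
  · exact absurd hab (key b h2)
  · exact absurd hab.symm (key a h1)
  · have : (a : ℂ) = b := by linear_combination hab
    exact_mod_cast this

theorem dir3_inj (i j k : ℕ) :
    Function.Injective (fun l : ℕ => if l = j then q ^ 2 * ((i : ℂ) + 1) else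
      if l = k then q * ((i : ℂ) + 1) else (l : ℂ) + 1) := by
  have hk : ((i : ℂ) + 1) ≠ 0 := by exact_mod_cast Nat.succ_ne_zero i
  have key : ∀ b : ℕ, q ^ 2 * ((i : ℂ) + 1) ≠ (b : ℂ) + 1 := by
    intro b he
    have h1 := congrArg norm he
    rw [norm_mul, norm_pow, norm_q, norm_nat_succ, norm_nat_succ] at h1
    have h2 : i = b := by
      have : (i : ℝ) = b := by linarith
      exact_mod_cast this
    rw [← h2] at he
    apply q_sq_ne_one
    apply mul_right_cancel₀ hk
    rw [he, one_mul]
  have key2 : ∀ b : ℕ, q * ((i : ℂ) + 1) ≠ (b : ℂ) + 1 := by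
    intro b he
    have h1 := congrArg norm he
    rw [norm_mul, norm_q, norm_nat_succ, norm_nat_succ] at h1
    have h2 : i = b := by
      have : (i : ℝ) = b := by linarith
      exact_mod_cast this
    rw [← h2] at he
    apply q_ne_one
    apply mul_right_cancel₀ hk
    rw [he, one_mul]
  have key3 : q ^ 2 * ((i : ℂ) + 1) ≠ q * ((i : ℂ) + 1) := fun h =>
    q_sq_ne_q (mul_right_cancel₀ hk h)
  intro a b hab
  simp only at hab
  split_ifs at hab with h1 h2 h2 h3 h4 h5 h6 h7
  · rw [h1, h2]
  · exact absurd hab key3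
  · exact absurd hab (key b)
  · exact absurd hab.symm key3
  · rw [h3, h5]
  · exact absurd hab (key2 b)
  · exact absurd hab.symm (key a)
  · exact absurd hab.symm (key2 a)
  · have : (a : ℂ) = b := by linear_combination hab
    exact_mod_cast this

theorem pp_insert {α R : Type*} [LinearOrder α] [CommMonoid R] (s : Finset α) (a : α) (ha : a ∉ s)
    (h : α → α → R) :
    ∏ j ∈ insert a s, ∏ i ∈ (insert a s).filter (· < j), h i j =
      (∏ j ∈ s, ∏ i ∈ s.filter (· < j), h i j) * (∏ i ∈ s.filter (· < a), h i a) *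
        ∏ j ∈ s.filter (a < ·), h a j := by
  rw [Finset.prod_insert ha]
  have h1 : (insert a s).filter (· < a) = s.filter (· < a) := by
    rw [Finset.filter_insert, if_neg (lt_irrefl a)]
  rw [h1, Finset.prod_filter (p := fun j => a < j), mul_comm, mul_assoc, mul_comm _ (∏ j ∈ s, _),
    ← mul_assoc, ← Finset.prod_mul_distrib]
  congr 1
  apply Finset.prod_congr rfl
  intro j _
  rw [Finset.filter_insert]
  split_ifs with hj
  · rw [Finset.prod_insert (by simp [ha]), mul_comm]
  · simp

theorem pp_insert' {α R : Type*} [LinearOrder α] [CommMonoid R] (s : Finset α) (a : α) (ha : a ∉ s)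
    (h : α → α → R) :
    ∏ j ∈ insert a s, ∏ i ∈ (insert a s).filter (j < ·), h j i =
      (∏ j ∈ s, ∏ i ∈ s.filter (j < ·), h j i) * (∏ i ∈ s.filter (· < a), h i a) *
        ∏ j ∈ s.filter (a < ·), h a j := by
  have sw : ∀ s : Finset α, ∏ j ∈ s, ∏ i ∈ s.filter (j < ·), h j i =
      ∏ j ∈ s, ∏ i ∈ s.filter (· < j), h i j := by
    intro s
    apply Finset.prod_comm'
    intro x y
    simp only [Finset.mem_filter]
    tauto
  rw [sw, sw, pp_insert s a ha]

section Rec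
variable {M : ℕ}

noncomputable def fac (s' : Finset ℕ) (L' : Finset (Fin M)) (l0 : Fin M) (k k' : ℕ) (z : ℕ → ℂ) : ℂ :=
  (-q) ^ (L'.filter (l0 < ·)).card * (-1) ^ (L'.filter (· < l0)).card *
    (∏ i ∈ s'.filter (· < k), (-(z i - q * z k))) *
    ∏ j ∈ s'.filter (k' < ·), (-q * (z j - q * z k))

theorem Fk_rec {s' : Finset ℕ} {L' : Finset (Fin M)} {b : Fin M → ℕ} {k k' : ℕ} {l0 : Fin M}
    (hk : k ∉ s') (hk' : k' ∉ s') (hkk : k < k') (hadj : ∀ x ∈ s', ¬ (k < x ∧ x < k'))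
    (hl0 : l0 ∉ L') (hb : ∀ l ∈ L', (l < l0 → b l ≤ k) ∧ (l0 < l → k' < b l))
    (hb1 : k < b l0) (hb2 : b l0 ≤ k') {z : ℕ → ℂ}
    (hz : Set.InjOn z (insert k (insert k' s') : Finset ℕ)) (hzk : z k' = q ^ 2 * z k)
    {κ : Fin M → ℕ} (hκ : κ ∈ Fintype.piFinset (Ak s' L' b)) (hinj : Set.InjOn κ L') :
    Fk (insert k (insert k' s')) (insert l0 L') b z (Function.update κ l0 k) =
      fac s' L' l0 k k' z * Fk s' L' b z κ := by
  have hq3 := q_cubed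
  set κ' := Function.update κ l0 k with hκ'
  have e0 : κ' l0 = k := by simp [hκ']
  have e1 : ∀ l ∈ L', κ' l = κ l := by
    intro l hl
    have : l ≠ l0 := fun h => hl0 (h ▸ hl)
    simp [hκ', this]
  have hm : ∀ l ∈ L', κ l ∈ s' ∧ κ l < b l := fun l hl => mem_Ak hκ hl
  have hne : ∀ l ∈ L', κ l ≠ k ∧ κ l ≠ k' := fun l hl =>
    ⟨fun h => hk (h ▸ (hm l hl).1), fun h => hk' (h ▸ (hm l hl).1)⟩
  have hll : ∀ l ∈ L', l < l0 ∨ l0 < l := fun l hl =>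
    lt_or_gt_of_ne (fun h => hl0 (h ▸ hl))
  have hsne : ∀ x ∈ s', x ≠ k ∧ x ≠ k' := fun x hx => ⟨fun h => hk (h ▸ hx), fun h => hk' (h ▸ hx)⟩
  have hside : ∀ x ∈ s', x < k ∨ k' < x := by
    intro x hx
    have h1 := hadj x hx
    have h2 := hsne x hx
    omega
  have hprs : prs (insert l0 L') z κ' = prs L' z κ *
      (∏ l ∈ L'.filter (· < l0), ((z k - z (κ l)) * (z (κ l) - q * z k))) *
      ∏ l ∈ L'.filter (l0 < ·), ((z (κ l) - z k) * (z k - q * z (κ l))) := by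
    unfold prs
    rw [pp_insert' L' l0 hl0 (fun l l' => (z (κ' l') - z (κ' l)) * (z (κ' l) - q * z (κ' l')))]
    congr 1
    · congr 1
      · apply Finset.prod_congr rfl
        intro l hl
        apply Finset.prod_congr rfl
        intro l' hl'
        rw [e1 l hl, e1 l' (Finset.mem_filter.mp hl').1]
      · apply Finset.prod_congr rfl
        intro l hl
        rw [e1 l (Finset.mem_filter.mp hl).1, e0]
    · apply Finset.prod_congr rfl
      intro l hl
      rw [e1 l (Finset.mem_filter.mp hl).1, e0]
  have hkS : k ∉ insert k' s' := by simp [hk, hkk.ne]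
  have hE : Ek (insert k (insert k' s')) (insert l0 L') b z κ' = Ek s' L' b z κ *
      (∏ i ∈ s'.filter (· < k), if ∃ l ∈ insert l0 L', κ' l = i ∧ b l ≤ k then 1
        else z i - q * z k) *
      (∏ i ∈ s'.filter (· < k), if ∃ l ∈ insert l0 L', κ' l = i ∧ b l ≤ k' then 1
        else z i - z k) *
      ∏ j ∈ s'.filter (k' < ·), (-q * (z j - q * z k)) := by
    unfold Ek
    rw [pp_insert _ _ hkS (fun i j => if ∃ l ∈ insert l0 L', κ' l = i ∧ b l ≤ j then 1
      else z i - q * z j)]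
    rw [pp_insert _ _ hk' (fun i j => if ∃ l ∈ insert l0 L', κ' l = i ∧ b l ≤ j then 1
      else z i - q * z j)]
    have f1 : (insert k' s').filter (· < k) = s'.filter (· < k) := by
      rw [Finset.filter_insert, if_neg (by omega)]
    have f2 : s'.filter (· < k') = s'.filter (· < k) := by
      apply Finset.filter_congr
      intro x hx
      have := hside x hx
      omega
    have f3 : (∏ j ∈ (insert k' s').filter (k < ·), if ∃ l ∈ insert l0 L', κ' l = k ∧ b l ≤ j then 1
      else z k - q * z j) = 1 := by
      apply Finset.prod_eq_one
      intro j hj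
      rw [if_pos]
      refine ⟨l0, Finset.mem_insert_self _ _, e0, ?_⟩
      rw [Finset.mem_filter, Finset.mem_insert] at hj
      rcases hj.1 with h | h
      · omega
      · have := hside j h
        omega
    have f4 : (∏ j ∈ s'.filter (k' < ·), if ∃ l ∈ insert l0 L', κ' l = k' ∧ b l ≤ j then 1
      else z k' - q * z j) = ∏ j ∈ s'.filter (k' < ·), (-q * (z j - q * z k)) := by
      apply Finset.prod_congr rfl
      intro j _
      rw [if_neg]
      · rw [hzk]; ring
      · rintro ⟨l, hl, h1, -⟩
        rw [Finset.mem_insert] at hl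
        rcases hl with h | h
        · rw [h, e0] at h1; omega
        · rw [e1 l h] at h1
          exact (hne l h).2 h1
    have f5 : (∏ j ∈ s', ∏ i ∈ s'.filter (· < j), if ∃ l ∈ insert l0 L', κ' l = i ∧ b l ≤ j then 1
      else z i - q * z j) = (∏ j ∈ s', ∏ i ∈ s'.filter (· < j), if ∃ l ∈ L', κ l = i ∧ b l ≤ j then 1
      else z i - q * z j) := by
      apply Finset.prod_congr rfl
      intro j _
      apply Finset.prod_congr rfl
      intro i hi
      congr 1
      apply propext
      constructor
      · rintro ⟨l, hl, h1, h2⟩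
        rw [Finset.mem_insert] at hl
        rcases hl with h | h
        · rw [h, e0] at h1
          exact absurd h1.symm (hsne i (Finset.mem_filter.mp hi).1).1
        · exact ⟨l, h, by rw [← e1 l h, h1], h2⟩
      · rintro ⟨l, hl, h1, h2⟩
        exact ⟨l, Finset.mem_insert_of_mem hl, by rw [e1 l hl, h1], h2⟩
    have f6 : (∏ i ∈ s'.filter (· < k), if ∃ l ∈ insert l0 L', κ' l = i ∧ b l ≤ k' then 1
        else z i - q * z k') = (∏ i ∈ s'.filter (· < k), if ∃ l ∈ insert l0 L', κ' l = i ∧ b l ≤ k' then 1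
        else z i - z k) := by
      apply Finset.prod_congr rfl
      intro i _
      have : z i - q * z k' = z i - z k := by rw [hzk]; linear_combination (-z k) * hq3
      rw [this]
    rw [f1, f2, f3, f4, f5, f6]
    ring
  have cA : ∀ K, (K = k ∨ K = k') → ∀ i ∈ s'.filter (· < k),
      (∃ l ∈ insert l0 L', κ' l = i ∧ b l ≤ K) ↔ ∃ l ∈ L'.filter (· < l0), κ l = i := by
    intro K hK i hi
    rw [Finset.mem_filter] at hi
    constructor
    · rintro ⟨l, hl, h1, h2⟩
      rw [Finset.mem_insert] at hl
      rcases hl with h | h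
      · rw [h, e0] at h1; omega
      · refine ⟨l, Finset.mem_filter.mpr ⟨h, ?_⟩, by rw [← e1 l h, h1]⟩
        rcases hll l h with h3 | h3
        · exact h3
        · have := (hb l h).2 h3; omega
    · rintro ⟨l, hl, h1⟩
      rw [Finset.mem_filter] at hl
      refine ⟨l, Finset.mem_insert_of_mem hl.1, by rw [e1 l hl.1, h1], ?_⟩
      have := (hb l hl.1).1 hl.2
      omega
  have hmA : ∀ l ∈ L'.filter (· < l0), κ l ∈ s'.filter (· < k) := by
    intro l hl
    rw [Finset.mem_filter] at hl ⊢
    have h1 := hm l hl.1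
    have h2 := (hb l hl.1).1 hl.2
    exact ⟨h1.1, by omega⟩
  have hinjA : Set.InjOn κ (L'.filter (· < l0) : Finset (Fin M)) := hinj.mono (by
    intro l hl
    rw [Finset.mem_coe, Finset.mem_filter] at hl
    exact hl.1)
  have pA := prod_cancel (s'.filter (· < k)) (L'.filter (· < l0)) κ hmA hinjA
    (fun i => z i - q * z k) _ (cA k (Or.inl rfl))
  have pB := prod_cancel (s'.filter (· < k)) (L'.filter (· < l0)) κ hmA hinjA
    (fun i => z i - z k) _ (cA k' (Or.inr rfl))
  have hden : den (insert k (insert k' s')) (insert l0 L') b z κ' =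
      (∏ i ∈ s'.filter (· < k), (z k - z i)) * (den s' L' b z κ *
      ∏ l ∈ L'.filter (l0 < ·), ((z (κ l) - z k) * (z (κ l) - z k'))) := by
    unfold den
    rw [Finset.prod_insert hl0, e0]
    congr 1
    · apply Finset.prod_congr _ (fun _ _ => rfl)
      ext x
      simp only [Finset.mem_erase, Finset.mem_filter, Finset.mem_insert]
      constructor
      · rintro ⟨h1, h2 | h2 | h2, h3⟩
        · exact absurd h2 h1
        · omega
        · have := hside x h2
          exact ⟨h2, by omega⟩
      · rintro ⟨h1, h2⟩
        exact ⟨(hsne x h1).1, Or.inr (Or.inr h1), by omega⟩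
    · rw [Finset.prod_filter, ← Finset.prod_mul_distrib]
      apply Finset.prod_congr rfl
      intro l hl
      rw [e1 l hl]
      have h0 := hne l hl
      split_ifs with h1
      · have h2 := (hb l hl).2 h1
        have : ((insert k (insert k' s')).filter (· < b l)).erase (κ l) =
            insert k (insert k' ((s'.filter (· < b l)).erase (κ l))) := by
          ext x
          simp only [Finset.mem_erase, Finset.mem_filter, Finset.mem_insert]
          constructor
          · rintro ⟨h1, h2 | h2 | h2, h3⟩ <;> simp [*]
          · rintro (h3 | h3 | h3)
            · subst h3; exact ⟨h0.1.symm, Or.inl rfl, by omega⟩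
            · subst h3; exact ⟨h0.2.symm, Or.inr (Or.inl rfl), by omega⟩
            · exact ⟨h3.1, Or.inr (Or.inr h3.2.1), h3.2.2⟩
        rw [this, Finset.prod_insert (by simp [hk, hkk.ne]), Finset.prod_insert (by simp [hk'])]
        ring
      · have h2 := (hb l hl).1 ((hll l hl).resolve_right h1)
        rw [mul_one]
        apply Finset.prod_congr _ (fun _ _ => rfl)
        congr 1
        rw [Finset.filter_insert, if_neg (by omega), Finset.filter_insert, if_neg (by omega)]
  unfold Fk fac
  rw [hprs, hE, hden]
  set A := ∏ i ∈ s'.filter (· < k), if ∃ l ∈ insert l0 L', κ' l = i ∧ b l ≤ k then 1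
        else z i - q * z k
  set B := ∏ i ∈ s'.filter (· < k), if ∃ l ∈ insert l0 L', κ' l = i ∧ b l ≤ k' then 1
        else z i - z k
  set Cc := ∏ j ∈ s'.filter (k' < ·), (-q * (z j - q * z k))
  have g1 : ∏ l ∈ L'.filter (· < l0), ((z k - z (κ l)) * (z (κ l) - q * z k)) =
      (-1) ^ (L'.filter (· < l0)).card * (∏ l ∈ L'.filter (· < l0), (z (κ l) - z k)) *
        ∏ l ∈ L'.filter (· < l0), (z (κ l) - q * z k) := by
    rw [← Finset.prod_const, ← Finset.prod_mul_distrib, ← Finset.prod_mul_distrib]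
    apply Finset.prod_congr rfl
    intro l _
    ring
  have g2 : ∏ l ∈ L'.filter (l0 < ·), ((z (κ l) - z k) * (z k - q * z (κ l))) =
      (-q) ^ (L'.filter (l0 < ·)).card *
      ∏ l ∈ L'.filter (l0 < ·), ((z (κ l) - z k) * (z (κ l) - z k')) := by
    rw [← Finset.prod_const, ← Finset.prod_mul_distrib]
    apply Finset.prod_congr rfl
    intro l _
    rw [hzk]
    linear_combination (- z k * (z (κ l) - z k)) * hq3
  have g3 : ∏ i ∈ s'.filter (· < k), (z i - z k) = 
      (-1) ^ (s'.filter (· < k)).card * ∏ i ∈ s'.filter (· < k), (z k - z i) := by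
    rw [← Finset.prod_const, ← Finset.prod_mul_distrib]
    apply Finset.prod_congr rfl
    intro l _
    ring
  have g4 : ∏ i ∈ s'.filter (· < k), (-(z i - q * z k)) = 
      (-1) ^ (s'.filter (· < k)).card * ∏ i ∈ s'.filter (· < k), (z i - q * z k) := by
    rw [← Finset.prod_const, ← Finset.prod_mul_distrib]
    apply Finset.prod_congr rfl
    intro l _
    ring
  have hz1 : ∀ x ∈ s', z x - z k ≠ 0 ∧ z x - z k' ≠ 0 := by
    intro x hx
    constructor
    · intro h
      exact (hsne x hx).1 (hz (by simp [hx]) (by simp) (sub_eq_zero.mp h))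
    · intro h
      exact (hsne x hx).2 (hz (by simp [hx]) (by simp) (sub_eq_zero.mp h))
  have n1 : ∏ l ∈ L'.filter (l0 < ·), ((z (κ l) - z k) * (z (κ l) - z k')) ≠ 0 := by
    refine Finset.prod_ne_zero_iff.mpr fun l hl => ?_
    have := hz1 _ (hm l (Finset.mem_filter.mp hl).1).1
    exact mul_ne_zero this.1 this.2
  have n2 : ∏ i ∈ s'.filter (· < k), (z k - z i) ≠ 0 := by
    refine Finset.prod_ne_zero_iff.mpr fun l hl => ?_
    have := hz1 _ (Finset.mem_filter.mp hl).1
    intro h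
    exact this.1 (by linear_combination -h)
  rw [g1, g2, g4, ← pA]
  rw [g3] at pB
  set R := ∏ l ∈ L'.filter (l0 < ·), ((z (κ l) - z k) * (z (κ l) - z k'))
  set DA := ∏ i ∈ s'.filter (· < k), (z k - z i)
  set PA := ∏ l ∈ L'.filter (· < l0), (z (κ l) - q * z k)
  set PB := ∏ l ∈ L'.filter (· < l0), (z (κ l) - z k)
  have w1 : prs L' z κ * ((-1) ^ (L'.filter (· < l0)).card * PB * PA) *
      ((-q) ^ (L'.filter (l0 < ·)).card * R) * (Ek s' L' b z κ * A * B * Cc) =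
      (prs L' z κ * Ek s' L' b z κ * ((-q) ^ (L'.filter (l0 < ·)).card *
        (-1) ^ (L'.filter (· < l0)).card * ((-1) ^ (s'.filter (· < k)).card * (A * PA)) * Cc)) *
        (DA * R) := by
    linear_combination (prs L' z κ * ((-1) ^ (L'.filter (· < l0)).card * PA) *
      ((-q) ^ (L'.filter (l0 < ·)).card * R) * (Ek s' L' b z κ * A * Cc)) * pB
  have w2 : DA * (den s' L' b z κ * R) = den s' L' b z κ * (DA * R) := by ring
  rw [w1, w2, mul_div_mul_right _ _ (mul_ne_zero n2 n1)]
  ring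

theorem Ek_zero_of {s : Finset ℕ} {L : Finset (Fin M)} {b : Fin M → ℕ} {z : ℕ → ℂ} {κ : Fin M → ℕ}
    {i j : ℕ} (hi : i ∈ s) (hj : j ∈ s) (hij : i < j) (h : z i = q * z j)
    (hn : ¬ ∃ l ∈ L, κ l = i ∧ b l ≤ j) : Ek s L b z κ = 0 := by
  unfold Ek
  apply Finset.prod_eq_zero hj
  apply Finset.prod_eq_zero (Finset.mem_filter.mpr ⟨hi, hij⟩)
  rw [if_neg hn, h, sub_self]

theorem Psum_zero {s : Finset ℕ} {L : Finset (Fin M)} {b : Fin M → ℕ} {k k' : ℕ}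
    (hk : k ∈ s) (hk' : k' ∈ s) (hkk : k < k') (hL : ∀ l ∈ L, ¬ (k < b l ∧ b l ≤ k'))
    {z : ℕ → ℂ} (hzk : z k' = q ^ 2 * z k) : Psum s L b z = 0 := by
  apply Finset.sum_eq_zero
  intro κ hκ
  have hE : Ek s L b z κ = 0 := by
    apply Ek_zero_of hk hk' hkk
    · rw [hzk]; linear_combination (- z k) * q_cubed
    · rintro ⟨l, hl, h1, h2⟩
      have := mem_Ak hκ hl
      exact hL l hl ⟨by omega, h2⟩
  rw [Fk, hE, mul_zero, zero_div]

theorem Psum_rec {s' : Finset ℕ} {L' : Finset (Fin M)} {b : Fin M → ℕ} {k k' : ℕ} {l0 : Fin M}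
    (hk : k ∉ s') (hk' : k' ∉ s') (hkk : k < k') (hadj : ∀ x ∈ s', ¬ (k < x ∧ x < k'))
    (hl0 : l0 ∉ L') (hb : ∀ l ∈ L', (l < l0 → b l ≤ k) ∧ (l0 < l → k' < b l))
    (hb1 : k < b l0) (hb2 : b l0 ≤ k') {z : ℕ → ℂ}
    (hz : Set.InjOn z (insert k (insert k' s') : Finset ℕ)) (hzk : z k' = q ^ 2 * z k) :
    Psum (insert k (insert k' s')) (insert l0 L') b z = fac s' L' l0 k k' z * Psum s' L' b z := by
  have hq3 := q_cubed
  have hzk' : z k = q * z k' := by rw [hzk]; linear_combination (- z k) * q_cubed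
  have hll : ∀ l ∈ L', l < l0 ∨ l0 < l := fun l hl =>
    lt_or_gt_of_ne (fun h => hl0 (h ▸ hl))
  unfold Psum
  rw [Finset.mul_sum]
  symm
  apply Finset.sum_of_injOn (fun κ => Function.update κ l0 k)
  · intro κ hκ κ2 hκ2 h
    rw [Finset.mem_coe] at hκ hκ2
    ext l
    by_cases hl : l = l0
    · subst hl; rw [mem_Ak' hκ hl0, mem_Ak' hκ2 hl0]
    · have := congrFun h l
      simpa [hl] using this
  · intro κ hκ
    rw [Finset.mem_coe] at hκ ⊢
    rw [Fintype.mem_piFinset]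
    intro l
    by_cases hl : l = l0
    · subst hl; simp [Ak, hb1]
    · by_cases hl' : l ∈ L'
      · have := mem_Ak hκ hl'
        simp [Ak, hl, hl', this.1, this.2]
      · have := mem_Ak' hκ hl'
        simp [Ak, hl, hl', this]
  · intro κ hκ hni
    by_contra hF
    apply hni
    rw [Fk] at hF
    have hp : prs (insert l0 L') z κ ≠ 0 := by intro h; rw [h] at hF; simp at hF
    have hE : Ek (insert k (insert k' s')) (insert l0 L') b z κ ≠ 0 := by
      intro h; rw [h] at hF; simp at hF
    have hk0 : κ l0 = k := by
      by_contra hne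
      apply hE
      apply Ek_zero_of (i := k) (j := k') (by simp) (by simp) hkk hzk'
      rintro ⟨l, hl, h1, h2⟩
      have h3 := mem_Ak hκ hl
      rw [Finset.mem_insert] at hl
      rcases hl with h | h
      · exact hne (h ▸ h1)
      · rcases hll l h with h4 | h4
        · have := (hb l h).1 h4; omega
        · have := (hb l h).2 h4; omega
    have hother : ∀ l ∈ L', κ l ≠ k ∧ κ l ≠ k' := by
      intro l hl
      constructor
      · intro h
        apply hp
        apply prs_zero_of_not_inj
        intro hi
        have := hi (by simp [hl]) (by simp) (h.trans hk0.symm)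
        exact hl0 (this ▸ hl)
      · intro h
        have h3 := mem_Ak hκ (Finset.mem_insert_of_mem hl)
        rcases hll l hl with h4 | h4
        · have := (hb l hl).1 h4; omega
        · apply hp
          exact prs_zero_of (by simp) (by simp [hl]) h4 (Or.inr (by rw [hk0, h]; exact hzk'))
    refine ⟨Function.update κ l0 0, ?_, ?_⟩
    · rw [Finset.mem_coe, Fintype.mem_piFinset]
      intro l
      by_cases hl : l = l0
      · subst hl; simp [Ak, hl0]
      · by_cases hl' : l ∈ L'
        · have h3 := mem_Ak hκ (Finset.mem_insert_of_mem hl')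
          have h4 := hother l hl'
          rw [Finset.mem_insert, Finset.mem_insert] at h3
          have h5 : κ l ∈ s' := by tauto
          simp [Ak, hl, hl', h5, h3.2]
        · have h3 := mem_Ak' hκ (l := l) (by simp [hl, hl'])
          simp [Ak, hl, hl', h3]
    · simp only
      ext l
      by_cases hl : l = l0
      · subst hl; simp [hk0]
      · simp [hl]
  · intro κ hκ
    by_cases hinj : Set.InjOn κ L'
    · exact (Fk_rec hk hk' hkk hadj hl0 hb hb1 hb2 hz hzk hκ hinj).symm
    · have h1 : prs L' z κ = 0 := prs_zero_of_not_inj hinj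
      have h2 : prs (insert l0 L') z (Function.update κ l0 k) = 0 := by
        apply prs_zero_of_not_inj
        intro hi
        apply hinj
        intro a ha c hc hac
        have ea : a ≠ l0 := fun h => hl0 (h ▸ ha)
        have ec : c ≠ l0 := fun h => hl0 (h ▸ hc)
        rw [Finset.mem_coe] at ha hc
        apply hi (by simp [ha]) (by simp [hc])
        simp [ea, ec, hac]
      rw [Fk, Fk, h1, h2]
      simp

/-- The recursion for the polynomial at every point of `z k' = q² z k`. -/
theorem Ppol_rec {s : Finset ℕ} {L : Finset (Fin M)} {b : Fin M → ℕ} {k k' : ℕ} {l0 : Fin M}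
    (hk : k ∈ s) (hk' : k' ∈ s) (hkk : k < k') (hadj : ∀ x ∈ s, ¬ (k < x ∧ x < k'))
    (hl0 : l0 ∈ L) (hb : ∀ l ∈ L, (l < l0 → b l ≤ k) ∧ (l0 < l → k' < b l))
    (hb1 : k < b l0) (hb2 : b l0 ≤ k') {z : ℕ → ℂ} (hzk : z k' = q ^ 2 * z k) :
    eval z (Ppol s L b) = fac ((s.erase k).erase k') (L.erase l0) l0 k k' z *
      eval z (Ppol ((s.erase k).erase k') (L.erase l0) b) := by
  set s' := (s.erase k).erase k' with hs'
  set L' := L.erase l0 with hL'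
  have es : s = insert k (insert k' s') := by
    rw [hs', Finset.insert_erase (Finset.mem_erase.mpr ⟨hkk.ne', hk'⟩), Finset.insert_erase hk]
  have eL : L = insert l0 L' := by rw [hL', Finset.insert_erase hl0]
  have hsub : s' ⊆ s := by
    intro x hx; rw [hs'] at hx; exact Finset.mem_of_mem_erase (Finset.mem_of_mem_erase hx)
  set v : ℕ → ℂ := fun l : ℕ => if l = k' then q ^ 2 * ((k : ℂ) + 1) else (l : ℂ) + 1 with hv
  have hvi : Set.InjOn v s := (dir2_inj k k').injOn
  have := path_zero (s := s) (z := z) (v := v) hvi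
    (F := fun t => eval (fun i => z i + t * v i) (Ppol s L b) -
      fac s' L' l0 k k' (fun i => z i + t * v i) * eval (fun i => z i + t * v i) (Ppol s' L' b))
    (by
      apply Continuous.sub (cont_line _ _ _)
      apply Continuous.mul _ (cont_line _ _ _)
      unfold fac
      fun_prop)
    (by
      intro t ht
      rw [Ppol_eval L b ht, Ppol_eval L' b (ht.mono (by exact_mod_cast hsub)), sub_eq_zero]
      conv_lhs => rw [es, eL]
      apply Psum_rec
      · simp [hs']
      · simp [hs']
      · exact hkk
      · exact fun x hx => hadj x (hsub hx)
      · simp [hL']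
      · exact fun l hl => hb l (Finset.mem_of_mem_erase hl)
      · exact hb1
      · exact hb2
      · rw [← es]; exact ht
      · have : v k' = q ^ 2 * v k := by simp [hv, hkk.ne]
        rw [hzk, this]; ring)
  simp only [zero_mul, add_zero] at this
  exact sub_eq_zero.mp this

theorem Ppol_zero {s : Finset ℕ} {L : Finset (Fin M)} {b : Fin M → ℕ} {k k' : ℕ}
    (hk : k ∈ s) (hk' : k' ∈ s) (hkk : k < k') (hL : ∀ l ∈ L, ¬ (k < b l ∧ b l ≤ k'))
    {z : ℕ → ℂ} (hzk : z k' = q ^ 2 * z k) : eval z (Ppol s L b) = 0 := by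
  set v : ℕ → ℂ := fun l : ℕ => if l = k' then q ^ 2 * ((k : ℂ) + 1) else (l : ℂ) + 1 with hv
  have := path_zero (s := s) (z := z) (v := v) (dir2_inj k k').injOn
    (F := fun t => eval (fun i => z i + t * v i) (Ppol s L b)) (cont_line _ _ _) (by
      intro t ht
      rw [Ppol_eval L b ht]
      apply Psum_zero hk hk' hkk hL
      have : v k' = q ^ 2 * v k := by simp [hv, hkk.ne]
      rw [hzk, this]; ring)
  simpa using this

theorem Ppol_wheel {s : Finset ℕ} {L : Finset (Fin M)} {b : Fin M → ℕ}
    (hb : ∀ l ∈ L, ∀ l' ∈ L, b l < b l' → l < l') : WheelOn s (Ppol s L b) := by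
  intro i hi j hj k hk hij hjk z hzj hzk
  set v : ℕ → ℂ := fun l : ℕ => if l = j then q ^ 2 * ((i : ℂ) + 1) else
      if l = k then q * ((i : ℂ) + 1) else (l : ℂ) + 1 with hv
  have hik : i ≠ k := by omega
  have := path_zero (s := s) (z := z) (v := v) (dir3_inj i j k).injOn
    (F := fun t => eval (fun i => z i + t * v i) (Ppol s L b)) (cont_line _ _ _) (by
      intro t ht
      rw [Ppol_eval L b ht]
      have w1 : v j = q ^ 2 * v i := by simp [hv, hij.ne, hik]
      have w2 : v k = q * v i := by simp [hv, hij.ne, hik, hjk.ne']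
      set y : ℕ → ℂ := fun i => z i + t * v i with hy
      have y1 : y i = q * y j := by
        simp only [hy]; rw [hzj, w1]; linear_combination (- z i - t * v i) * q_cubed
      have y2 : y j = q * y k := by
        simp only [hy]; rw [hzj, hzk, w1, w2]; ring
      apply Finset.sum_eq_zero
      intro κ hκ
      by_cases c1 : ∃ l ∈ L, κ l = i ∧ b l ≤ j
      · by_cases c2 : ∃ l ∈ L, κ l = j ∧ b l ≤ k
        · obtain ⟨l, hl, h1, h2⟩ := c1
          obtain ⟨l', hl', h1', h2'⟩ := c2
          have h3 := mem_Ak hκ hl'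
          have : l < l' := hb l hl l' hl' (by omega)
          rw [Fk, prs_zero_of hl hl' this (Or.inr (by rw [h1, h1']; exact y1))]
          simp
        · rw [Fk, Ek_zero_of hj hk hjk y2 c2]
          simp
      · rw [Fk, Ek_zero_of hi hj hij y1 c1]
        simp)
  simpa using this

end Rec

theorem deg_of_scale {s : Finset ℕ} {p : MvPolynomial ℕ ℂ} {d : ℕ}
    (h : ∀ z : ℕ → ℂ, Set.InjOn z s → ∀ t : ℂ, t ≠ 0 →
      eval (fun l => t * z l) p = t ^ d * eval z p) : p.totalDegree ≤ d := by
  have h1 : ∀ e, d < e → ∀ z : ℕ → ℂ, Set.InjOn z s → eval z (homogeneousComponent e p) = 0 := by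
    intro e he z hz
    set P : Polynomial ℂ := Polynomial.X * (∑ d ∈ Finset.range (p.totalDegree + 1),
      Polynomial.C (eval z (homogeneousComponent d p)) * Polynomial.X ^ d -
        Polynomial.C (eval z p) * Polynomial.X ^ d) with hP
    have hP0 : P = 0 := by
      apply Polynomial.funext
      intro t
      rw [hP, Polynomial.eval_mul, Polynomial.eval_X, Polynomial.eval_zero]
      by_cases ht : t = 0
      · rw [ht, zero_mul]
      have h0 := h z hz t ht
      conv_lhs at h0 => rw [← sum_homogeneousComponent p, map_sum]
      rw [Polynomial.eval_sub, Polynomial.eval_finsetSum]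
      have h2 : ∑ i ∈ Finset.range (p.totalDegree + 1), Polynomial.eval t
          (Polynomial.C (eval z (homogeneousComponent i p)) * Polynomial.X ^ i) =
          t ^ d * eval z p := by
        rw [← h0]
        apply Finset.sum_congr rfl
        intro d _
        rw [Polynomial.eval_mul, Polynomial.eval_C, Polynomial.eval_pow, Polynomial.eval_X]
        rw [hom_scale (homogeneousComponent_isHomogeneous d p), mul_comm]
      rw [h2]
      simp
      right
      ring
    have hco : P.coeff (e + 1) = 0 := by rw [hP0]; simp
    rw [hP, Polynomial.coeff_X_mul, Polynomial.coeff_sub, Polynomial.finsetSum_coeff] at hco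
    simp only [Polynomial.coeff_C_mul, Polynomial.coeff_X_pow, mul_ite, mul_one, mul_zero,
      Finset.sum_ite_eq, Finset.mem_range, if_neg he.ne', sub_zero] at hco
    split_ifs at hco with h
    · exact hco
    · rw [homogeneousComponent_eq_zero _ _ (by omega), map_zero]
  have h2 : ∀ e, d < e → homogeneousComponent e p = 0 := by
    intro e he
    apply MvPolynomial.funext
    intro z
    rw [map_zero]
    have := path_zero (s := s) (z := z) (v := fun l : ℕ => (l : ℂ))
      (Nat.cast_injective.injOn)
      (F := fun t => eval (fun i => z i + t * (i : ℂ)) (homogeneousComponent e p))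
      (cont_line _ _ _) (fun t ht => h1 e he _ ht)
    simpa using this
  rw [← sum_homogeneousComponent p]
  refine (totalDegree_finsetSum _ _).trans (Finset.sup_le ?_)
  intro e _
  by_cases he : d < e
  · rw [h2 e he]; simp
  · exact (homogeneousComponent_isHomogeneous e p).totalDegree_le.trans (by omega)

theorem pair_count {α : Type*} [LinearOrder α] (s : Finset α) :
    2 * ∑ j ∈ s, (s.filter (· < j)).card = s.card * (s.card - 1) := by
  induction s using Finset.induction_on_max with
  | empty => simp
  | insert a s ha ih =>
    have hna : a ∉ s := fun h => lt_irrefl _ (ha a h)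
    rw [Finset.sum_insert hna, Finset.card_insert_of_notMem hna]
    have h1 : ((insert a s).filter (· < a)) = s := by
      ext x
      simp only [Finset.mem_filter, Finset.mem_insert]
      constructor
      · rintro ⟨rfl | h, h'⟩
        · exact absurd h' (lt_irrefl _)
        · exact h
      · intro h; exact ⟨Or.inr h, ha x h⟩
    have h2 : ∀ j ∈ s, ((insert a s).filter (· < j)).card = (s.filter (· < j)).card := by
      intro j hj
      rw [Finset.filter_insert, if_neg (ha j hj).not_gt]
    rw [h1, Finset.sum_congr rfl h2, mul_add, ih]
    rcases Nat.eq_zero_or_pos s.card with h | h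
    · simp [h]
    · obtain ⟨c, hc⟩ := Nat.exists_eq_succ_of_ne_zero h.ne'
      rw [hc]; simp; ring

theorem pair_count' {α : Type*} [LinearOrder α] (s : Finset α) :
    2 * ∑ j ∈ s, (s.filter (j < ·)).card = s.card * (s.card - 1) := by
  rw [← pair_count s]
  congr 1
  simp only [Finset.card_filter]
  rw [Finset.sum_comm]

section Kernel
variable {M : ℕ}

theorem prs_scale (L : Finset (Fin M)) (z : ℕ → ℂ) (κ : Fin M → ℕ) (t : ℂ) :
    prs L (fun l => t * z l) κ = t ^ (L.card * (L.card - 1)) * prs L z κ := by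
  rw [← pair_count', prs, prs, pow_mul, ← Finset.prod_pow_eq_pow_sum, ← Finset.prod_mul_distrib]
  apply Finset.prod_congr rfl
  intro l _
  rw [← Finset.prod_const, ← Finset.prod_mul_distrib]
  apply Finset.prod_congr rfl
  intro l' _
  ring

theorem den_scale {s : Finset ℕ} {L : Finset (Fin M)} {b : Fin M → ℕ} (z : ℕ → ℂ) {κ : Fin M → ℕ}
    (hκ : κ ∈ Fintype.piFinset (Ak s L b)) (t : ℂ) :
    den s L b (fun l => t * z l) κ * t ^ L.card = t ^ (∑ l ∈ L, (s.filter (· < b l)).card) *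
      den s L b z κ := by
  rw [den, den, ← Finset.prod_pow_eq_pow_sum, ← Finset.prod_const, ← Finset.prod_mul_distrib,
    ← Finset.prod_mul_distrib]
  apply Finset.prod_congr rfl
  intro l hl
  have h : κ l ∈ s.filter (· < b l) := Finset.mem_filter.mpr (mem_Ak hκ hl)
  have h1 : ∏ i ∈ (s.filter (· < b l)).erase (κ l), (t * z (κ l) - t * z i) =
      t ^ ((s.filter (· < b l)).card - 1) *
        ∏ i ∈ (s.filter (· < b l)).erase (κ l), (z (κ l) - z i) := by
    rw [← Finset.card_erase_of_mem h, ← Finset.prod_const, ← Finset.prod_mul_distrib]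
    apply Finset.prod_congr rfl
    intro i _
    ring
  rw [h1]
  have h2 : 0 < (s.filter (· < b l)).card := Finset.card_pos.mpr ⟨_, h⟩
  obtain ⟨c, hc⟩ := Nat.exists_eq_succ_of_ne_zero h2.ne'
  rw [hc]
  simp only [Nat.succ_eq_add_one, Nat.add_sub_cancel]
  ring

theorem Ek_scale {s : Finset ℕ} {L : Finset (Fin M)} {b : Fin M → ℕ} (z : ℕ → ℂ) {κ : Fin M → ℕ}
    (hκ : κ ∈ Fintype.piFinset (Ak s L b)) (hinj : Set.InjOn κ L) (t : ℂ) :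
    Ek s L b (fun l => t * z l) κ * t ^ (∑ l ∈ L, (s.filter (b l ≤ ·)).card) =
      t ^ (∑ j ∈ s, (s.filter (· < j)).card) * Ek s L b z κ := by
  have h0 : ∑ l ∈ L, (s.filter (b l ≤ ·)).card = ∑ j ∈ s, (L.filter (b · ≤ j)).card := by
    simp only [Finset.card_filter]
    rw [Finset.sum_comm]
  rw [h0, Ek, Ek, ← Finset.prod_pow_eq_pow_sum, ← Finset.prod_pow_eq_pow_sum,
    ← Finset.prod_mul_distrib, ← Finset.prod_mul_distrib]
  apply Finset.prod_congr rfl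
  intro j _
  have := prod_cancel (s.filter (· < j)) (L.filter (b · ≤ j)) κ (by
    intro l hl
    rw [Finset.mem_filter] at hl ⊢
    have := mem_Ak hκ hl.1
    exact ⟨this.1, by omega⟩) (hinj.mono (by intro l hl; simp at hl ⊢; exact hl.1))
    (fun _ => t) (fun i => ∃ l ∈ L, κ l = i ∧ b l ≤ j) (by
      intro i _
      simp only [Finset.mem_filter]
      constructor
      · rintro ⟨l, h1, h2, h3⟩; exact ⟨l, ⟨h1, h3⟩, h2⟩
      · rintro ⟨l, ⟨h1, h3⟩, h2⟩; exact ⟨l, h1, h2, h3⟩)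
  simp only [Finset.prod_const] at this
  rw [← this, mul_right_comm, ← Finset.prod_mul_distrib]
  congr 1
  apply Finset.prod_congr rfl
  intro i _
  split_ifs
  · simp
  · ring

theorem Fk_scale {m : ℕ} {s : Finset ℕ} {L : Finset (Fin M)} {b : Fin M → ℕ} (hs : s.card = 2 * m)
    (hL : L.card = m) (z : ℕ → ℂ) {κ : Fin M → ℕ}
    (hκ : κ ∈ Fintype.piFinset (Ak s L b)) {t : ℂ} (ht : t ≠ 0) :
    Fk s L b (fun l => t * z l) κ = t ^ (m * (m - 1)) * Fk s L b z κ := by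
  by_cases hinj : Set.InjOn κ L
  swap
  · rw [Fk, Fk, prs_zero_of_not_inj hinj, prs_zero_of_not_inj hinj]; simp
  rw [Fk, Fk, prs_scale, hL]
  have h1 := den_scale z hκ t
  have h2 := Ek_scale z hκ hinj t
  rw [hL] at h1
  have h3 : ∑ l ∈ L, (s.filter (· < b l)).card + ∑ l ∈ L, (s.filter (b l ≤ ·)).card =
      m * (2 * m) := by
    rw [← Finset.sum_add_distrib, Finset.sum_congr rfl (g := fun _ => 2 * m), Finset.sum_const, hL,
      smul_eq_mul]
    intro l _
    rw [← hs, ← Finset.card_filter_add_card_filter_not (s := s) (· < b l)]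
    simp only [not_lt]
  have h4 : ∑ j ∈ s, (s.filter (· < j)).card + m = m * (2 * m) := by
    have := pair_count s
    rw [hs] at this
    rcases Nat.eq_zero_or_pos m with h | h
    · subst h; simp at this ⊢; simpa using this
    · obtain ⟨c, rfl⟩ := Nat.exists_eq_succ_of_ne_zero h.ne'
      have e : 2 * c.succ - 1 = 2 * c + 1 := by omega
      rw [e] at this
      have : ∑ j ∈ s, (s.filter (· < j)).card = c.succ * (2 * c + 1) := by nlinarith
      rw [this, Nat.succ_eq_add_one]; ring
  set a := ∑ l ∈ L, (s.filter (· < b l)).card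
  set a' := ∑ l ∈ L, (s.filter (b l ≤ ·)).card
  set e := ∑ j ∈ s, (s.filter (· < j)).card
  have key : Ek s L b (fun l => t * z l) κ / den s L b (fun l => t * z l) κ =
      Ek s L b z κ / den s L b z κ := by
    have hE : Ek s L b (fun l => t * z l) κ = t ^ e * Ek s L b z κ / t ^ a' := by
      rw [← h2]; field_simp
    have hD : den s L b (fun l => t * z l) κ = t ^ a * den s L b z κ / t ^ m := by
      rw [← h1]; field_simp
    have h5 : t ^ e * t ^ m = t ^ a * t ^ a' := by rw [← pow_add, ← pow_add, h4, h3]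
    rw [hE, hD, div_div_div_eq]
    have h6 : t ^ e * Ek s L b z κ * t ^ m = (t ^ a * t ^ a') * Ek s L b z κ := by rw [← h5]; ring
    have h7 : t ^ a' * (t ^ a * den s L b z κ) = (t ^ a * t ^ a') * den s L b z κ := by ring
    rw [h6, h7, mul_div_mul_left]
    exact mul_ne_zero (pow_ne_zero _ ht) (pow_ne_zero _ ht)
  rw [mul_div_assoc, key]
  ring

theorem Ppol_deg {m : ℕ} {s : Finset ℕ} {L : Finset (Fin M)} (b : Fin M → ℕ) (hs : s.card = 2 * m)
    (hL : L.card = m) : (Ppol s L b).totalDegree ≤ m * (m - 1) := by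
  apply deg_of_scale (s := s)
  intro z hz t ht
  rw [Ppol_eval L b hz, Ppol_eval, Psum, Psum, Finset.mul_sum]
  · exact Finset.sum_congr rfl fun κ hκ => Fk_scale hs hL z hκ ht
  · intro a ha c hc h
    exact hz ha hc (mul_left_cancel₀ ht h)

end Kernel

/-- Rank (number of smaller elements). -/
def rk {α : Type*} [LinearOrder α] (s : Finset α) (x : α) : ℕ := (s.filter (· < x)).card

theorem rk_mono {α : Type*} [LinearOrder α] (s : Finset α) {x y : α} (h : x ≤ y) :
    rk s x ≤ rk s y :=
  Finset.card_le_card (Finset.monotone_filter_right s fun _ _ ha => lt_of_lt_of_le ha h)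

theorem rk_lt {α : Type*} [LinearOrder α] {s : Finset α} {x y : α} (hx : x ∈ s) (h : x < y) :
    rk s x < rk s y := by
  apply Finset.card_lt_card
  refine ⟨Finset.monotone_filter_right s fun _ _ ha => lt_trans ha h, ?_⟩
  intro hsub
  have := hsub (Finset.mem_filter.mpr ⟨hx, h⟩)
  simp at this

theorem rk_insert_lt {α : Type*} [LinearOrder α] {s : Finset α} {x a : α} (ha : a ∉ s) (h : a < x) :
    rk (insert a s) x = rk s x + 1 := by
  unfold rk
  rw [Finset.filter_insert, if_pos h, Finset.card_insert_of_notMem (by simp [ha])]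

theorem rk_insert_ge {α : Type*} [LinearOrder α] {s : Finset α} {x a : α} (h : ¬ a < x) :
    rk (insert a s) x = rk s x := by
  unfold rk
  rw [Finset.filter_insert, if_neg h]

theorem exists_rk {α : Type*} [LinearOrder α] (s : Finset α) :
    ∀ a, a < s.card → ∃ l ∈ s, rk s l = a := by
  induction s using Finset.induction_on_max with
  | empty => simp
  | insert x s hx ih =>
    intro a ha
    have hna : x ∉ s := fun h => lt_irrefl _ (hx x h)
    rw [Finset.card_insert_of_notMem hna] at ha
    by_cases h : a = s.card
    · refine ⟨x, Finset.mem_insert_self _ _, ?_⟩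
      rw [rk_insert_ge (lt_irrefl x), rk, Finset.filter_true_of_mem hx, h]
    · obtain ⟨l, hl, hr⟩ := ih a (by omega)
      refine ⟨l, Finset.mem_insert_of_mem hl, ?_⟩
      rw [rk_insert_ge (hx l hl).not_gt, hr]

theorem rk_lt_card {α : Type*} [LinearOrder α] {s : Finset α} {x : α} (hx : x ∈ s) :
    rk s x < s.card := by
  apply Finset.card_lt_card
  refine ⟨Finset.filter_subset _ _, fun h => ?_⟩
  have := h hx
  simp at this

theorem NCw.prod {s : Finset ℕ} {z : ℕ → ℂ} (h : NCw s z) : ∀ m, s.card = 2 * m →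
    ∏ i ∈ s, (-(z i - 1)) = 3 ^ m := by
  induction h with
  | nil z =>
    intro m hm
    simp at hm
    simp [hm]
  | cons s z i j hi hj hij hadj hzi hzj h ih =>
    intro m hm
    have hpos : 0 < s.card := Finset.card_pos.mpr ⟨i, hi⟩
    obtain ⟨m, rfl⟩ := Nat.exists_eq_succ_of_ne_zero (show m ≠ 0 by omega)
    have hj' : j ∈ s.erase i := Finset.mem_erase.mpr ⟨hij.ne', hj⟩
    have hc : ((s.erase i).erase j).card = 2 * m := by
      rw [Finset.card_erase_of_mem hj', Finset.card_erase_of_mem hi]; omega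
    rw [← Finset.mul_prod_erase s _ hi, ← Finset.mul_prod_erase _ _ hj', ih m hc, hzi, hzj,
      Nat.succ_eq_add_one]
    linear_combination (3 : ℂ) ^ m * (q_cubed - q_sum)

def Alt (s : Finset ℕ) (z : ℕ → ℂ) : Prop := ∀ i ∈ s, (z i = q ^ 2 ↔ Even (rk s i))

section Kernel
variable {M : ℕ}

theorem fac_val {m : ℕ} {s' : Finset ℕ} {L' : Finset (Fin M)} {l0 : Fin M} {k k' : ℕ} {z : ℕ → ℂ}
    (hs : s'.card = 2 * m) (hL : L'.card = m) (hl0 : l0 ∉ L') (hnc : NCw s' z) (hk : k < k')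
    (hsk : ∀ x ∈ s', x < k ∨ k' < x) (hz : z k = q ^ 2) :
    fac s' L' l0 k k' z * q ^ (rk s' k + rk L' l0) = (-3) ^ m := by
  have h1 := hnc.prod m hs
  have hcL : (L'.filter (l0 < ·)).card + rk L' l0 = m := by
    rw [← hL, ← Finset.card_filter_add_card_filter_not (s := L') (l0 < ·)]
    congr 1
    unfold rk
    congr 1
    apply Finset.filter_congr
    intro x hx
    have : x ≠ l0 := fun h => hl0 (h ▸ hx)
    rw [not_lt, le_iff_lt_or_eq]
    simp [this]
  have hf : s'.filter (k' < ·) = s'.filter (fun x => ¬ x < k) := by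
    apply Finset.filter_congr
    intro x hx
    rcases hsk x hx with h | h <;> constructor <;> intro <;> omega
  have hcs : (s'.filter (k' < ·)).card + rk s' k = 2 * m := by
    rw [← hs, ← Finset.card_filter_add_card_filter_not (s := s') (· < k), hf, rk, add_comm]
  have h2 : (∏ i ∈ s'.filter (· < k), (-(z i - q * z k))) *
    ∏ j ∈ s'.filter (k' < ·), (-q * (z j - q * z k)) = q ^ (s'.filter (k' < ·)).card * 3 ^ m := by
    rw [← h1, ← Finset.prod_filter_mul_prod_filter_not s' (· < k) (fun i => -(z i - 1)), ← hf,
      ← Finset.prod_const, mul_left_comm, ← Finset.prod_mul_distrib]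
    congr 1
    · apply Finset.prod_congr rfl
      intro i _
      rw [hz]; linear_combination q_cubed
    · apply Finset.prod_congr rfl
      intro i _
      rw [hz]; linear_combination q * q_cubed
  unfold fac
  rw [mul_assoc (_ * _) (∏ i ∈ s'.filter (· < k), (-(z i - q * z k))), h2]
  have h3 : (L'.filter (· < l0)).card = rk L' l0 := rfl
  rw [h3]
  set A := (L'.filter (l0 < ·)).card
  set B := (s'.filter (k' < ·)).card
  have e1 : (-q) ^ A = (-1) ^ A * q ^ A := by rw [← mul_pow]; ring
  have e2 : (-3 : ℂ) ^ m = (-1) ^ (A + rk L' l0) * 3 ^ m := by rw [hcL, ← mul_pow]; norm_num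
  have e3 : q ^ (A + rk L' l0 + (B + rk s' k)) = 1 := by
    rw [hcL, hcs]
    have : m + 2 * m = 3 * m := by ring
    rw [this, pow_mul, q_cubed, one_pow]
  rw [e1, e2]
  linear_combination (-1) ^ (A + rk L' l0) * 3 ^ m * e3

theorem Ppol_empty (b : Fin M → ℕ) (z : ℕ → ℂ) : eval z (Ppol ∅ ∅ b) = 1 := by
  rw [Ppol_eval _ _ (by simp), Psum]
  have : Fintype.piFinset (Ak ∅ (∅ : Finset (Fin M)) b) = {fun _ => 0} := by
    ext κ
    simp [Ak, funext_iff]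
  rw [this, Finset.sum_singleton]
  simp [Fk, prs, Ek, den]

theorem NC_val {s : Finset ℕ} {z : ℕ → ℂ} (hnc : NCw s z) : ∀ (m : ℕ) (L : Finset (Fin M)),
    s.card = 2 * m → L.card = m → ∃ e : Fin M → ℕ, (∀ l, e l ≤ 1) ∧
      (∀ ε b : Fin M → ℕ, (∀ l, ε l ≤ 1) → (∀ l ∈ L, rk s (b l) = 2 * rk L l + 1 + ε l) →
        q ^ (∑ l ∈ L, ε l) * eval z (Ppol s L b) =
          if ∀ l ∈ L, ε l = e l then (-3) ^ (∑ i ∈ Finset.range m, i) else 0) ∧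
      ((∀ l ∈ L, e l = 0) ↔ Alt s z) := by
  induction hnc with
  | nil z =>
    intro m L hm hL
    have hm0 : m = 0 := by simpa using hm.symm
    subst hm0
    have hL0 : L = ∅ := Finset.card_eq_zero.mp hL
    subst hL0
    refine ⟨fun _ => 0, by simp, ?_, by simp [Alt]⟩
    intro ε b _ _
    rw [Ppol_empty]; simp
  | cons s z k k' hk hk' hkk hadj hzk hzk' h ih =>
    intro m L hm hL
    have hpos : 0 < s.card := Finset.card_pos.mpr ⟨k, hk⟩
    obtain ⟨m, rfl⟩ := Nat.exists_eq_succ_of_ne_zero (show m ≠ 0 by omega)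
    have hk'e : k' ∈ s.erase k := Finset.mem_erase.mpr ⟨hkk.ne', hk'⟩
    set s' := (s.erase k).erase k' with hs'
    have hc : s'.card = 2 * m := by
      rw [hs', Finset.card_erase_of_mem hk'e, Finset.card_erase_of_mem hk]; omega
    have es : s = insert k (insert k' s') := by
      rw [hs', Finset.insert_erase hk'e, Finset.insert_erase hk]
    have hks' : k' ∉ s' := by simp [hs']
    have hks : k ∉ insert k' s' := by simp [hs', hkk.ne]
    have hsk : ∀ x ∈ s', x < k ∨ k' < x := by
      intro x hx
      have hxs : x ∈ s := by rw [es]; simp [hx]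
      have h1 : x ≠ k := by rintro rfl; exact hks (by simp [hx])
      have h2 : x ≠ k' := by rintro rfl; exact hks' hx
      have := hadj x hxs
      omega
    set r := rk s k with hr
    have rk1 : ∀ x, x ≤ k → rk s x = rk s' x := by
      intro x hx
      rw [es, rk_insert_ge (by omega), rk_insert_ge (by omega)]
    have rk3 : ∀ x, k' < x → rk s x = rk s' x + 2 := by
      intro x hx
      rw [es, rk_insert_lt hks (by omega), rk_insert_lt hks' (by omega)]
    have rksk : rk s' k' = r := by
      rw [hr, rk1 k le_rfl]
      unfold rk
      congr 1
      apply Finset.filter_congr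
      intro x hx
      have := hsk x hx
      omega
    have hrs'k : rk s' k = r := by rw [hr, rk1 k le_rfl]
    have rk_k' : rk s k' = r + 1 := by
      rw [es, rk_insert_lt hks hkk, rk_insert_ge (lt_irrefl _), rksk]
    have c1 : ∀ x, x ≤ k → rk s x ≤ r := fun x hx => rk_mono s hx
    have c2 : ∀ x, k < x → x ≤ k' → rk s x = r + 1 := by
      intro x h1 h2
      have := rk_lt hk h1
      have := rk_mono s h2
      omega
    have c3 : ∀ x, k' < x → r + 2 ≤ rk s x := by
      intro x h1
      have := rk_lt hk' h1
      omega
    have hr2 : r + 1 < 2 * (m + 1) := by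
      have := rk_lt_card hk'
      rw [rk_k', hm] at this
      exact this
    obtain ⟨l0, hl0, hrl0⟩ := exists_rk L (r / 2) (by omega)
    set L' := L.erase l0 with hL'
    have hl0' : l0 ∉ L' := by simp [hL']
    have eL : L = insert l0 L' := by rw [hL', Finset.insert_erase hl0]
    have hLc : L'.card = m := by rw [hL', Finset.card_erase_of_mem hl0, hL]; rfl
    have rkL0 : rk L' l0 = r / 2 := by
      rw [← hrl0, eL, rk_insert_ge (lt_irrefl _)]
    obtain ⟨e', he1, he2, he3⟩ := ih m L' hc hLc
    refine ⟨fun l => if l = l0 then r % 2 else e' l, ?_, ?_, ?_⟩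
    · intro l
      simp only
      split_ifs
      · omega
      · exact he1 l
    · intro ε b hε hb
      have hzz : z k' = q ^ 2 * z k := by
        rw [hzk, hzk']; linear_combination - q * q_cubed
      by_cases hεr : ε l0 = r % 2
      · have hb0 : rk s (b l0) = r + 1 := by
          rw [hb l0 hl0, hrl0, hεr]; omega
        have hb1 : k < b l0 := by
          by_contra h
          have := c1 (b l0) (by omega)
          omega
        have hb2 : b l0 ≤ k' := by
          by_contra h
          have := c3 (b l0) (by omega)
          omega
        have hbl : ∀ l ∈ L, (l < l0 → b l ≤ k) ∧ (l0 < l → k' < b l) := by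
          intro l hl
          have h1 := hb l hl
          have h2 := hε l
          constructor
          · intro hlt
            have h3 := rk_lt hl hlt
            by_contra h
            have h4 := c2 (k + 1) (by omega) (by omega)
            have h5 := rk_mono s (show k + 1 ≤ b l by omega)
            omega
          · intro hlt
            have h3 := rk_lt hl0 hlt
            by_contra h
            have h5 := rk_mono s (show b l ≤ k' by omega)
            omega
        rw [Ppol_rec hk hk' hkk hadj hl0 hbl hb1 hb2 hzz, ← hs', ← hL']
        have hf := fac_val hc hLc hl0' h hkk hsk hzk
        rw [hrs'k, rkL0] at hf
        have hq : q ^ (r + r / 2) = q ^ (r % 2) := by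
          have : r + r / 2 = 3 * (r / 2) + r % 2 := by omega
          rw [this, pow_add, pow_mul, q_cubed, one_pow, one_mul]
        rw [hq] at hf
        have hrec := he2 ε b hε (by
          intro l hl
          have hlL : l ∈ L := by rw [eL]; simp [hl]
          have hne : l ≠ l0 := by rintro rfl; exact hl0' hl
          have h1 := hb l hlL
          rcases lt_or_gt_of_ne hne with h2 | h2
          · rw [← rk1 _ ((hbl l hlL).1 h2), h1, eL, rk_insert_ge h2.not_gt]
          · have h3 := rk3 _ ((hbl l hlL).2 h2)
            have h4 : rk L l = rk L' l + 1 := by rw [eL, rk_insert_lt hl0' h2]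
            omega)
        have hsum : ∑ l ∈ L, ε l = r % 2 + ∑ l ∈ L', ε l := by
          rw [eL, Finset.sum_insert hl0', hεr]
        have hiff : (∀ l ∈ L, ε l = if l = l0 then r % 2 else e' l) ↔ ∀ l ∈ L', ε l = e' l := by
          constructor
          · intro h l hl
            have hne : l ≠ l0 := by rintro rfl; exact hl0' hl
            have := h l (by rw [eL]; simp [hl])
            rwa [if_neg hne] at this
          · intro h l hl
            by_cases hne : l = l0
            · rw [if_pos hne, hne, hεr]
            · rw [if_neg hne]
              exact h l (by rw [hL']; simp [hne, hl])
        rw [hsum, pow_add]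
        have e3 : q ^ (r % 2) * q ^ (∑ l ∈ L', ε l) * (fac s' L' l0 k k' z * eval z (Ppol s' L' b)) =
          (fac s' L' l0 k k' z * q ^ (r % 2)) * (q ^ (∑ l ∈ L', ε l) * eval z (Ppol s' L' b)) := by
          ring
        rw [e3, hf, hrec, Finset.sum_range_succ, pow_add]
        simp only [hiff]
        split_ifs
        · ring
        · ring
      · rw [Ppol_zero hk hk' hkk ?_ hzz, mul_zero, if_neg]
        · intro h
          have := h l0 hl0
          simp only [if_true] at this
          exact hεr this
        · rintro l hl ⟨h1, h2⟩
          have h3 := c2 _ h1 h2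
          have h4 := hb l hl
          have h5 := hε l
          have h6 : rk L l = r / 2 := by omega
          have : l = l0 := by
            rcases lt_trichotomy l l0 with h | h | h
            · have := rk_lt hl h; omega
            · exact h
            · have := rk_lt hl0 h; omega
          subst this
          omega
    · have hAlt : Alt s z ↔ (r % 2 = 0 ∧ Alt s' z) := by
        have hst : ∀ i ∈ s', r % 2 = 0 → (Even (rk s i) ↔ Even (rk s' i)) := by
          intro i hi _
          rcases hsk i hi with h | h
          · rw [rk1 i h.le]
          · rw [rk3 i h]; simp [Nat.even_add]
        constructor
        · intro h
          have h1 := (h k hk).mp hzk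
          rw [← hr, Nat.even_iff] at h1
          refine ⟨h1, ?_⟩
          intro i hi
          rw [h i (by rw [es]; simp [hi]), hst i hi h1]
        · rintro ⟨h1, h2⟩ i hi
          rw [es, Finset.mem_insert, Finset.mem_insert] at hi
          rcases hi with rfl | rfl | hi
          · simp [hzk, ← hr, Nat.even_iff, h1]
          · rw [hzk', rk_k']
            have := q_sq_ne_q.symm
            simp only [this, false_iff, Nat.even_iff]
            omega
          · rw [h2 i hi, hst i hi h1]
      rw [hAlt, ← he3]
      simp only
      constructor
      · intro h
        refine ⟨?_, ?_⟩
        · have := h l0 hl0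
          simpa using this
        · intro l hl
          have hne : l ≠ l0 := by rintro rfl; exact hl0' hl
          have := h l (by rw [eL]; simp [hl])
          rwa [if_neg hne] at this
      · rintro ⟨h1, h2⟩ l hl
        by_cases hne : l = l0
        · rw [if_pos hne, h1]
        · rw [if_neg hne]
          exact h2 l (by rw [hL']; simp [hne, hl])

end Kernel

theorem rk_range {N x : ℕ} (h : x ≤ N) : rk (Finset.range N) x = x := by
  unfold rk
  have : (Finset.range N).filter (· < x) = Finset.range x := by
    ext i; simp; omega
  rw [this, Finset.card_range]

theorem rk_fin {n : ℕ} (l : Fin n) : rk (Finset.univ : Finset (Fin n)) l = l := by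
  unfold rk
  have : (Finset.univ : Finset (Fin n)).filter (· < l) = Finset.Iio l := by
    ext i; simp
  rw [this, Fin.card_Iio]

theorem NCw.exists_match {s : Finset ℕ} {z : ℕ → ℂ} (h : NCw s z) : ∃ f : ℕ → ℕ,
    (∀ k ∈ s, f k ∈ s ∧ f (f k) = k ∧ f k ≠ k) ∧
    (∀ a ∈ s, ∀ b ∈ s, ∀ c ∈ s, ∀ d ∈ s, a < b → b < c → c < d → f a = c → f b = d → False) ∧
    ∀ k ∈ s, z k = if k < f k then q ^ 2 else q := by
  induction h with
  | nil z => exact ⟨id, by simp, by simp, by simp⟩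
  | cons s z i j hi hj hij hadj hzi hzj h ih =>
    obtain ⟨f, h1, h2, h3⟩ := ih
    set s' := (s.erase i).erase j with hs'
    have hmem : ∀ x, x ∈ s' ↔ x ∈ s ∧ x ≠ i ∧ x ≠ j := by
      intro x; simp [hs']; tauto
    have hfi : ∀ x ∈ s', f x ≠ i ∧ f x ≠ j := fun x hx => ((hmem _).mp (h1 x hx).1).2
    set g : ℕ → ℕ := fun x => if x = i then j else if x = j then i else f x with hg
    have gi : g i = j := by simp [hg]
    have gj : g j = i := by simp [hg, hij.ne']
    have gs : ∀ x ∈ s', g x = f x := by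
      intro x hx
      have := ((hmem x).mp hx).2
      simp [hg, this.1, this.2]
    have hcase : ∀ x ∈ s, x = i ∨ x = j ∨ x ∈ s' := by
      intro x hx; rw [hmem]; tauto
    have gg : ∀ k ∈ s, g k ∈ s ∧ g (g k) = k ∧ g k ≠ k := by
      intro k hk
      rcases hcase k hk with rfl | rfl | hk'
      · rw [gi, gj]; exact ⟨hj, rfl, hij.ne'⟩
      · rw [gj, gi]; exact ⟨hi, rfl, hij.ne⟩
      · have := h1 k hk'
        rw [gs k hk', gs _ this.1]
        exact ⟨((hmem _).mp this.1).1, this.2⟩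
    refine ⟨g, gg, ?_, ?_⟩
    · intro a ha b hb c hc d hd hab hbc hcd hac hbd
      have hca : g c = a := by rw [← hac]; exact (gg a ha).2.1
      have hdb : g d = b := by rw [← hbd]; exact (gg b hb).2.1
      rcases hcase a ha with rfl | rfl | ha'
      · rw [gi] at hac; subst hac; exact hadj b hb ⟨hab, hbc⟩
      · rw [gj] at hac; omega
      rcases hcase b hb with rfl | rfl | hb'
      · rw [gi] at hbd; subst hbd; exact hadj c hc ⟨hbc, hcd⟩
      · rw [gj] at hbd; omega
      rw [gs _ ha'] at hac
      rw [gs _ hb'] at hbd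
      refine h2 a ha' b hb' c ?_ d ?_ hab hbc hcd hac hbd
      · rw [← hac]; exact (h1 a ha').1
      · rw [← hbd]; exact (h1 b hb').1
    · intro k hk
      rcases hcase k hk with rfl | rfl | hk'
      · rw [gi, if_pos hij, hzi]
      · rw [gj, if_neg (by omega), hzj]
      · rw [gs k hk', h3 k hk']

theorem NCw.toNCM {n : ℕ} {z : ℕ → ℂ} (h : NCw (Finset.range (2 * n)) z) :
    ∃ π : NCM n, ∀ k : Fin (2 * n), z k = if k < π.f k then q⁻¹ else q := by
  obtain ⟨f, h1, h2, h3⟩ := h.exists_match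
  have hm : ∀ k : Fin (2 * n), (k : ℕ) ∈ Finset.range (2 * n) := fun k => Finset.mem_range.mpr k.2
  refine ⟨⟨fun k => ⟨f k, Finset.mem_range.mp (h1 k (hm k)).1⟩, ?_, ?_, ?_⟩, ?_⟩
  · intro k
    apply Fin.ext
    exact (h1 k (hm k)).2.1
  · intro k hk
    exact (h1 k (hm k)).2.2 (congrArg Fin.val hk)
  · intro a b c d hab hbc hcd hac hbd
    exact h2 a (hm a) b (hm b) c (hm c) d (hm d) hab hbc hcd (congrArg Fin.val hac)
      (congrArg Fin.val hbd)
  · intro k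
    rw [q_inv]
    exact h3 k (hm k)

theorem NCM.max_of_alt {n : ℕ} (π : NCM n) (h : ∀ k : Fin (2 * n), k < π.f k ↔ Even (k : ℕ)) :
    ∀ j, ∀ hj : j < n, (π.f ⟨2 * j, by omega⟩ : ℕ) = 2 * j + 1 := by
  intro j
  induction j using Nat.strong_induction_on with
  | _ j ih =>
    intro hj
    set y : Fin (2 * n) := ⟨2 * j + 1, by omega⟩ with hy
    have h1 : ¬ y < π.f y := by rw [h]; simp [hy]
    have h2 : (π.f y : ℕ) < 2 * j + 1 := by
      have h3 := π.nofix y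
      have h4 : (π.f y : ℕ) ≠ 2 * j + 1 := fun h5 => h3 (Fin.ext h5)
      have h6 : ¬ (2 * j + 1 < (π.f y : ℕ)) := h1
      omega
    have h3 : Even ((π.f y : Fin (2 * n)) : ℕ) := by
      rw [← h, π.invol]
      exact h2
    obtain ⟨x, hx⟩ := h3
    by_cases hxj : x = j
    · have : π.f y = ⟨2 * j, by omega⟩ := Fin.ext (by rw [hx]; simp; omega)
      rw [← this, π.invol]
    · have h4 := ih x (by omega) (by omega)
      have : π.f y = ⟨2 * x, by omega⟩ := Fin.ext (by rw [hx]; simp; omega)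
      rw [← this, π.invol] at h4
      simp [hy] at h4
      omega

theorem NCM.eq_max {n : ℕ} (π σ : NCM n) (h : ∀ j, ∀ hj : j < n, (π.f ⟨2 * j, by omega⟩ : ℕ) = 2 * j + 1)
    (h' : ∀ j, ∀ hj : j < n, (σ.f ⟨2 * j, by omega⟩ : ℕ) = 2 * j + 1) : π = σ := by
  apply NCM.ext'
  funext k
  rcases Nat.even_or_odd' (k : ℕ) with ⟨j, hj | hj⟩
  · have hk := k.2
    have e : k = ⟨2 * j, by omega⟩ := Fin.ext hj
    apply Fin.ext
    rw [e, h j (by omega), h' j (by omega)]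
  · have hk := k.2
    have e1 : π.f ⟨2 * j, by omega⟩ = k := Fin.ext (by rw [h j (by omega), hj])
    have e2 : σ.f ⟨2 * j, by omega⟩ = k := Fin.ext (by rw [h' j (by omega), hj])
    have e3 := congrArg π.f e1
    have e4 := congrArg σ.f e2
    rw [π.invol] at e3
    rw [σ.invol] at e4
    rw [← e3, ← e4]

theorem NCM.alt_of_max {n : ℕ} (π : NCM n)
    (h : ∀ j, ∀ hj : j < n, (π.f ⟨2 * j, by omega⟩ : ℕ) = 2 * j + 1) (k : Fin (2 * n)) :
    k < π.f k ↔ Even (k : ℕ) := by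
  have hk := k.2
  rcases Nat.even_or_odd' (k : ℕ) with ⟨j, hj | hj⟩
  · have e : k = ⟨2 * j, by omega⟩ := Fin.ext hj
    have h1 := h j (by omega)
    rw [← e] at h1
    rw [Fin.lt_def, h1, hj]
    simp
  · have e1 : π.f ⟨2 * j, by omega⟩ = k := Fin.ext (by rw [h j (by omega), hj])
    have e2 : π.f k = ⟨2 * j, by omega⟩ := by
      have e3 := congrArg π.f e1
      rw [π.invol] at e3
      exact e3.symm
    rw [e2, Fin.lt_def, hj]
    simp

theorem eval_aeval' {σ : Type*} (w : σ → ℂ) (f : σ → MvPolynomial σ ℂ) (p : MvPolynomial σ ℂ) :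
    eval w (aeval f p) = eval (fun l => eval w (f l)) p := by
  induction p using MvPolynomial.induction_on with
  | C a => simp
  | add p r hp hr => rw [map_add, map_add, map_add, hp, hr]
  | mul_X p i hp => rw [map_mul, map_mul, map_mul, hp, aeval_X, eval_X]

/-- The polynomial for `n` little arcs. -/
noncomputable def Pmax (n : ℕ) : MvPolynomial ℕ ℂ :=
  Ppol (Finset.range (2 * n)) (Finset.univ : Finset (Fin n)) (fun l => 2 * (l : ℕ) + 1)

theorem psi_eq (n : ℕ) (p : MvPolynomial (Fin (2 * n)) ℂ) (hp : IsWheel n p) (πmax : NCM n)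
    (hdual : ∀ σ : NCM n, evalNC p σ = if σ = πmax then 1 else 0)
    (hmax : ∀ j, ∀ hj : j < n, (πmax.f ⟨2 * j, by omega⟩ : ℕ) = 2 * j + 1) :
    evalOne p * (-3) ^ (∑ i ∈ Finset.range n, i) = eval (fun _ => 1) (Pmax n) := by
  have hev : ∀ z : ℕ → ℂ, eval z (rename (Fin.val : Fin (2 * n) → ℕ) p) =
      eval (fun k : Fin (2 * n) => z k) p := by
    intro z; rw [eval_rename]; rfl
  have h0 : C ((-3 : ℂ) ^ (∑ i ∈ Finset.range n, i)) * rename (Fin.val : Fin (2 * n) → ℕ) p -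
      Pmax n = 0 := by
    apply wheel_unique n (Finset.range (2 * n)) (by simp)
    · intro i hi j hj k hk hij hjk z hzj hzk
      rw [Finset.mem_range] at hi hj hk
      have h1 : eval z (Pmax n) = 0 := by
        refine Ppol_wheel ?_ i (by simpa using hi) j (by simpa using hj) k (by simpa using hk)
          hij hjk z hzj hzk
        intro l _ l' _ h
        have h : 2 * (l : ℕ) + 1 < 2 * (l' : ℕ) + 1 := h
        rw [Fin.lt_def]; omega
      have h2 := congrArg (eval (fun k : Fin (2 * n) => z k))
        (hp.2 ⟨i, hi⟩ ⟨j, hj⟩ ⟨k, hk⟩ hij hjk)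
      rw [map_zero, eval_aeval'] at h2
      rw [map_sub, map_mul, h1, hev]
      have h3 : eval (fun k : Fin (2 * n) => z k) p = 0 := by
        rw [← h2]
        congr 1
        congr 1
        funext l
        split_ifs with h4 h5
        · rw [h4]; simpa using hzj
        · rw [h5]; simp only [map_mul, eval_C, eval_X]
          rw [hzk]; linear_combination (- q * z i) * q_cubed
        · simp
      rw [h3]; ring
    · refine (totalDegree_sub _ _).trans (max_le ?_ ?_)
      · refine (totalDegree_mul _ _).trans ?_
        rw [totalDegree_C, zero_add]
        exact (totalDegree_rename_le _ _).trans hp.1.totalDegree_le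
      · exact Ppol_deg _ (by simp) (by simp)
    · intro z hz
      obtain ⟨π, hπ⟩ := hz.toNCM
      obtain ⟨e, he1, he2, he3⟩ := NC_val hz n (Finset.univ : Finset (Fin n)) (by simp) (by simp)
      have h1 := he2 (fun _ => 0) (fun l => 2 * (l : ℕ) + 1) (by simp) (by
        intro l _
        have := l.2
        rw [rk_range (by omega), rk_fin])
      simp only [Finset.sum_const_zero, pow_zero, one_mul] at h1
      have h2 : eval (fun k : Fin (2 * n) => z k) p = evalNC p π := by
        rw [evalNC]; congr 2; funext k; exact hπ k
      rw [map_sub, map_mul, eval_C, hev, h2, hdual π, Pmax, h1]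
      have hiff : (∀ l ∈ (Finset.univ : Finset (Fin n)), 0 = e l) ↔ π = πmax := by
        have : (∀ l ∈ (Finset.univ : Finset (Fin n)), 0 = e l) ↔
            (∀ l ∈ (Finset.univ : Finset (Fin n)), e l = 0) := by
          constructor <;> intro h l hl <;> exact (h l hl).symm
        rw [this, he3]
        have halt : Alt (Finset.range (2 * n)) z ↔ ∀ k : Fin (2 * n), k < π.f k ↔ Even (k : ℕ) := by
          have hb : ∀ k : Fin (2 * n), z k = q ^ 2 ↔ k < π.f k := by
            intro k
            rw [hπ k, q_inv]
            split_ifs with h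
            · simp [h]
            · simp [h, q_sq_ne_q.symm]
          constructor
          · intro h k
            have := h k (Finset.mem_range.mpr k.2)
            rw [rk_range k.2.le, hb] at this
            exact this
          · intro h i hi
            rw [Finset.mem_range] at hi
            rw [rk_range hi.le]
            exact (hb ⟨i, hi⟩).trans (h ⟨i, hi⟩)
        rw [halt]
        constructor
        · intro h
          exact NCM.eq_max _ _ (NCM.max_of_alt π h) hmax
        · rintro rfl
          exact NCM.alt_of_max _ hmax
      simp only [hiff]
      split_ifs <;> ring
  have h1 := congrArg (eval fun _ => (1 : ℂ)) h0
  rw [map_sub, map_mul, eval_C, hev, map_zero] at h1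
  rw [evalOne]
  linear_combination h1

/-- Generic alternant matrix. -/
def altm {R : Type*} [CommRing R] (N : ℕ) (e : ℕ → ℕ) (z : ℕ → R) : Matrix (Fin N) (Fin N) R :=
  Matrix.of fun i j => z i ^ e j

theorem alt_div {R : Type*} [CommRing R] [Nontrivial R] (N : ℕ) (e : ℕ → ℕ) (z : ℕ → R) (g : Polynomial R)
    (hg : g = ∏ i ∈ Finset.range N, (Polynomial.X - Polynomial.C (z i))) :
    altm N e z = altm N id z *
      Matrix.of fun (k : Fin N) (j : Fin N) => ((Polynomial.X ^ e j) %ₘ g).coeff k := by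
  have hgm : g.Monic := by rw [hg]; exact Polynomial.monic_prod_X_sub_C _ _
  have hdeg : g.natDegree = N := by
    rw [hg, Polynomial.natDegree_prod_of_monic _ _ (fun i _ => Polynomial.monic_X_sub_C _)]
    simp
  ext i j
  rw [Matrix.mul_apply]
  simp only [altm, Matrix.of_apply, id]
  have hroot : g.eval (z i) = 0 := by
    rw [hg, Polynomial.eval_prod]
    exact Finset.prod_eq_zero (Finset.mem_range.mpr i.2) (by simp)
  have h1 := congrArg (Polynomial.eval (z i))
    (Polynomial.modByMonic_add_div (Polynomial.X ^ e j) g)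
  rw [Polynomial.eval_add, Polynomial.eval_mul, hroot, zero_mul, add_zero, Polynomial.eval_pow,
    Polynomial.eval_X] at h1
  rw [← h1]
  by_cases hN : N = 0
  · exact absurd i.2 (by omega)
  rw [Polynomial.eval_eq_sum_range' (n := N)]
  · rw [← Fin.sum_univ_eq_sum_range (fun k => ((Polynomial.X ^ e j) %ₘ g).coeff k * z i ^ k) N]
    apply Finset.sum_congr rfl
    intro k _
    ring
  · have h2 : g ≠ 1 := by
      intro h
      rw [h, Polynomial.natDegree_one] at hdeg
      omega
    have := Polynomial.natDegree_modByMonic_lt (Polynomial.X ^ e j) hgm h2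
    omega

noncomputable def Gp (N : ℕ) {R : Type*} [CommRing R] (z : ℕ → R) : Polynomial R :=
  ∏ i ∈ Finset.range N, (Polynomial.X - Polynomial.C (z i))

noncomputable def schurp (N : ℕ) (e : ℕ → ℕ) : MvPolynomial ℕ ℂ :=
  Matrix.det (Matrix.of fun (k : Fin N) (j : Fin N) =>
    ((Polynomial.X ^ e j) %ₘ (Gp N (fun i => (X i : MvPolynomial ℕ ℂ)))).coeff k)

theorem schurp_eval (N : ℕ) (e : ℕ → ℕ) (z : ℕ → ℂ) : eval z (schurp N e) =
    Matrix.det (Matrix.of fun (k : Fin N) (j : Fin N) =>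
      ((Polynomial.X ^ e j) %ₘ (Gp N z)).coeff k) := by
  rw [schurp, RingHom.map_det]
  congr 1
  ext k j
  simp only [RingHom.mapMatrix_apply, Matrix.map_apply, Matrix.of_apply]
  have hgm : (Gp N (fun i => (X i : MvPolynomial ℕ ℂ))).Monic :=
    Polynomial.monic_prod_X_sub_C _ _
  rw [← Polynomial.coeff_map, Polynomial.map_modByMonic _ hgm]
  simp [Gp, Polynomial.map_prod]

theorem schurp_alt (N : ℕ) (e : ℕ → ℕ) (z : ℕ → ℂ) :
    (altm N e z).det = (altm N id z).det * eval z (schurp N e) := by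
  rw [schurp_eval, ← Matrix.det_mul, ← alt_div N e z (Gp N z) rfl]

theorem altm_id (N : ℕ) {R : Type*} [CommRing R] (z : ℕ → R) :
    (altm N id z).det = ∏ j ∈ Finset.range N, ∏ i ∈ Finset.range j, (z j - z i) := by
  have : altm N id z = Matrix.vandermonde (fun i : Fin N => z i) := by
    ext i j; simp [altm, Matrix.vandermonde]
  rw [this, Matrix.det_vandermonde]
  have h1 : ∏ i : Fin N, ∏ j ∈ Finset.Ioi i, (z j - z i) =
      ∏ j : Fin N, ∏ i ∈ Finset.Iio j, (z j - z i) :=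
    Finset.prod_comm' (by intro x y; simp)
  rw [h1, ← Fin.prod_univ_eq_prod_range (fun j => ∏ i ∈ Finset.range j, (z j - z i)) N]
  apply Finset.prod_congr rfl
  intro j _
  refine Finset.prod_bij (fun i _ => (i : ℕ)) ?_ ?_ ?_ ?_
  · intro i hi; simpa using hi
  · intro a _ b _ h; exact Fin.ext h
  · intro b hb
    rw [Finset.mem_range] at hb
    exact ⟨⟨b, hb.trans j.2⟩, by simpa [Fin.lt_def] using hb, rfl⟩
  · intro i _; rfl

theorem altm_id_ne {N : ℕ} {z : ℕ → ℂ} (hz : Set.InjOn z (Finset.range N)) :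
    (altm N id z).det ≠ 0 := by
  rw [altm_id, Finset.prod_ne_zero_iff]
  intro j hj
  rw [Finset.prod_ne_zero_iff]
  intro i hi h
  rw [Finset.mem_range] at hi hj
  have := hz (show j ∈ (Finset.range N : Set ℕ) by simpa using hj)
    (show i ∈ (Finset.range N : Set ℕ) by simp; omega) (sub_eq_zero.mp h)
  omega

theorem altm_scale (N : ℕ) (e : ℕ → ℕ) (z : ℕ → ℂ) (t : ℂ) :
    (altm N e (fun i => t * z i)).det = t ^ (∑ j ∈ Finset.range N, e j) * (altm N e z).det := by
  have : altm N e (fun i => t * z i) = Matrix.of fun (i j : Fin N) => (t ^ e j) * altm N e z i j := by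
    ext i j; simp [altm, mul_pow]
  rw [this, Matrix.det_mul_row, Fin.prod_univ_eq_prod_range (fun j => t ^ e j) N,
    Finset.prod_pow_eq_pow_sum]

theorem schurp_deg (N : ℕ) (e : ℕ → ℕ) (d : ℕ)
    (hd : ∑ j ∈ Finset.range N, e j = ∑ j ∈ Finset.range N, j + d) :
    (schurp N e).totalDegree ≤ d := by
  apply deg_of_scale (s := Finset.range N)
  intro z hz t ht
  have h1 := schurp_alt N e z
  have h2 := schurp_alt N e (fun i => t * z i)
  rw [altm_scale, altm_scale, h1, hd, pow_add] at h2
  have h3 := altm_id_ne hz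
  have h4 : t ^ (∑ j ∈ Finset.range N, id j) ≠ 0 := pow_ne_zero _ ht
  apply mul_left_cancel₀ (mul_ne_zero h4 h3)
  rw [← h2]
  simp only [id]
  ring

theorem schurp_wheel (N : ℕ) (e : ℕ → ℕ) (he : ∀ j, e j % 3 = 0 ∨ e j % 3 = 1) :
    WheelOn (Finset.range N) (schurp N e) := by
  have main : ∀ i ∈ Finset.range N, ∀ j ∈ Finset.range N, ∀ k ∈ Finset.range N, i < j → j < k →
      ∀ z : ℕ → ℂ, Set.InjOn z (Finset.range N) →
      z j = q ^ 2 * z i → z k = q * z i → eval z (schurp N e) = 0 := by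
    intro i hi j hj k hk hij hjk z hz hzj hzk
    rw [Finset.mem_range] at hi hj hk
    have h0 : (altm N e z).det = 0 := by
      rw [← Matrix.exists_vecMul_eq_zero_iff]
      refine ⟨Pi.single ⟨i, hi⟩ q + Pi.single ⟨j, hj⟩ 1 + Pi.single ⟨k, hk⟩ (q ^ 2), ?_, ?_⟩
      · intro h
        have := congrFun h ⟨i, hi⟩
        simp [hij.ne, (hij.trans hjk).ne, q_ne_zero] at this
      · ext c
        simp only [Matrix.add_vecMul, Matrix.single_vecMul, Pi.add_apply, Pi.smul_apply,
          Pi.zero_apply, Matrix.row_apply, smul_eq_mul, altm, Matrix.of_apply]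
        rw [hzj, hzk, mul_pow, mul_pow, ← pow_mul]
        have hq := Nat.div_add_mod (e c) 3
        have e1 : q ^ e c = q ^ (e c % 3) := by
          conv_lhs => rw [← hq, pow_add, pow_mul, q_cubed, one_pow, one_mul]
        have e2 : q ^ (2 * e c) = q ^ (2 * (e c % 3)) := by
          rw [mul_comm, pow_mul, e1, ← pow_mul, mul_comm]
        rw [e1, e2]
        rcases he c with h | h <;> rw [h]
        · linear_combination (z i ^ e c) * q_sum
        · linear_combination (z i ^ e c) * (q * q_sum)
    rw [schurp_alt] at h0
    exact (mul_eq_zero.mp h0).resolve_left (altm_id_ne hz)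
  intro i hi j hj k hk hij hjk z hzj hzk
  set v : ℕ → ℂ := fun l : ℕ => if l = j then q ^ 2 * ((i : ℂ) + 1) else
      if l = k then q * ((i : ℂ) + 1) else (l : ℂ) + 1 with hv
  have := path_zero (s := Finset.range N) (z := z) (v := v) (dir3_inj i j k).injOn
    (F := fun t => eval (fun i => z i + t * v i) (schurp N e)) (cont_line _ _ _) (by
      intro t ht
      apply main i hi j hj k hk hij hjk _ ht
      · have : v j = q ^ 2 * v i := by simp [hv, hij.ne, (hij.trans hjk).ne]
        rw [hzj, this]; ring
      · have : v k = q * v i := by simp [hv, hjk.ne', hij.ne, (hij.trans hjk).ne]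
        rw [hzk, this]; ring)
  simpa using this

/-- The exponents. -/
def ex (j : ℕ) : ℕ := 3 * (j / 2) + j % 2

theorem ex_even (j : ℕ) : ex (2 * j) = 3 * j := by unfold ex; omega
theorem ex_odd (j : ℕ) : ex (2 * j + 1) = 3 * j + 1 := by unfold ex; omega

theorem ex_mono {i j : ℕ} (h : i < j) : ex i < ex j := by unfold ex; omega

theorem ex_sum (m : ℕ) : ∑ j ∈ Finset.range (2 * m), ex j =
    ∑ j ∈ Finset.range (2 * m), j + m * (m - 1) := by
  induction m with
  | zero => simp
  | succ m ih =>
    have : 2 * (m + 1) = 2 * m + 1 + 1 := by ring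
    rw [this, Finset.sum_range_succ, Finset.sum_range_succ, Finset.sum_range_succ,
      Finset.sum_range_succ, ih, ex_even, ex_odd]
    rcases m with _ | m
    · simp
    · simp; ring

theorem prod_range_two {R : Type*} [CommMonoid R] (m : ℕ) (g : ℕ → R) :
    ∏ i ∈ Finset.range (2 * m), g i = ∏ i ∈ Finset.range m, (g (2 * i) * g (2 * i + 1)) := by
  induction m with
  | zero => simp
  | succ m ih =>
    have : 2 * (m + 1) = 2 * m + 1 + 1 := by ring
    rw [this, Finset.prod_range_succ, Finset.prod_range_succ, Finset.prod_range_succ, ih, mul_assoc]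

theorem pp_range_two {R : Type*} [CommMonoid R] (m : ℕ) (f : ℕ → ℕ → R) :
    ∏ j ∈ Finset.range (2 * m), ∏ i ∈ Finset.range j, f i j =
    ∏ j ∈ Finset.range m, ((∏ i ∈ Finset.range j, ((f (2 * i) (2 * j) * f (2 * i + 1) (2 * j)) *
      (f (2 * i) (2 * j + 1) * f (2 * i + 1) (2 * j + 1)))) * f (2 * j) (2 * j + 1)) := by
  rw [prod_range_two]
  apply Finset.prod_congr rfl
  intro j _
  rw [Finset.prod_range_succ, prod_range_two, prod_range_two, ← mul_assoc,
    ← Finset.prod_mul_distrib]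

theorem cont_pos {F : ℝ → ℂ} (hF : Continuous F) (h : ∀ t : ℝ, 0 < t → F t = 0) : F 0 = 0 := by
  have hc : IsClosed {t : ℝ | F t = 0} := isClosed_eq hF continuous_const
  have h1 : Set.Ioi (0 : ℝ) ⊆ {t : ℝ | F t = 0} := fun t ht => h t ht
  have h2 := closure_minimal h1 hc
  rw [closure_Ioi] at h2
  exact h2 (Set.mem_Ici.mpr le_rfl)

theorem cont_path (p : MvPolynomial ℕ ℂ) (z : ℝ → ℕ → ℂ) (hz : ∀ i, Continuous fun t => z t i) :
    Continuous fun t : ℝ => eval (z t) p :=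
  (MvPolynomial.continuous_eval p).comp (continuous_pi hz)

theorem NCw.Gp {s : Finset ℕ} {z : ℕ → ℂ} (h : NCw s z) : ∀ m, s.card = 2 * m →
    ∏ i ∈ s, (Polynomial.X - Polynomial.C (z i)) =
      ((Polynomial.X - Polynomial.C (q ^ 2)) * (Polynomial.X - Polynomial.C q)) ^ m := by
  induction h with
  | nil z =>
    intro m hm
    simp at hm
    simp [hm]
  | cons s z i j hi hj hij hadj hzi hzj h ih =>
    intro m hm
    have hpos : 0 < s.card := Finset.card_pos.mpr ⟨i, hi⟩
    obtain ⟨m, rfl⟩ := Nat.exists_eq_succ_of_ne_zero (show m ≠ 0 by omega)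
    have hj' : j ∈ s.erase i := Finset.mem_erase.mpr ⟨hij.ne', hj⟩
    have hc : ((s.erase i).erase j).card = 2 * m := by
      rw [Finset.card_erase_of_mem hj', Finset.card_erase_of_mem hi]; omega
    rw [← Finset.mul_prod_erase s _ hi, ← Finset.mul_prod_erase _ _ hj', ih m hc, hzi, hzj,
      Nat.succ_eq_add_one]
    ring

/-- The two primitive cube roots. -/
noncomputable def rho (a : ℕ) : ℂ := if a % 2 = 0 then q ^ 2 else q

theorem rho_cubed (a : ℕ) : rho a ^ 3 = 1 := by
  unfold rho
  have := q_cubed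
  split_ifs
  · rw [← pow_mul, mul_comm, pow_mul, this, one_pow]
  · exact this

theorem rho_even (a : ℕ) : rho (2 * a) = q ^ 2 := by simp [rho]
theorem rho_odd (a : ℕ) : rho (2 * a + 1) = q := by
  have : (2 * a + 1) % 2 = 1 := by omega
  simp [rho, this]

theorem altm_ex (m : ℕ) (x : ℕ → ℂ) :
    (altm (2 * m) ex (fun k => rho k * x (k / 2))).det =
      (∏ i ∈ Finset.range m, ((q - q ^ 2) * x i)) *
        (∏ j ∈ Finset.range m, ∏ i ∈ Finset.range j, (x j ^ 3 - x i ^ 3)) ^ 2 := by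
  set E : Fin 2 × Fin m ≃ Fin (2 * m) :=
    ((Equiv.prodComm _ _).trans finProdFinEquiv).trans (finCongr (mul_comm m 2)) with hE
  have hEv : ∀ a i, ((E (a, i) : Fin (2 * m)) : ℕ) = a + 2 * i := by
    intro a i
    simp [hE]
  set R : Fin m → Matrix (Fin 2) (Fin 2) ℂ := fun i => Matrix.of fun a b =>
    (rho a * x i) ^ (b : ℕ) with hR
  have h1 : (altm (2 * m) ex (fun k => rho k * x (k / 2))).submatrix E E =
      Matrix.blockDiagonal R *
        Matrix.kroneckerMap (· * ·) (1 : Matrix (Fin 2) (Fin 2) ℂ)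
          (altm m id (fun i => x i ^ 3)) := by
    ext ⟨a, i⟩ ⟨b, j⟩
    rw [Matrix.mul_apply, Fintype.sum_prod_type]
    simp only [Matrix.submatrix_apply, altm, Matrix.of_apply, hEv, Matrix.blockDiagonal_apply,
      Matrix.kroneckerMap_apply, hR, Matrix.one_apply, id]
    have ha := a.2
    have hb := b.2
    have e1 : ((a : ℕ) + 2 * i) / 2 = i := by omega
    have e2 : rho ((a : ℕ) + 2 * i) = rho a := by
      unfold rho
      have : ((a : ℕ) + 2 * i) % 2 = a % 2 := by omega
      rw [this]
    have e3 : ex ((b : ℕ) + 2 * j) = 3 * j + b := by unfold ex; omega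
    rw [e1, e2, e3]
    rw [Finset.sum_eq_single b, Finset.sum_eq_single i]
    · simp only [if_true, one_mul]
      rw [pow_add, pow_mul, mul_pow (rho _) _ 3, rho_cubed, one_mul]
      ring
    · intro i' _ hne
      rw [if_neg (Ne.symm hne), zero_mul]
    · simp
    · intro b' _ hne
      apply Finset.sum_eq_zero
      intro i' _
      rw [if_neg hne, zero_mul, mul_zero]
    · simp
  have h2 := congrArg Matrix.det h1
  rw [Matrix.det_submatrix_equiv_self, Matrix.det_mul, Matrix.det_blockDiagonal,
    Matrix.det_kronecker, Matrix.det_one, one_pow, one_mul, altm_id] at h2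
  rw [h2, Fintype.card_fin]
  congr 1
  rw [← Fin.prod_univ_eq_prod_range (fun i => (q - q ^ 2) * x i) m]
  apply Finset.prod_congr rfl
  intro i _
  rw [Matrix.det_fin_two]
  simp [hR, rho]
  ring

theorem schurp_pair (m : ℕ) (x : ℕ → ℂ) (hx : ∀ i, x i ≠ 0)
    (hx2 : ∀ i j, i < j → x j ^ 3 - x i ^ 3 ≠ 0) :
    eval (fun k => rho k * x (k / 2)) (schurp (2 * m) ex) =
      ∏ j ∈ Finset.range m, ∏ i ∈ Finset.range j, (x j ^ 2 + x j * x i + x i ^ 2) := by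
  have h1 := schurp_alt (2 * m) ex (fun k => rho k * x (k / 2))
  rw [altm_ex, altm_id, pp_range_two] at h1
  set A := ∏ j ∈ Finset.range m, ∏ i ∈ Finset.range j, (x j ^ 3 - x i ^ 3) with hA
  set B := ∏ j ∈ Finset.range m, ∏ i ∈ Finset.range j, (x j - x i) with hB
  set W := ∏ j ∈ Finset.range m, ∏ i ∈ Finset.range j, (x j ^ 2 + x j * x i + x i ^ 2) with hW
  set Cc := ∏ i ∈ Finset.range m, ((q - q ^ 2) * x i) with hC
  have hABW : A = B * W := by
    rw [hA, hB, hW, ← Finset.prod_mul_distrib]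
    apply Finset.prod_congr rfl; intro j _
    rw [← Finset.prod_mul_distrib]
    apply Finset.prod_congr rfl; intro i _
    ring
  have hA0 : A ≠ 0 := by
    rw [hA, Finset.prod_ne_zero_iff]
    intro j _
    rw [Finset.prod_ne_zero_iff]
    intro i hi
    exact hx2 i j (Finset.mem_range.mp hi)
  have hB0 : B ≠ 0 := by intro h; rw [h, zero_mul] at hABW; exact hA0 hABW
  have hC0 : Cc ≠ 0 := by
    rw [hC, Finset.prod_ne_zero_iff]
    intro i _
    exact mul_ne_zero (sub_ne_zero.mpr q_sq_ne_q.symm) (hx i)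
  have hprod : ∏ j ∈ Finset.range m, ((∏ i ∈ Finset.range j,
      (((rho (2 * j) * x (2 * j / 2) - rho (2 * i) * x (2 * i / 2)) *
        (rho (2 * j) * x (2 * j / 2) - rho (2 * i + 1) * x ((2 * i + 1) / 2))) *
      ((rho (2 * j + 1) * x ((2 * j + 1) / 2) - rho (2 * i) * x (2 * i / 2)) *
        (rho (2 * j + 1) * x ((2 * j + 1) / 2) - rho (2 * i + 1) * x ((2 * i + 1) / 2))))) *
      (rho (2 * j + 1) * x ((2 * j + 1) / 2) - rho (2 * j) * x (2 * j / 2))) = A * B * Cc := by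
    have d1 : ∀ j, 2 * j / 2 = j := by intro j; omega
    have d2 : ∀ j, (2 * j + 1) / 2 = j := by intro j; omega
    simp only [rho_even, rho_odd, d1, d2]
    have hAB : A * B = ∏ j ∈ Finset.range m, ∏ i ∈ Finset.range j,
        ((x j ^ 3 - x i ^ 3) * (x j - x i)) := by
      rw [hA, hB, ← Finset.prod_mul_distrib]
      apply Finset.prod_congr rfl; intro j _
      rw [← Finset.prod_mul_distrib]
    rw [Finset.prod_mul_distrib, hAB, hC]
    congr 1
    · apply Finset.prod_congr rfl; intro j _
      apply Finset.prod_congr rfl; intro i _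
      have e1 : (q ^ 2 * x j - q ^ 2 * x i) * (q * x j - q * x i) = (x j - x i) ^ 2 := by
        linear_combination (x j - x i) ^ 2 * q_cubed
      have e2 : (q ^ 2 * x j - q * x i) * (q * x j - q ^ 2 * x i) =
          x j ^ 2 + x j * x i + x i ^ 2 := by
        linear_combination (x j ^ 2 + x i ^ 2 - q * x i * x j) * q_cubed - x i * x j * q_sum
      calc _ = ((q ^ 2 * x j - q ^ 2 * x i) * (q * x j - q * x i)) *
          ((q ^ 2 * x j - q * x i) * (q * x j - q ^ 2 * x i)) := by ring
        _ = _ := by rw [e1, e2]; ring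
    · apply Finset.prod_congr rfl; intro j _
      ring
  rw [hprod] at h1
  apply mul_left_cancel₀ (mul_ne_zero (mul_ne_zero hA0 hB0) hC0)
  rw [← h1, pow_two]
  nth_rewrite 2 [hABW]
  ring

theorem schurp_rho (m : ℕ) : eval rho (schurp (2 * m) ex) = 3 ^ (∑ i ∈ Finset.range m, i) := by
  have := cont_pos (F := fun t : ℝ =>
    eval (fun k => rho k * (1 + (t : ℂ) * ((k / 2 : ℕ) : ℂ))) (schurp (2 * m) ex) -
      ∏ j ∈ Finset.range m, ∏ i ∈ Finset.range j, ((1 + (t : ℂ) * (j : ℂ)) ^ 2 +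
        (1 + (t : ℂ) * (j : ℂ)) * (1 + (t : ℂ) * (i : ℂ)) + (1 + (t : ℂ) * (i : ℂ)) ^ 2)) ?_ ?_
  · simp only [Complex.ofReal_zero, zero_mul, add_zero, mul_one, one_pow] at this
    rw [sub_eq_zero] at this
    rw [← Finset.prod_pow_eq_pow_sum]
    rw [this]
    apply Finset.prod_congr rfl; intro j _
    rw [Finset.prod_const, Finset.card_range]
    norm_num
  · apply Continuous.sub
    · apply cont_path
      intro i; fun_prop
    · fun_prop
  · intro t ht
    rw [sub_eq_zero]
    have hpos : ∀ i : ℕ, (0 : ℝ) < 1 + t * i := fun i => by positivity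
    apply schurp_pair m (fun i => 1 + (t : ℂ) * (i : ℂ))
    · intro i
      have := (hpos i).ne'
      exact_mod_cast this
    · intro i j hij
      have h1 : (1 + t * i : ℝ) < 1 + t * j := by
        have : (i : ℝ) < j := by exact_mod_cast hij
        nlinarith
      have h2 : (1 + t * i : ℝ) ^ 3 < (1 + t * j) ^ 3 := pow_lt_pow_left₀ h1 (hpos i).le (by norm_num)
      have h3 := (sub_pos.mpr h2).ne'
      exact_mod_cast h3

theorem schurp_NC {m : ℕ} {z : ℕ → ℂ} (hz : NCw (Finset.range (2 * m)) z) :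
    eval z (schurp (2 * m) ex) = 3 ^ (∑ i ∈ Finset.range m, i) := by
  have h1 : Gp (2 * m) z = Gp (2 * m) rho := by
    rw [Gp, hz.Gp m (by simp), Gp, prod_range_two]
    simp only [rho_even, rho_odd]
    rw [Finset.prod_const, Finset.card_range]
  rw [← schurp_rho, schurp_eval, schurp_eval, h1]

theorem schurp_one (N : ℕ) (e : ℕ → ℕ) (he : ∀ i j, i < j → e i < e j) :
    eval (fun _ => 1) (schurp N e) * ∏ j ∈ Finset.range N, ∏ i ∈ Finset.range j, ((j - i : ℕ) : ℂ) =
      ∏ j ∈ Finset.range N, ∏ i ∈ Finset.range j, ((e j - e i : ℕ) : ℂ) := by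
  have hgeom : ∀ (a b : ℕ), a < b → ∀ t : ℂ,
      t ^ b - t ^ a = (t - 1) * (t ^ a * ∑ k ∈ Finset.range (b - a), t ^ k) := by
    intro a b hab t
    have := geom_sum_mul t (b - a)
    have e1 : t ^ b = t ^ a * t ^ (b - a) := by rw [← pow_add]; congr 1; omega
    rw [e1]
    linear_combination - t ^ a * this
  have hpp : ∀ (f : ℕ → ℕ), (∀ i j, i < j → f i < f j) → ∀ t : ℂ,
      ∏ j ∈ Finset.range N, ∏ i ∈ Finset.range j, (t ^ f j - t ^ f i) =
      (∏ j ∈ Finset.range N, ∏ i ∈ Finset.range j, (t - 1)) *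
      ∏ j ∈ Finset.range N, ∏ i ∈ Finset.range j,
        (t ^ f i * ∑ k ∈ Finset.range (f j - f i), t ^ k) := by
    intro f hf t
    rw [← Finset.prod_mul_distrib]
    apply Finset.prod_congr rfl; intro j _
    rw [← Finset.prod_mul_distrib]
    apply Finset.prod_congr rfl; intro i hi
    exact hgeom _ _ (hf i j (Finset.mem_range.mp hi)) t
  have := cont_pos (F := fun u : ℝ =>
    eval (fun i => (1 + (u : ℂ)) ^ i) (schurp N e) * ∏ j ∈ Finset.range N, ∏ i ∈ Finset.range j,
        ((1 + (u : ℂ)) ^ i * ∑ k ∈ Finset.range (j - i), (1 + (u : ℂ)) ^ k) -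
    ∏ j ∈ Finset.range N, ∏ i ∈ Finset.range j,
        ((1 + (u : ℂ)) ^ e i * ∑ k ∈ Finset.range (e j - e i), (1 + (u : ℂ)) ^ k)) ?_ ?_
  · simp only [Complex.ofReal_zero, add_zero, one_pow, one_mul, Finset.sum_const,
      Finset.card_range, nsmul_eq_mul, mul_one] at this
    exact sub_eq_zero.mp this
  · apply Continuous.sub
    · apply Continuous.mul
      · apply cont_path
        intro i; fun_prop
      · fun_prop
    · fun_prop
  · intro u hu
    set t : ℂ := 1 + (u : ℂ) with ht
    have h1 := schurp_alt N e (fun i => t ^ i)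
    have h2 : (altm N e (fun i => t ^ i)).det =
        ∏ j ∈ Finset.range N, ∏ i ∈ Finset.range j, (t ^ e j - t ^ e i) := by
      rw [← altm_id N (fun j => t ^ e j), ← Matrix.det_transpose]
      congr 1
      ext i j
      simp only [altm, Matrix.transpose_apply, Matrix.of_apply, id]
      rw [← pow_mul, ← pow_mul, mul_comm]
    rw [h2, altm_id, hpp e he, hpp (fun i => i) (fun i j h => h)] at h1
    have h3 : ∏ j ∈ Finset.range N, ∏ i ∈ Finset.range j, (t - 1) ≠ 0 := by
      rw [Finset.prod_ne_zero_iff]; intro j _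
      rw [Finset.prod_ne_zero_iff]; intro i _
      rw [ht, add_sub_cancel_left]
      exact_mod_cast hu.ne'
    rw [sub_eq_zero]
    apply mul_left_cancel₀ h3
    rw [h1]; ring

theorem prod_refl_diff (g : ℕ → ℂ) (j : ℕ) :
    ∏ i ∈ Finset.range j, g (j - i) = ∏ d ∈ Finset.range j, g (d + 1) := by
  rw [← Finset.prod_range_reflect]
  apply Finset.prod_congr rfl
  intro d hd
  rw [Finset.mem_range] at hd
  congr 1
  omega

theorem step_num (j : ℕ) : ∏ d ∈ Finset.range j, (((3 * (d + 1) : ℕ) : ℂ) * ((3 * (d + 1) - 1 : ℕ) : ℂ) *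
    (((3 * (d + 1) + 1 : ℕ) : ℂ) * ((3 * (d + 1) : ℕ) : ℂ))) =
    ((3 * j + 1).factorial : ℂ) * 3 ^ j * (j.factorial : ℂ) := by
  induction j with
  | zero => simp
  | succ j ih =>
    rw [Finset.prod_range_succ, ih]
    have h1 : 3 * (j + 1) + 1 = 3 * j + 1 + 1 + 1 + 1 := by ring
    rw [h1, Nat.factorial_succ (3 * j + 1 + 1 + 1), Nat.factorial_succ (3 * j + 1 + 1),
      Nat.factorial_succ (3 * j + 1), Nat.factorial_succ j]
    have h2 : 3 * (j + 1) - 1 = 3 * j + 2 := by omega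
    rw [h2]
    push_cast
    ring

theorem step_den (j : ℕ) : ∏ d ∈ Finset.range j, (((2 * (d + 1) : ℕ) : ℂ) * ((2 * (d + 1) - 1 : ℕ) : ℂ) *
    (((2 * (d + 1) + 1 : ℕ) : ℂ) * ((2 * (d + 1) : ℕ) : ℂ))) =
    ((2 * j).factorial : ℂ) * ((2 * j + 1).factorial : ℂ) := by
  induction j with
  | zero => simp
  | succ j ih =>
    rw [Finset.prod_range_succ, ih]
    have h1 : 2 * (j + 1) = 2 * j + 1 + 1 := by ring
    have h2 : 2 * (j + 1) - 1 = 2 * j + 1 := by omega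
    rw [h2, h1, Nat.factorial_succ (2 * j + 1 + 1), Nat.factorial_succ (2 * j + 1)]
    rw [Nat.factorial_succ (2 * j)]
    push_cast
    ring

theorem fac_ne (k : ℕ) : (k.factorial : ℂ) ≠ 0 := by exact_mod_cast k.factorial_ne_zero

theorem ASM_succ (m : ℕ) : ASM (m + 1) * (((2 * m).factorial : ℂ) * ((2 * m + 1).factorial : ℂ)) =
    ASM m * (((3 * m + 1).factorial : ℂ) * (m.factorial : ℂ)) := by
  unfold ASM
  rw [Finset.prod_div_distrib, Finset.prod_div_distrib]
  have h1 : (∏ j ∈ Finset.range (m + 1), ((m + 1 + j).factorial : ℂ)) * (m.factorial : ℂ) =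
      (∏ j ∈ Finset.range m, ((m + j).factorial : ℂ)) *
        (((2 * m).factorial : ℂ) * ((2 * m + 1).factorial : ℂ)) := by
    have h := Finset.prod_range_succ' (fun j => ((m + j).factorial : ℂ)) (m + 1)
    rw [Finset.prod_range_succ, Finset.prod_range_succ] at h
    have e1 : m + (m + 1) = 2 * m + 1 := by ring
    have e2 : m + m = 2 * m := by ring
    rw [e1, e2, add_zero] at h
    rw [← mul_assoc, h]
    congr 1
    apply Finset.prod_congr rfl
    intro j _
    congr 2
    ring
  have hA : (∏ j ∈ Finset.range (m + 1), ((m + 1 + j).factorial : ℂ)) ≠ 0 :=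
    Finset.prod_ne_zero_iff.mpr fun j _ => fac_ne _
  have hB : (∏ j ∈ Finset.range m, ((m + j).factorial : ℂ)) ≠ 0 :=
    Finset.prod_ne_zero_iff.mpr fun j _ => fac_ne _
  rw [Finset.prod_range_succ (fun j => ((3 * j + 1).factorial : ℂ))]
  rw [div_mul_eq_mul_div, div_mul_eq_mul_div, div_eq_div_iff hA hB]
  linear_combination (-(∏ j ∈ Finset.range m, ((3 * j + 1).factorial : ℂ)) * ((3 * m + 1).factorial : ℂ)) * h1

theorem ASM_zero : ASM 0 = 1 := by simp [ASM]

theorem asm_prod (m : ℕ) :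
    (∏ j ∈ Finset.range m, (((3 * j + 1).factorial : ℂ) * 3 ^ j * (j.factorial : ℂ))) =
    3 ^ (∑ i ∈ Finset.range m, i) * ASM m *
      ∏ j ∈ Finset.range m, (((2 * j).factorial : ℂ) * ((2 * j + 1).factorial : ℂ)) := by
  induction m with
  | zero => simp [ASM_zero]
  | succ m ih =>
    rw [Finset.prod_range_succ, ih, Finset.prod_range_succ, Finset.sum_range_succ, pow_add]
    have := ASM_succ m
    linear_combination (-3 ^ (∑ i ∈ Finset.range m, i) * 3 ^ m * ∏ j ∈ Finset.range m, (((2 * j).factorial : ℂ) * ((2 * j + 1).factorial : ℂ))) * this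

theorem schur_asm (m : ℕ) :
    eval (fun _ => 1) (schurp (2 * m) ex) = 3 ^ (∑ i ∈ Finset.range m, i) * ASM m := by
  have h := schurp_one (2 * m) ex (fun i j h => ex_mono h)
  rw [pp_range_two, pp_range_two m (fun i j => ((ex j - ex i : ℕ) : ℂ))] at h
  have hn : ∏ j ∈ Finset.range m, ((∏ i ∈ Finset.range j,
      ((((ex (2 * j) - ex (2 * i) : ℕ) : ℂ) * ((ex (2 * j) - ex (2 * i + 1) : ℕ) : ℂ)) *
      (((ex (2 * j + 1) - ex (2 * i) : ℕ) : ℂ) * ((ex (2 * j + 1) - ex (2 * i + 1) : ℕ) : ℂ)))) *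
      ((ex (2 * j + 1) - ex (2 * j) : ℕ) : ℂ)) =
      ∏ j ∈ Finset.range m, (((3 * j + 1).factorial : ℂ) * 3 ^ j * (j.factorial : ℂ)) := by
    apply Finset.prod_congr rfl; intro j _
    rw [← step_num, ← prod_refl_diff (fun d => (((3 * d : ℕ) : ℂ) * ((3 * d - 1 : ℕ) : ℂ) *
      (((3 * d + 1 : ℕ) : ℂ) * ((3 * d : ℕ) : ℂ))))]
    simp only [ex_even, ex_odd]
    have : (3 * j + 1 - 3 * j : ℕ) = 1 := by omega
    rw [this, Nat.cast_one, mul_one]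
    apply Finset.prod_congr rfl; intro i hi
    rw [Finset.mem_range] at hi
    have e1 : 3 * j - 3 * i = 3 * (j - i) := by omega
    have e2 : 3 * j - (3 * i + 1) = 3 * (j - i) - 1 := by omega
    have e3 : 3 * j + 1 - 3 * i = 3 * (j - i) + 1 := by omega
    have e4 : 3 * j + 1 - (3 * i + 1) = 3 * (j - i) := by omega
    rw [e1, e2, e3, e4]
  have hd : ∏ j ∈ Finset.range m, ((∏ i ∈ Finset.range j,
      ((((2 * j - 2 * i : ℕ) : ℂ) * ((2 * j - (2 * i + 1) : ℕ) : ℂ)) *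
      (((2 * j + 1 - 2 * i : ℕ) : ℂ) * ((2 * j + 1 - (2 * i + 1) : ℕ) : ℂ)))) *
      ((2 * j + 1 - 2 * j : ℕ) : ℂ)) =
      ∏ j ∈ Finset.range m, (((2 * j).factorial : ℂ) * ((2 * j + 1).factorial : ℂ)) := by
    apply Finset.prod_congr rfl; intro j _
    rw [← step_den, ← prod_refl_diff (fun d => (((2 * d : ℕ) : ℂ) * ((2 * d - 1 : ℕ) : ℂ) *
      (((2 * d + 1 : ℕ) : ℂ) * ((2 * d : ℕ) : ℂ))))]
    have : (2 * j + 1 - 2 * j : ℕ) = 1 := by omega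
    rw [this, Nat.cast_one, mul_one]
    apply Finset.prod_congr rfl; intro i hi
    rw [Finset.mem_range] at hi
    have e1 : 2 * j - 2 * i = 2 * (j - i) := by omega
    have e2 : 2 * j - (2 * i + 1) = 2 * (j - i) - 1 := by omega
    have e3 : 2 * j + 1 - 2 * i = 2 * (j - i) + 1 := by omega
    have e4 : 2 * j + 1 - (2 * i + 1) = 2 * (j - i) := by omega
    rw [e1, e2, e3, e4]
  rw [hn, hd, asm_prod] at h
  refine mul_right_cancel₀ ?_ h
  exact Finset.prod_ne_zero_iff.mpr fun j _ => mul_ne_zero (fac_ne _) (fac_ne _)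

noncomputable def Eset (m : ℕ) : Finset (Fin m → ℕ) := Fintype.piFinset (fun _ : Fin m => Finset.range 2)

noncomputable def Ipol (m : ℕ) : MvPolynomial ℕ ℂ :=
  ∑ ε ∈ Eset m, C (q ^ (∑ l, ε l)) *
    Ppol (Finset.range (2 * m)) (Finset.univ : Finset (Fin m)) (fun l => 2 * (l : ℕ) + 1 + ε l)

theorem mem_Eset {m : ℕ} {ε : Fin m → ℕ} : ε ∈ Eset m ↔ ∀ l, ε l ≤ 1 := by
  simp [Eset, Fintype.mem_piFinset, Nat.lt_succ_iff]

theorem Ipol_schur (m : ℕ) :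
    Ipol m = C ((-1) ^ (∑ i ∈ Finset.range m, i)) * schurp (2 * m) ex := by
  rw [← sub_eq_zero]
  apply wheel_unique m (Finset.range (2 * m)) (by simp)
  · intro i hi j hj k hk hij hjk z hzj hzk
    rw [map_sub, map_mul, schurp_wheel (2 * m) ex ?_ i hi j hj k hk hij hjk z hzj hzk, mul_zero,
      sub_zero, Ipol, map_sum]
    · apply Finset.sum_eq_zero
      intro ε hε
      rw [mem_Eset] at hε
      rw [map_mul, Ppol_wheel ?_ i hi j hj k hk hij hjk z hzj hzk, mul_zero]
      intro l _ l' _ h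
      have h : 2 * (l : ℕ) + 1 + ε l < 2 * (l' : ℕ) + 1 + ε l' := h
      have h1 := hε l
      have h2 := hε l'
      rw [Fin.lt_def]
      by_contra h3
      rcases (not_lt.mp h3).eq_or_lt with h4 | h4
      · have : l' = l := Fin.ext h4
        subst this; omega
      · omega
    · intro j; unfold ex; omega
  · refine (totalDegree_sub _ _).trans (max_le ?_ ?_)
    · rw [Ipol]
      apply totalDegree_finsetSum_le
      intro ε _
      refine (totalDegree_mul _ _).trans ?_
      rw [totalDegree_C, zero_add]
      exact Ppol_deg _ (by simp) (by simp)
    · refine (totalDegree_mul _ _).trans ?_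
      rw [totalDegree_C, zero_add]
      exact schurp_deg _ _ _ (ex_sum m)
  · intro z hz
    obtain ⟨e, he1, he2, -⟩ := NC_val hz m (Finset.univ : Finset (Fin m)) (by simp) (by simp)
    rw [map_sub, map_mul, eval_C, schurp_NC hz, Ipol, map_sum, Finset.sum_eq_single e]
    · rw [map_mul, eval_C, he2 e _ he1 ?_]
      · simp only [implies_true, if_true]
        rw [← mul_pow]; norm_num
      · intro l _
        have := l.2
        have := he1 l
        rw [rk_range (by omega), rk_fin]
    · intro ε hε hne
      rw [mem_Eset] at hε
      rw [map_mul, eval_C, he2 ε _ hε ?_]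
      · rw [if_neg]
        intro h
        exact hne (funext fun l => h l (Finset.mem_univ l))
      · intro l _
        have := l.2
        have := hε l
        rw [rk_range (by omega), rk_fin]
    · intro h
      exact absurd (mem_Eset.mpr he1) h

theorem Ipol_one (m : ℕ) : eval (fun _ => 1) (Ipol m) = (-3) ^ (∑ i ∈ Finset.range m, i) * ASM m := by
  rw [Ipol_schur, map_mul, eval_C, schur_asm, ← mul_assoc, ← mul_pow]
  norm_num

noncomputable def DD (N : ℕ) (z : ℕ → ℂ) : ℂ :=
  ∏ j ∈ Finset.range N, ∏ i ∈ Finset.range j, (z i - q * z j)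

/-- Product in the denominator of the one-variable kernel. -/
noncomputable def kd (N : ℕ) (z : ℕ → ℂ) (b k : ℕ) : ℂ :=
  ∏ i ∈ Finset.range N, if i < b then (if i = k then 1 else z k - z i) else z k - q * z i

noncomputable def kr (N : ℕ) (z : ℕ → ℂ) (b k : ℕ) : ℂ :=
  if k < b then (kd N z b k)⁻¹ else 0

noncomputable def SS (N m : ℕ) (z : ℕ → ℂ) (K : Fin m → ℕ → ℂ) : ℂ :=
  ∑ κ ∈ Fintype.piFinset (fun _ : Fin m => Finset.range N),
    prs Finset.univ z κ * ∏ l, K l (κ l)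

theorem Ek_DD {N m : ℕ} {b : Fin m → ℕ} (z : ℕ → ℂ) {κ : Fin m → ℕ}
    (hκ : κ ∈ Fintype.piFinset (Ak (Finset.range N) Finset.univ b)) (hinj : Function.Injective κ) :
    Ek (Finset.range N) Finset.univ b z κ *
      ∏ l, ∏ j ∈ Finset.range N, (if j < b l then 1 else z (κ l) - q * z j) = DD N z := by
  rw [Finset.prod_comm, Ek, DD, ← Finset.prod_mul_distrib]
  apply Finset.prod_congr rfl
  intro j hj
  rw [Finset.mem_range] at hj
  have hf : (Finset.range N).filter (· < j) = Finset.range j := by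
    ext i; simp only [Finset.mem_filter, Finset.mem_range]; omega
  have h1 : ∏ l, (if j < b l then 1 else z (κ l) - q * z j) =
      ∏ l ∈ Finset.univ.filter (b · ≤ j), (z (κ l) - q * z j) := by
    rw [Finset.prod_filter]
    apply Finset.prod_congr rfl
    intro l _
    by_cases h : j < b l
    · rw [if_pos h, if_neg (by omega)]
    · rw [if_neg h, if_pos (by omega)]
  rw [h1, hf]
  apply prod_cancel (Finset.range j) (Finset.univ.filter (b · ≤ j)) κ ?_ hinj.injOn
    (fun i => z i - q * z j) (fun i => ∃ l ∈ Finset.univ, κ l = i ∧ b l ≤ j) ?_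
  · intro l hl
    rw [Finset.mem_filter] at hl
    have := mem_Ak hκ (Finset.mem_univ l)
    rw [Finset.mem_range]; omega
  · intro i _
    simp only [Finset.mem_filter]
    constructor
    · rintro ⟨l, h1, h2, h3⟩; exact ⟨l, ⟨h1, h3⟩, h2⟩
    · rintro ⟨l, ⟨h1, h3⟩, h2⟩; exact ⟨l, h1, h2, h3⟩

theorem den_kd {N m : ℕ} (b : Fin m → ℕ) (z : ℕ → ℂ) (κ : Fin m → ℕ) :
    den (Finset.range N) Finset.univ b z κ *
      ∏ l, ∏ j ∈ Finset.range N, (if j < b l then 1 else z (κ l) - q * z j) =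
    ∏ l, kd N z (b l) (κ l) := by
  rw [den, ← Finset.prod_mul_distrib]
  apply Finset.prod_congr rfl
  intro l _
  have h1 : ((Finset.range N).filter (· < b l)).erase (κ l) =
      (Finset.range N).filter (fun i => i < b l ∧ i ≠ κ l) := by
    ext i; simp only [Finset.mem_erase, Finset.mem_filter]; tauto
  rw [h1, Finset.prod_filter, ← Finset.prod_mul_distrib, kd]
  apply Finset.prod_congr rfl
  intro i _
  by_cases h2 : i < b l <;> by_cases h3 : i = κ l <;> simp [h2, h3]

theorem Fk_rat {N m : ℕ} {b : Fin m → ℕ} {z : ℕ → ℂ} {κ : Fin m → ℕ}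
    (hz : ∀ i < N, ∀ j < N, z i - q * z j ≠ 0)
    (hκ : κ ∈ Fintype.piFinset (Ak (Finset.range N) Finset.univ b)) :
    Fk (Finset.range N) Finset.univ b z κ =
      DD N z * (prs Finset.univ z κ * ∏ l, kr N z (b l) (κ l)) := by
  by_cases hinj : Function.Injective κ
  · have h0 : ∏ l, ∏ j ∈ Finset.range N, (if j < b l then 1 else z (κ l) - q * z j) ≠ 0 := by
      rw [Finset.prod_ne_zero_iff]; intro l _
      rw [Finset.prod_ne_zero_iff]; intro j hj
      have := mem_Ak hκ (Finset.mem_univ l)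
      split_ifs
      · exact one_ne_zero
      · exact hz _ (Finset.mem_range.mp this.1) _ (Finset.mem_range.mp hj)
    have h1 : ∏ l, kr N z (b l) (κ l) = (∏ l, kd N z (b l) (κ l))⁻¹ := by
      rw [← Finset.prod_inv_distrib]
      apply Finset.prod_congr rfl
      intro l _
      rw [kr, if_pos (mem_Ak hκ (Finset.mem_univ l)).2]
    rw [h1, ← den_kd, ← Ek_DD z hκ hinj, Fk, mul_inv, div_eq_mul_inv]
    field_simp
  · have : prs Finset.univ z κ = 0 := by
      apply prs_zero_of_not_inj
      simpa [Set.injOn_univ] using hinj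
    rw [Fk, this]; simp

theorem sum_SS {N m : ℕ} {b : Fin m → ℕ} {z : ℕ → ℂ}
    (hz : ∀ i < N, ∀ j < N, z i - q * z j ≠ 0) (g : Fin m → ℕ → ℂ) :
    ∑ κ ∈ Fintype.piFinset (Ak (Finset.range N) Finset.univ b),
      Fk (Finset.range N) Finset.univ b z κ * ∏ l, g l (κ l) =
    DD N z * SS N m z (fun l k => kr N z (b l) k * g l k) := by
  rw [SS, Finset.mul_sum]
  have hsub : Fintype.piFinset (Ak (Finset.range N) Finset.univ b) ⊆
      Fintype.piFinset (fun _ : Fin m => Finset.range N) := by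
    intro κ hκ
    rw [Fintype.mem_piFinset]
    intro l
    exact (mem_Ak hκ (Finset.mem_univ l)).1
  rw [← Finset.sum_subset hsub]
  · apply Finset.sum_congr rfl
    intro κ hκ
    rw [Fk_rat hz hκ, Finset.prod_mul_distrib]
    ring
  · intro κ h1 h2
    rw [Fintype.mem_piFinset] at h1 h2
    push Not at h2
    obtain ⟨l, hl⟩ := h2
    have h3 : ¬ κ l < b l := by
      intro h
      apply hl
      simp only [Ak, Finset.mem_univ, if_true, Finset.mem_filter]
      exact ⟨h1 l, h⟩
    have : ∏ l, (kr N z (b l) (κ l) * g l (κ l)) = 0 := by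
      apply Finset.prod_eq_zero (Finset.mem_univ l)
      rw [kr, if_neg h3, zero_mul]
    rw [this, mul_zero, mul_zero]

theorem Ppol_SS {N m : ℕ} {b : Fin m → ℕ} {z : ℕ → ℂ} (hinj : Set.InjOn z (Finset.range N))
    (hz : ∀ i < N, ∀ j < N, z i - q * z j ≠ 0) :
    eval z (Ppol (Finset.range N) Finset.univ b) = DD N z * SS N m z (fun l k => kr N z (b l) k) := by
  rw [Ppol_eval _ _ hinj, Psum]
  have := sum_SS (b := b) hz (fun _ _ => 1)
  simpa using this

/-- The master polynomial. -/
theorem Hpol_exists (m : ℕ) : ∃ p : MvPolynomial ℕ ℂ, ∀ z : ℕ → ℂ,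
    Set.InjOn z (Finset.range (2 * m)) →
    (∀ i < 2 * m, ∀ j < 2 * m, z i - q * z j ≠ 0) →
    eval z p = DD (2 * m) z * SS (2 * m) m z (fun l k => kr (2 * m) z (2 * (l : ℕ) + 2) k *
      ((z k - q ^ 2 * z (3 * m + l)) *
        ∏ i ∈ Finset.range (2 * m), if i = k then 1 else z i - q * z (2 * m + l))) := by
  choose G hG using fun l : Fin m => Gpoly (Finset.range (2 * m)) ({l} : Finset (Fin m))
    (C (C q * X (2 * m + l)) : MvPolynomial (Fin m) (MvPolynomial ℕ ℂ))
  obtain ⟨p, hp⟩ := poly_exists_gen (Finset.range (2 * m)) (Finset.univ : Finset (Fin m))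
    (fun l => 2 * (l : ℕ) + 2) (∏ l : Fin m, ((X l - C (C (q ^ 2) * X (3 * m + (l : ℕ)))) * G l))
  refine ⟨p, fun z hinj hz => ?_⟩
  rw [hp z hinj, ← sum_SS hz]
  apply Finset.sum_congr rfl
  intro κ hκ
  congr 1
  rw [map_prod]
  apply Finset.prod_congr rfl
  intro l _
  rw [map_mul, hG l z κ ?_ (by simp) (fun i => i = κ l) ?_]
  · simp [phi]
  · intro l' hl'
    exact (mem_Ak hκ (Finset.mem_univ l')).1
  · intro i _
    simp [eq_comm]

theorem kd_ne {N : ℕ} {z : ℕ → ℂ} (hinj : Set.InjOn z (Finset.range N))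
    (hz : ∀ i < N, ∀ j < N, z i - q * z j ≠ 0) {b k : ℕ} (hk : k < N) : kd N z b k ≠ 0 := by
  rw [kd, Finset.prod_ne_zero_iff]
  intro i hi
  split_ifs with h1 h2
  · exact one_ne_zero
  · rw [sub_ne_zero]
    intro h
    exact h2 (hinj hi (Finset.mem_coe.mpr (Finset.mem_range.mpr hk)) h.symm)
  · exact hz k hk i (Finset.mem_range.mp hi)

theorem kr_id {N : ℕ} {z : ℕ → ℂ} (hinj : Set.InjOn z (Finset.range N))
    (hz : ∀ i < N, ∀ j < N, z i - q * z j ≠ 0) {b k : ℕ} (hb : b < N) (hk : k < N) :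
    kr N z b k + q * kr N z (b + 1) k =
      -q ^ 2 * (kr N z (b + 1) k * (z k - q ^ 2 * z b)) / (z k - q * z b) := by
  have h0 := hz k hk b hb
  rw [eq_div_iff h0]
  have hbm : b ∈ Finset.range N := Finset.mem_range.mpr hb
  rcases lt_trichotomy k b with h | h | h
  · have h1 : kd N z (b + 1) k * (z k - q * z b) = kd N z b k * (z k - z b) := by
      rw [kd, kd, ← Finset.mul_prod_erase _ _ hbm, ← Finset.mul_prod_erase _ _ hbm]
      rw [if_pos (Nat.lt_succ_self b), if_neg (lt_irrefl b), if_neg (by omega)]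
      have : ∏ i ∈ (Finset.range N).erase b, (if i < b + 1 then (if i = k then 1 else z k - z i)
          else z k - q * z i) = ∏ i ∈ (Finset.range N).erase b,
          (if i < b then (if i = k then 1 else z k - z i) else z k - q * z i) := by
        apply Finset.prod_congr rfl
        intro i hi
        have hne : i ≠ b := Finset.ne_of_mem_erase hi
        by_cases h5 : i < b
        · rw [if_pos h5, if_pos (by omega)]
        · rw [if_neg h5, if_neg (by omega)]
      rw [this]; ring
    rw [kr, kr, if_pos h, if_pos (by omega)]
    have h2 := kd_ne hinj hz (b := b) hk
    have h3 := kd_ne hinj hz (b := b + 1) hk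
    have h4 : (kd N z b k)⁻¹ * (z k - q * z b) = (kd N z (b + 1) k)⁻¹ * (z k - z b) := by
      field_simp
      linear_combination h1
    rw [add_mul, h4]
    linear_combination (kd N z (b + 1) k)⁻¹ * ((z k - z b) * q_sum - q * z b * q_cubed)
  · subst h
    rw [kr, kr, if_neg (lt_irrefl _), if_pos (Nat.lt_succ_self _)]
    linear_combination (kd N z (k + 1) k)⁻¹ * z k * (-q * q_cubed)
  · rw [kr, kr, if_neg (by omega), if_neg (by omega)]
    ring

theorem SS_smul (N m : ℕ) (z : ℕ → ℂ) (c : Fin m → ℂ) (K : Fin m → ℕ → ℂ) :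
    SS N m z (fun l k => c l * K l k) = (∏ l, c l) * SS N m z K := by
  rw [SS, SS, Finset.mul_sum]
  apply Finset.sum_congr rfl
  intro κ _
  rw [Finset.prod_mul_distrib]; ring

theorem SS_congr (N m : ℕ) (z : ℕ → ℂ) {K K' : Fin m → ℕ → ℂ}
    (h : ∀ l, ∀ k < N, K l k = K' l k) : SS N m z K = SS N m z K' := by
  rw [SS, SS]
  apply Finset.sum_congr rfl
  intro κ hκ
  rw [Fintype.mem_piFinset] at hκ
  congr 1
  apply Finset.prod_congr rfl
  intro l _
  exact h l _ (Finset.mem_range.mp (hκ l))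

theorem Ipol_SS {m : ℕ} {z : ℕ → ℂ} (hinj : Set.InjOn z (Finset.range (2 * m)))
    (hz : ∀ i < 2 * m, ∀ j < 2 * m, z i - q * z j ≠ 0) :
    eval z (Ipol m) = DD (2 * m) z * SS (2 * m) m z (fun l k => kr (2 * m) z (2 * (l : ℕ) + 1) k +
      q * kr (2 * m) z (2 * (l : ℕ) + 1 + 1) k) := by
  rw [Ipol, map_sum]
  have h1 : ∀ ε ∈ Eset m, eval z (C (q ^ (∑ l, ε l)) * Ppol (Finset.range (2 * m))
      (Finset.univ : Finset (Fin m)) (fun l => 2 * (l : ℕ) + 1 + ε l)) =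
      ∑ κ ∈ Fintype.piFinset (fun _ : Fin m => Finset.range (2 * m)),
        DD (2 * m) z * (prs Finset.univ z κ *
          ∏ l, (q ^ ε l * kr (2 * m) z (2 * (l : ℕ) + 1 + ε l) (κ l))) := by
    intro ε _
    rw [map_mul, eval_C, Ppol_SS hinj hz, SS, Finset.mul_sum, Finset.mul_sum]
    apply Finset.sum_congr rfl
    intro κ _
    rw [Finset.prod_mul_distrib, Finset.prod_pow_eq_pow_sum]
    ring
  rw [Finset.sum_congr rfl h1, Finset.sum_comm, SS, Finset.mul_sum]
  apply Finset.sum_congr rfl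
  intro κ _
  rw [← Finset.mul_sum, ← Finset.mul_sum, Eset,
    ← Finset.prod_univ_sum (fun _ => Finset.range 2)
      (fun (l : Fin m) e => q ^ e * kr (2 * m) z (2 * (l : ℕ) + 1 + e) (κ l))]
  congr 2
  apply Finset.prod_congr rfl
  intro l _
  rw [Finset.sum_range_succ, Finset.sum_range_one]
  simp

theorem prod_ite_ne {N k : ℕ} (hk : k < N) (g : ℕ → ℂ) (h : g k ≠ 0) :
    (∏ i ∈ Finset.range N, if i = k then 1 else g i) = (∏ i ∈ Finset.range N, g i) / g k := by
  rw [eq_div_iff h]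
  have hm : k ∈ Finset.range N := Finset.mem_range.mpr hk
  rw [← Finset.mul_prod_erase _ _ hm, ← Finset.mul_prod_erase _ g hm, if_pos rfl, one_mul, mul_comm]
  congr 1
  apply Finset.prod_congr rfl
  intro i hi
  rw [if_neg (Finset.ne_of_mem_erase hi)]

noncomputable def Hpol (m : ℕ) : MvPolynomial ℕ ℂ := (Hpol_exists m).choose

theorem Hpol_spec1 {m : ℕ} {z : ℕ → ℂ} (hinj : Set.InjOn z (Finset.range (2 * m)))
    (hz : ∀ i < 2 * m, ∀ j < 2 * m, z i - q * z j ≠ 0)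
    (h1 : ∀ l < m, z (2 * m + l) = z (2 * l + 1)) (h2 : ∀ l < m, z (3 * m + l) = z (2 * l + 1)) :
    eval z (Hpol m) * (-q ^ 2) ^ m =
      (∏ l : Fin m, ∏ i ∈ Finset.range (2 * m), (z i - q * z (2 * (l : ℕ) + 1))) *
        eval z (Ipol m) := by
  rw [Hpol, (Hpol_exists m).choose_spec z hinj hz, Ipol_SS hinj hz]
  have e1 : (-q ^ 2) ^ m = ∏ _l : Fin m, (-q ^ 2) := by simp
  rw [e1, mul_right_comm, mul_assoc, ← SS_smul, mul_left_comm, ← SS_smul]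
  congr 1
  apply SS_congr
  intro l k hk
  have hl := l.2
  rw [kr_id hinj hz (by omega) hk, h1 l hl, h2 l hl,
    prod_ite_ne hk (fun i => z i - q * z (2 * (l : ℕ) + 1)) (hz _ hk _ (by omega))]
  ring

theorem DD_ext {N : ℕ} (x z : ℕ → ℂ) (hx : ∀ i < N, x (i + 1) = z i) :
    DD (N + 2) x = DD N z * (∏ j ∈ Finset.range N, (x 0 - q * z j)) *
      ((∏ i ∈ Finset.range N, (z i - q * x (N + 1))) * (x 0 - q * x (N + 1))) := by
  rw [DD, Finset.prod_range_succ, Finset.prod_range_succ' _ N, Finset.prod_range_succ' _ N]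
  simp only [Finset.range_zero, Finset.prod_empty, mul_one]
  congr 1
  · rw [DD, ← Finset.prod_mul_distrib]
    apply Finset.prod_congr rfl
    intro j hj
    rw [Finset.mem_range] at hj
    rw [Finset.prod_range_succ', hx j hj]
    congr 1
    apply Finset.prod_congr rfl
    intro i hi
    rw [Finset.mem_range] at hi
    rw [hx i (by omega)]
  · congr 1
    apply Finset.prod_congr rfl
    intro i hi
    rw [hx i (Finset.mem_range.mp hi)]

theorem kd_ext {N : ℕ} (x z : ℕ → ℂ) (hx : ∀ i < N, x (i + 1) = z i) {b k : ℕ} (hb : b ≤ N) (hk : k < N) :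
    kd (N + 2) x (b + 1) (k + 1) = kd N z b k * ((z k - x 0) * (z k - q * x (N + 1))) := by
  rw [kd, Finset.prod_range_succ, Finset.prod_range_succ', kd, if_neg (show ¬ N + 1 < b + 1 by omega),
    if_pos (show 0 < b + 1 by omega), if_neg (show ¬ 0 = k + 1 by omega), hx k hk, mul_assoc]
  congr 1
  apply Finset.prod_congr rfl
  intro i hi
  rw [hx i (Finset.mem_range.mp hi)]
  simp

theorem kd_zero {N : ℕ} (x z : ℕ → ℂ) (hx : ∀ i < N, x (i + 1) = z i) :
    kd (N + 2) x 1 0 = (∏ j ∈ Finset.range N, (x 0 - q * z j)) * (x 0 - q * x (N + 1)) := by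
  rw [kd, Finset.prod_range_succ, Finset.prod_range_succ']
  simp only [zero_lt_one, if_true, mul_one]
  congr 1
  · apply Finset.prod_congr rfl
    intro i hi
    rw [hx i (Finset.mem_range.mp hi)]
    simp

theorem prs_ext {m : ℕ} (x z : ℕ → ℂ) (κ : Fin m → ℕ) (hx : ∀ l, x (κ l + 1) = z (κ l)) :
    prs Finset.univ x (Fin.cons 0 (fun l => κ l + 1) : Fin (m + 1) → ℕ) =
      (∏ l, ((z (κ l) - x 0) * (x 0 - q * z (κ l)))) * prs Finset.univ z κ := by
  rw [prs, prs]
  simp only [Finset.prod_filter]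
  rw [Fin.prod_univ_succ]
  congr 1
  · rw [Fin.prod_univ_succ]
    simp [hx]
  · apply Finset.prod_congr rfl
    intro l _
    rw [Fin.prod_univ_succ]
    simp [hx]

theorem SS_ext {m : ℕ} (x z : ℕ → ℂ) (hx : ∀ i < 2 * m, x (i + 1) = z i)
    (h0 : ∀ i < 2 * m, z i - x 0 ≠ 0) :
    SS (2 * m + 2) (m + 1) x (fun l k => kr (2 * m + 2) x (2 * (l : ℕ) + 1) k) =
      (kd (2 * m + 2) x 1 0)⁻¹ * SS (2 * m) m z (fun l k => kr (2 * m) z (2 * (l : ℕ) + 2) k *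
        (x 0 - q * z k) / (z k - q * x (2 * m + 1))) := by
  rw [SS, SS, Finset.mul_sum]
  symm
  apply Finset.sum_of_injOn (fun κ : Fin m → ℕ => (Fin.cons 0 (fun l => κ l + 1) : Fin (m + 1) → ℕ))
  · intro κ _ κ' _ h
    funext l
    have := congrFun h l.succ
    simpa using this
  · intro κ hκ
    simp only [Finset.mem_coe, Fintype.mem_piFinset, Finset.mem_range] at hκ ⊢
    intro l
    refine Fin.cases ?_ (fun l => ?_) l
    · simp
    · have := hκ l
      simp only [Fin.cons_succ]; omega
  · intro κ' hκ' hni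
    by_contra hne
    apply hni
    have hp := left_ne_zero_of_mul hne
    have hk := right_ne_zero_of_mul hne
    rw [Finset.prod_ne_zero_iff] at hk
    have hlt : ∀ l : Fin (m + 1), κ' l < 2 * (l : ℕ) + 1 := by
      intro l
      by_contra h
      exact hk l (Finset.mem_univ l) (by rw [kr, if_neg h])
    have hinj : Function.Injective κ' := by
      by_contra h
      apply hp
      apply prs_zero_of_not_inj
      simpa [Set.injOn_univ] using h
    have hz0 : κ' 0 = 0 := by have := hlt 0; simp at this; exact this
    have hpos : ∀ l : Fin m, κ' l.succ ≠ 0 := by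
      intro l h
      have := hinj (h.trans hz0.symm)
      exact Fin.succ_ne_zero l this
    refine ⟨fun l => κ' l.succ - 1, ?_, ?_⟩
    · simp only [Finset.mem_coe, Fintype.mem_piFinset, Finset.mem_range]
      intro l
      have h1 := hlt l.succ
      have h2 := hpos l
      have h3 := l.2
      rw [Fin.val_succ] at h1
      omega
    · funext l
      refine Fin.cases ?_ (fun l => ?_) l
      · simp [hz0]
      · have := hpos l
        simp only [Fin.cons_succ]; omega
  · intro κ hκ
    simp only [Fintype.mem_piFinset, Finset.mem_range] at hκ
    rw [prs_ext x z κ (fun l => hx _ (hκ l)), Fin.prod_univ_succ]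
    simp only [Fin.cons_zero, Fin.cons_succ, Fin.val_zero, Fin.val_succ, mul_zero, zero_add]
    have e1 : kr (2 * m + 2) x 1 0 = (kd (2 * m + 2) x 1 0)⁻¹ := by rw [kr, if_pos zero_lt_one]
    rw [e1]
    have e2 : (∏ l, ((z (κ l) - x 0) * (x 0 - q * z (κ l)))) *
        ∏ l : Fin m, kr (2 * m + 2) x (2 * ((l : ℕ) + 1) + 1) (κ l + 1) =
        ∏ l : Fin m, (kr (2 * m) z (2 * (l : ℕ) + 2) (κ l) *
        (x 0 - q * z (κ l)) / (z (κ l) - q * x (2 * m + 1))) := by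
      rw [← Finset.prod_mul_distrib]
      apply Finset.prod_congr rfl
      intro l _
      have e3 : 2 * ((l : ℕ) + 1) + 1 = (2 * (l : ℕ) + 2) + 1 := by ring
      have hl := l.2
      have h1 := h0 _ (hκ l)
      rw [e3, kr, kr, kd_ext x z hx (by omega) (hκ l)]
      by_cases h : κ l < 2 * (l : ℕ) + 2
      · rw [if_pos h, if_pos (by omega), mul_inv, mul_inv, div_eq_mul_inv]
        field_simp
      · rw [if_neg h, if_neg (by omega)]
        simp
    rw [← e2]
    ring

theorem Hpol_spec2 {m : ℕ} {x z : ℕ → ℂ} (hx : ∀ i < 2 * m, x (i + 1) = z i)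
    (hinj : Set.InjOn x (Finset.range (2 * m + 2)))
    (hxq : ∀ i < 2 * m + 2, ∀ j < 2 * m + 2, x i - q * x j ≠ 0)
    (h1 : ∀ l < m, z (2 * m + l) = x (2 * m + 1)) (h2 : ∀ l < m, z (3 * m + l) = x 0) :
    eval z (Hpol m) * (-q) ^ m * ∏ i ∈ Finset.range (2 * m), (z i - q * x (2 * m + 1)) =
      (∏ i ∈ Finset.range (2 * m), (z i - q * x (2 * m + 1))) ^ m * eval x (Pmax (m + 1)) := by
  have hzinj : Set.InjOn z (Finset.range (2 * m)) := by
    intro i hi j hj h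
    simp only [Finset.coe_range, Set.mem_Iio] at hi hj
    rw [← hx i hi, ← hx j hj] at h
    have := hinj (by simp; omega) (by simp; omega) h
    omega
  have hzq : ∀ i < 2 * m, ∀ j < 2 * m, z i - q * z j ≠ 0 := by
    intro i hi j hj
    rw [← hx i hi, ← hx j hj]
    exact hxq _ (by omega) _ (by omega)
  have h0 : ∀ i < 2 * m, z i - x 0 ≠ 0 := by
    intro i hi h
    rw [sub_eq_zero, ← hx i hi] at h
    have := hinj (by simp; omega) (by simp) h
    omega
  have hP : eval x (Pmax (m + 1)) = DD (2 * m + 2) x *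
      SS (2 * m + 2) (m + 1) x (fun l k => kr (2 * m + 2) x (2 * (l : ℕ) + 1) k) :=
    Ppol_SS (N := 2 * m + 2) (m := m + 1) (b := fun l => 2 * (l : ℕ) + 1) hinj hxq
  rw [hP, SS_ext x z hx h0, DD_ext x z hx, kd_zero x z hx, Hpol,
    (Hpol_exists m).choose_spec z hzinj hzq]
  have n1 : (∏ j ∈ Finset.range (2 * m), (x 0 - q * z j)) ≠ 0 := by
    rw [Finset.prod_ne_zero_iff]
    intro j hj
    rw [← hx j (Finset.mem_range.mp hj)]
    rw [Finset.mem_range] at hj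
    exact hxq _ (by omega) _ (by omega)
  have n2 : x 0 - q * x (2 * m + 1) ≠ 0 := hxq _ (by omega) _ (by omega)
  set A := ∏ i ∈ Finset.range (2 * m), (z i - q * x (2 * m + 1)) with hA
  have e1 : SS (2 * m) m z (fun l k => kr (2 * m) z (2 * (l : ℕ) + 2) k *
      ((z k - q ^ 2 * z (3 * m + l)) *
        ∏ i ∈ Finset.range (2 * m), if i = k then 1 else z i - q * z (2 * m + l))) * (-q) ^ m =
      A ^ m * SS (2 * m) m z (fun l k => kr (2 * m) z (2 * (l : ℕ) + 2) k *
        (x 0 - q * z k) / (z k - q * x (2 * m + 1))) := by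
    have c1 : (-q) ^ m = ∏ _l : Fin m, (-q) := by simp
    have c2 : A ^ m = ∏ _l : Fin m, A := by simp
    rw [mul_comm, c1, c2, ← SS_smul, ← SS_smul]
    apply SS_congr
    intro l k hk
    have n3 : z k - q * x (2 * m + 1) ≠ 0 := by
      rw [← hx k hk]
      exact hxq _ (by omega) _ (by omega)
    rw [h1 l l.2, h2 l l.2, prod_ite_ne hk (fun i => z i - q * x (2 * m + 1)) n3, ← hA]
    field_simp
    linear_combination (kr (2 * m) z (2 * (l : ℕ) + 2) k * A * x 0) * q_cubed
  rw [mul_assoc (DD (2 * m) z), e1]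
  field_simp

noncomputable def pth (a : ℕ → ℕ) (t : ℝ) (i : ℕ) : ℂ := 1 + (t : ℂ) * (a i : ℂ)

theorem pth_zero (a : ℕ → ℕ) : pth a 0 = fun _ => 1 := by funext i; simp [pth]

theorem pth_cont (a : ℕ → ℕ) (i : ℕ) : Continuous fun t => pth a t i := by
  unfold pth; fun_prop

theorem pth_q (a : ℕ → ℕ) {t : ℝ} (ht : 0 < t) (i j : ℕ) : pth a t i - q * pth a t j ≠ 0 := by
  intro h
  rw [sub_eq_zero] at h
  have hr : ∀ k, pth a t k = ((1 + t * a k : ℝ) : ℂ) := by intro k; simp [pth]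
  have hp : ∀ k, (0 : ℝ) < 1 + t * a k := fun k => by positivity
  rw [hr, hr] at h
  have h1 := congrArg norm h
  rw [norm_mul, norm_q, one_mul, Complex.norm_real, Complex.norm_real, Real.norm_of_nonneg (hp i).le,
    Real.norm_of_nonneg (hp j).le] at h1
  rw [h1] at h
  have h2 : ((1 + t * a j : ℝ) : ℂ) ≠ 0 := by exact_mod_cast (hp j).ne'
  apply q_ne_one
  apply mul_right_cancel₀ h2
  rw [← h, one_mul]

theorem pth_inj (a : ℕ → ℕ) {t : ℝ} (ht : 0 < t) {i j : ℕ} (h : pth a t i = pth a t j) : a i = a j := by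
  unfold pth at h
  have h1 : (t : ℂ) ≠ 0 := by exact_mod_cast ht.ne'
  have h2 := mul_left_cancel₀ h1 (add_left_cancel h)
  exact_mod_cast h2

theorem Hone1 (m : ℕ) : eval (fun _ => 1) (Hpol m) * (-q ^ 2) ^ m =
    ((1 - q) ^ (2 * m)) ^ m * eval (fun _ => 1) (Ipol m) := by
  set a : ℕ → ℕ := fun i => if i < 2 * m then i else if i < 3 * m then 2 * (i - 2 * m) + 1
    else 2 * (i - 3 * m) + 1 with ha
  have := cont_pos (F := fun t => eval (pth a t) (Hpol m) * (-q ^ 2) ^ m -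
      (∏ l : Fin m, ∏ i ∈ Finset.range (2 * m), (pth a t i - q * pth a t (2 * (l : ℕ) + 1))) *
        eval (pth a t) (Ipol m)) ?_ ?_
  · simp only [pth_zero, mul_one, Finset.prod_const, Finset.card_range, Finset.card_univ,
      Fintype.card_fin] at this
    exact sub_eq_zero.mp this
  · have h1 := cont_path (Hpol m) (pth a) (pth_cont a)
    have h2 := cont_path (Ipol m) (pth a) (pth_cont a)
    have h3 := pth_cont a
    fun_prop
  · intro t ht
    rw [sub_eq_zero]
    apply Hpol_spec1
    · intro i hi j hj h
      simp only [Finset.coe_range, Set.mem_Iio] at hi hj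
      have := pth_inj a ht h
      simpa [ha, hi, hj] using this
    · intro i _ j _; exact pth_q a ht i j
    · intro l hl
      have : a (2 * m + l) = a (2 * l + 1) := by simp only [ha]; split_ifs <;> omega
      simp only [pth, this]
    · intro l hl
      have : a (3 * m + l) = a (2 * l + 1) := by simp only [ha]; split_ifs <;> omega
      simp only [pth, this]

theorem Hone2 (m : ℕ) : eval (fun _ => 1) (Hpol m) * (-q) ^ m * (1 - q) ^ (2 * m) =
    ((1 - q) ^ (2 * m)) ^ m * eval (fun _ => 1) (Pmax (m + 1)) := by
  set a : ℕ → ℕ := fun i => if i < 2 * m then i + 1 else if i < 3 * m then 2 * m + 1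
    else 0 with ha
  have := cont_pos (F := fun t => eval (pth a t) (Hpol m) * (-q) ^ m *
      ∏ i ∈ Finset.range (2 * m), (pth a t i - q * pth id t (2 * m + 1)) -
      (∏ i ∈ Finset.range (2 * m), (pth a t i - q * pth id t (2 * m + 1))) ^ m *
        eval (pth id t) (Pmax (m + 1))) ?_ ?_
  · simp only [pth_zero, mul_one, Finset.prod_const, Finset.card_range] at this
    exact sub_eq_zero.mp this
  · have h1 := cont_path (Hpol m) (pth a) (pth_cont a)
    have h2 := cont_path (Pmax (m + 1)) (pth id) (pth_cont id)
    have h3 := pth_cont a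
    have h4 := pth_cont id
    fun_prop
  · intro t ht
    rw [sub_eq_zero]
    apply Hpol_spec2
    · intro i hi
      simp only [pth, id, ha, if_pos hi]
    · intro i _ j _ h
      exact pth_inj id ht h
    · intro i _ j _; exact pth_q id ht i j
    · intro l hl
      have : a (2 * m + l) = 2 * m + 1 := by simp only [ha]; split_ifs <;> omega
      simp only [pth, this, id]
    · intro l hl
      have : a (3 * m + l) = 0 := by simp only [ha]; split_ifs <;> omega
      simp only [pth, this, id]

theorem Pmax_one (m : ℕ) : eval (fun _ => 1) (Pmax (m + 1)) =
    (-3) ^ (∑ i ∈ Finset.range (m + 1), i) * ASM m := by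
  have h1 := Hone1 m
  have h2 := Hone2 m
  have hq : (1 : ℂ) - q ≠ 0 := sub_ne_zero.mpr q_ne_one.symm
  have h3 : (-3 : ℂ) ^ m * (-q ^ 2) ^ m = (-q) ^ m * (1 - q) ^ (2 * m) := by
    rw [pow_mul, ← mul_pow, ← mul_pow]
    congr 1
    linear_combination q * q_sum
  have hq2 : (-q ^ 2 : ℂ) ^ m ≠ 0 := pow_ne_zero _ (neg_ne_zero.mpr (pow_ne_zero _ q_ne_zero))
  rw [Finset.sum_range_succ, pow_add, mul_right_comm, ← Ipol_one]
  apply mul_left_cancel₀ (pow_ne_zero m (pow_ne_zero (2 * m) hq))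
  apply mul_right_cancel₀ hq2
  linear_combination (-(-q ^ 2) ^ m) * h2 + (-q) ^ m * (1 - q) ^ (2 * m) * h1 -
    ((1 - q) ^ (2 * m)) ^ m * eval (fun _ => 1) (Ipol m) * h3

/-- Theorem 1.5(3) / end of Section 2.2: `Ψ_{π_max}(1,…,1) = ASM(n-1)`, where
`π_max` consists of the `n` little arcs `(2j-1, 2j)`. -/
theorem psi_max_value (n : ℕ) (hn : 1 ≤ n)
    (Ψ : NCM n → MvPolynomial (Fin (2 * n)) ℂ)
    (hwheel : ∀ π, IsWheel n (Ψ π))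
    (hdual : ∀ π σ : NCM n, evalNC (Ψ π) σ = if σ = π then 1 else 0)
    (πmax : NCM n)
    (hmax : ∀ j : Fin n,
      (πmax.f ⟨2 * (j : ℕ), by have := j.isLt; omega⟩ : ℕ) = 2 * (j : ℕ) + 1) :
    evalOne (Ψ πmax) = ASM (n - 1) := by
  have h := psi_eq n (Ψ πmax) (hwheel πmax) πmax (hdual πmax) (fun j hj => hmax ⟨j, hj⟩)
  obtain ⟨m, rfl⟩ : ∃ m, n = m + 1 := ⟨n - 1, by omega⟩
  rw [Pmax_one, mul_comm] at h
  rw [Nat.add_sub_cancel]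
  exact mul_left_cancel₀ (pow_ne_zero _ (by norm_num)) h
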